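/- The orbit space Gr(2,ℂ⁵)/T of the compact torus action on the complex Grassmannian of 2-planes in ℂ⁵ has integral singular homology groups H_i(Gr(2,ℂ⁵)/T; ℤ) ≅ ℤ for i = 0 and i = 8, H_5(Gr(2,ℂ⁵)/T; ℤ) ≅ ℤ/2ℤ, and H_i(Gr(2,ℂ⁵)/T; ℤ) = 0 for all other i. -/

import Mathlib

/-!
The orbit space `Gr(2,ℂ⁵)/T` of the compact torus
`T = {(s₁,…,s₅) ∈ (S¹)⁵ : s₁⋯s₅ = 1}` acting on the Grassmannian of 2-planes in `ℂ⁵`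
has integral singular homology `ℤ` in degrees 0 and 8, `ℤ/2ℤ` in degree 5, and `0` else.

We model `Gr(2,ℂ⁵)` via the Plücker embedding: the Grassmannian is the image in
`ℙ(Λ²ℂ⁵)` of the cone of nonzero decomposable tensors (described by Plücker
coordinates of rank-2 matrices), and the orbit space `Gr(2,ℂ⁵)/T` is the quotient
of this cone by simultaneous rescaling by a nonzero scalar (projectivization)
and the torus action `p i j ↦ tᵢ tⱼ p i j`, equipped with the quotient topology.

Singular homology with integer coefficients is defined as the homology of the
alternating face map complex of the free simplicial `ℤ`-module on the singular
simplicial set of the space.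
-/

open CategoryTheory AlgebraicTopology

noncomputable section

/-- The Plücker coordinates of (the row space of) a `2 × 5` complex matrix. -/
def pluecker (M : Matrix (Fin 2) (Fin 5) ℂ) : Fin 5 → Fin 5 → ℂ :=
  fun i j => M 0 i * M 1 j - M 0 j * M 1 i

/-- The affine cone over the Plücker-embedded Grassmannian `Gr(2,ℂ⁵)`, with the
origin removed: all nonzero vectors of Plücker coordinates. -/
def plueckerCone : Set (Fin 5 → Fin 5 → ℂ) :=
  {p | p ≠ 0 ∧ ∃ M : Matrix (Fin 2) (Fin 5) ℂ, pluecker M = p}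

/-- The compact torus `T = {(s₁,…,s₅) ∈ (S¹)⁵ : s₁ s₂ s₃ s₄ s₅ = 1}`. -/
def torusT : Set (Fin 5 → ℂ) := {t | (∀ i, ‖t i‖ = 1) ∧ (∏ i, t i) = 1}

/-- Two nonzero Plücker vectors represent the same point of `Gr(2,ℂ⁵)/T` iff they
differ by a nonzero scalar (projectivization) together with the induced action of
an element of the compact torus `T` on the Plücker coordinates. -/
def grassmannTRel (p q : plueckerCone) : Prop :=
  ∃ c : ℂ, c ≠ 0 ∧ ∃ t ∈ torusT, ∀ i j, (q : Fin 5 → Fin 5 → ℂ) i j =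
    c * t i * t j * (p : Fin 5 → Fin 5 → ℂ) i j

/-- The orbit space `Gr(2,ℂ⁵)/T`, with the quotient topology. -/
def GrModT : Type := Quot grassmannTRel

instance : TopologicalSpace GrModT :=
  inferInstanceAs (TopologicalSpace (Quot grassmannTRel))

/-- The complex of singular chains with integer coefficients on a topological
space `X`: the alternating face map complex of the free simplicial `ℤ`-module on
the singular simplicial set of `X`. -/
def singularChainComplex (X : Type) [TopologicalSpace X] : ChainComplex (ModuleCat ℤ) ℕ :=
  (alternatingFaceMapComplex (ModuleCat ℤ)).obj
    (((SimplicialObject.whiskering (Type) (ModuleCat ℤ)).obj (ModuleCat.free ℤ)).obj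
      (TopCat.toSSet.obj (TopCat.of X)))

/-- The `i`-th integral singular homology group of a topological space `X`. -/
def singularHomology (X : Type) [TopologicalSpace X] (i : ℕ) : ModuleCat ℤ :=
  (singularChainComplex X).homology i

namespace GT

/-- The standard simplex with `n` vertices. -/
abbrev Dl (n : ℕ) := stdSimplex ℝ (Fin n)

/-- Singular chains on simplices with `n` vertices (so degree `n - 1`), including `n = 0`. -/
abbrev Ch (n : ℕ) (X : Type) [TopologicalSpace X] := C(Dl n, X) →₀ ℤ

variable {X Y Z : Type} [TopologicalSpace X] [TopologicalSpace Y] [TopologicalSpace Z]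

/-- The `i`-th face inclusion. -/
def face {n : ℕ} (i : Fin (n + 1)) : C(Dl n, Dl (n + 1)) :=
  ⟨stdSimplex.map i.succAbove, stdSimplex.continuous_map _⟩

/-- Pushforward of chains. -/
def mapc (f : C(X, Y)) (n : ℕ) : Ch n X →ₗ[ℤ] Ch n Y :=
  Finsupp.lmapDomain ℤ ℤ (fun σ => f.comp σ)

@[simp] lemma mapc_single (f : C(X, Y)) (n : ℕ) (σ : C(Dl n, X)) (a : ℤ) :
    mapc f n (Finsupp.single σ a) = Finsupp.single (f.comp σ) a := by
  simp [mapc]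

lemma mapc_mapc (g : C(Y, Z)) (f : C(X, Y)) (n : ℕ) (c : Ch n X) :
    mapc g n (mapc f n c) = mapc (g.comp f) n c := by
  induction c using Finsupp.induction_linear with
  | zero => simp
  | add a b ha hb => simp [ha, hb]
  | single σ a => simp [ContinuousMap.comp_assoc]

lemma mapc_id (n : ℕ) (c : Ch n X) : mapc (ContinuousMap.id X) n c = c := by
  induction c using Finsupp.induction_linear with
  | zero => simp
  | add a b ha hb => simp [ha, hb]
  | single σ a => simp

/-- Linear extension of a function on simplices. -/
def ext (n : ℕ) {M : Type} [AddCommGroup M] (φ : C(Dl n, X) → M) : Ch n X →ₗ[ℤ] M :=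
  Finsupp.linearCombination ℤ φ

@[simp] lemma ext_single (n : ℕ) {M : Type} [AddCommGroup M] (φ : C(Dl n, X) → M) (σ) (a : ℤ) :
    ext n φ (Finsupp.single σ a) = a • φ σ := by
  simp [ext]

/-- The boundary. -/
def bd (n : ℕ) : Ch (n + 1) X →ₗ[ℤ] Ch n X :=
  ext (n + 1) fun σ => ∑ i : Fin (n + 1), (-1 : ℤ) ^ (i : ℕ) • Finsupp.single (σ.comp (face i)) 1

lemma bd_single (n : ℕ) (σ : C(Dl (n + 1), X)) (a : ℤ) : bd n (Finsupp.single σ a) =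
    a • ∑ i : Fin (n + 1), (-1 : ℤ) ^ (i : ℕ) • Finsupp.single (σ.comp (face i)) 1 := by
  simp [bd]

lemma bd_mapc (f : C(X, Y)) (n : ℕ) (c : Ch (n + 1) X) :
    bd n (mapc f (n + 1) c) = mapc f n (bd n c) := by
  induction c using Finsupp.induction_linear with
  | zero => simp
  | add a b ha hb => simp only [map_add, ha, hb]
  | single σ a => simp [bd_single, ContinuousMap.comp_assoc]

lemma succAbove_comp {n : ℕ} {i j : Fin (n + 1)} (h : i ≤ j) (k : Fin n) :
    i.castSucc.succAbove (j.succAbove k) = j.succ.succAbove (i.succAbove k) := by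
  simp only [Fin.succAbove]
  rcases i with ⟨i, _⟩
  rcases j with ⟨j, _⟩
  rcases k with ⟨k, _⟩
  split_ifs <;> · simp at * <;> lia

lemma face_comp_face {n : ℕ} {i j : Fin (n + 1)} (h : i ≤ j) :
    (face i.castSucc).comp (face j) = (face j.succ).comp (face i) := by
  ext1 x
  simp only [face, ContinuousMap.comp_apply, ContinuousMap.coe_mk]
  rw [stdSimplex.map_comp_apply, stdSimplex.map_comp_apply]
  congr 1
  ext k
  simp [succAbove_comp h]

/-- The sign cancellation behind `d ∘ d = 0`. -/
lemma alt_sum_zero {n : ℕ} {M : Type*} [AddCommGroup M] (F : Fin (n + 2) → Fin (n + 1) → M)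
    (hF : ∀ i j : Fin (n + 1), i ≤ j → F i.castSucc j = F j.succ i) :
    ∑ i : Fin (n + 2), ∑ j : Fin (n + 1), ((-1 : ℤ) ^ (i : ℕ) * (-1 : ℤ) ^ (j : ℕ)) • F i j = 0 := by
  rw [← Finset.sum_product']
  let g : Fin (n + 2) × Fin (n + 1) → Fin (n + 2) × Fin (n + 1) := fun p =>
    if h : (p.1 : ℕ) ≤ p.2 then (p.2.succ, ⟨p.1, by omega⟩)
    else (p.2.castSucc, ⟨p.1 - 1, by omega⟩)
  refine Finset.sum_involution (fun p _ => g p) ?_ ?_ (fun _ _ => by simp) ?_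
  · rintro ⟨i, j⟩ -
    by_cases h : (i : ℕ) ≤ j
    · have := hF ⟨i, by omega⟩ j h
      simp only [g, h, dite_true]
      have h2 : F i j = F j.succ ⟨i, by omega⟩ := this
      rw [h2, ← add_smul]
      simp [pow_succ, mul_comm]
    · have := hF j ⟨i - 1, by omega⟩ (by simp [Fin.le_def]; omega)
      simp only [g, h, dite_false]
      have h3 : (⟨i - 1, by omega⟩ : Fin (n + 1)).succ = i := by ext; simp; omega
      rw [h3] at this
      rw [← this, ← add_smul]
      obtain ⟨m, hm⟩ : ∃ m, (i : ℕ) = m + 1 := ⟨i - 1, by omega⟩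
      simp [hm, pow_succ, mul_comm]
  · rintro ⟨i, j⟩ - - heq
    by_cases h : (i : ℕ) ≤ j
    · simp only [g, h, dite_true, Prod.mk.injEq, Fin.ext_iff, Fin.val_succ] at heq
      omega
    · simp only [g, h, dite_false, Prod.mk.injEq, Fin.ext_iff, Fin.val_castSucc] at heq
      omega
  · rintro ⟨i, j⟩ -
    by_cases h : (i : ℕ) ≤ j
    · have h2 : ¬ ((j : ℕ) + 1 ≤ i) := by omega
      simp [g, h, h2]
    · have h2 : (j : ℕ) ≤ i - 1 := by omega
      simp only [g, h, dite_false, Fin.val_castSucc, h2, dite_true]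
      ext <;> simp
      omega

lemma bd_bd (n : ℕ) (c : Ch (n + 2) X) : bd n (bd (n + 1) c) = 0 := by
  induction c using Finsupp.induction_linear with
  | zero => simp
  | add a b ha hb => simp only [map_add, ha, hb, add_zero]
  | single σ a =>
    simp only [bd_single, map_smul, map_sum, Finset.smul_sum, smul_smul]
    rw [← smul_zero a, ← alt_sum_zero
      (fun i j => Finsupp.single ((σ.comp (face i)).comp (face j)) (1 : ℤ)) ?_]
    · simp only [Finset.smul_sum, smul_smul, mul_assoc, one_mul]
    · intro i j h
      simp only [ContinuousMap.comp_assoc, face_comp_face h]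

/-! ### Affine chains -/

/-- Formal combinations of tuples of points of a set `K`. -/
abbrev Af (m : ℕ) (K : Type) := (Fin m → K) →₀ ℤ

variable {K K' : Type}

/-- Boundary of affine chains. -/
def bdA (n : ℕ) : Af (n + 1) K →ₗ[ℤ] Af n K :=
  Finsupp.linearCombination ℤ fun w =>
    ∑ i : Fin (n + 1), (-1 : ℤ) ^ (i : ℕ) • Finsupp.single (fun k => w (i.succAbove k)) (1 : ℤ)

lemma bdA_single (n : ℕ) (w : Fin (n + 1) → K) (a : ℤ) : bdA n (Finsupp.single w a) =
    a • ∑ i : Fin (n + 1), (-1 : ℤ) ^ (i : ℕ) •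
      Finsupp.single (fun k => w (i.succAbove k)) (1 : ℤ) := by
  simp [bdA]

lemma bdA_bdA (n : ℕ) (c : Af (n + 2) K) : bdA n (bdA (n + 1) c) = 0 := by
  induction c using Finsupp.induction_linear with
  | zero => simp
  | add a b ha hb => simp only [map_add, ha, hb, add_zero]
  | single w a =>
    simp only [bdA_single, map_smul, map_sum, Finset.smul_sum, smul_smul]
    rw [← smul_zero a, ← alt_sum_zero
      (fun i j => Finsupp.single (fun k => w (i.succAbove (j.succAbove k))) (1 : ℤ)) ?_]
    · simp only [Finset.smul_sum, smul_smul, mul_assoc, one_mul]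
    · intro i j h
      simp only [succAbove_comp h]

/-- Cone operator. -/
def cone (b : K) (n : ℕ) : Af n K →ₗ[ℤ] Af (n + 1) K :=
  Finsupp.lmapDomain ℤ ℤ (fun w => Fin.cons b w)

lemma cone_single (b : K) (n : ℕ) (w : Fin n → K) (a : ℤ) :
    cone b n (Finsupp.single w a) = Finsupp.single (Fin.cons b w) a := by
  simp [cone]

lemma bdA_cone (b : K) (n : ℕ) (c : Af (n + 1) K) :
    bdA (n + 1) (cone b (n + 1) c) = c - cone b n (bdA n c) := by
  induction c using Finsupp.induction_linear with
  | zero => simp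
  | add x y hx hy => simp only [map_add, hx, hy]; abel
  | single w a =>
    rw [cone_single, bdA_single, bdA_single, Fin.sum_univ_succ]
    simp only [map_smul, map_sum, cone_single]
    have h0 : (fun k => (Fin.cons b w : Fin (n + 2) → K) ((0 : Fin (n + 2)).succAbove k)) = w := by
      ext k; simp
    have h1 : ∀ i : Fin (n + 1), (fun k => (Fin.cons b w : Fin (n + 2) → K) (i.succ.succAbove k)) =
        Fin.cons b (fun k => w (i.succAbove k)) := by
      intro i; ext k
      refine Fin.cases ?_ ?_ k
      · simp
      · intro k; simp
    simp only [h0, h1]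
    simp [smul_add, pow_succ, sub_eq_add_neg]

lemma bdA_cone_zero (b : K) (c : Af 0 K) : bdA 0 (cone b 0 c) = c := by
  induction c using Finsupp.induction_linear with
  | zero => simp
  | add x y hx hy => simp only [map_add, hx, hy]
  | single w a =>
    rw [cone_single, bdA_single]
    simp

/-- Pushforward of affine chains. -/
def mapA (f : K → K') (n : ℕ) : Af n K →ₗ[ℤ] Af n K' :=
  Finsupp.lmapDomain ℤ ℤ (fun w => f ∘ w)

lemma mapA_single (f : K → K') (n : ℕ) (w : Fin n → K) (a : ℤ) :
    mapA f n (Finsupp.single w a) = Finsupp.single (f ∘ w) a := by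
  simp [mapA]

lemma bdA_mapA (f : K → K') (n : ℕ) (c : Af (n + 1) K) :
    bdA n (mapA f (n + 1) c) = mapA f n (bdA n c) := by
  induction c using Finsupp.induction_linear with
  | zero => simp
  | add a b ha hb => simp only [map_add, ha, hb]
  | single w a => simp [bdA_single, mapA_single]; rfl

end GT

namespace GT
variable {X Y Z : Type} [TopologicalSpace X] [TopologicalSpace Y] [TopologicalSpace Z]

/-- The prism over the simplex with `n` vertices. -/
abbrev PrS (n : ℕ) : Set ((Fin n → ℝ) × ℝ) := stdSimplex ℝ (Fin n) ×ˢ Set.Icc (0 : ℝ) 1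

abbrev Pr (n : ℕ) := ↥(PrS n)

lemma convex_PrS (n : ℕ) : Convex ℝ (PrS n) := (convex_stdSimplex ℝ (Fin n)).prod (convex_Icc 0 1)

/-- The affine simplex with given vertices. -/
def aff {n m : ℕ} (w : Fin m → Pr n) : C(Dl m, Pr n) where
  toFun x := ⟨∑ i, x i • (w i : (Fin n → ℝ) × ℝ),
    (convex_PrS n).sum_mem (fun i _ => x.2.1 i) x.2.2 (fun i _ => (w i).2)⟩
  continuous_toFun := by
    refine Continuous.subtype_mk ?_ _
    refine continuous_finsetSum _ fun i _ => ?_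
    exact ((continuous_apply i).comp continuous_subtype_val).smul continuous_const

lemma aff_apply {n m : ℕ} (w : Fin m → Pr n) (x : Dl m) :
    (aff w x : (Fin n → ℝ) × ℝ) = ∑ i, x i • (w i : (Fin n → ℝ) × ℝ) := rfl

/-- Realization of affine chains. -/
def re {n : ℕ} (m : ℕ) : Af m (Pr n) →ₗ[ℤ] Ch m (Pr n) := Finsupp.lmapDomain ℤ ℤ aff

lemma re_single {n m : ℕ} (w : Fin m → Pr n) (a : ℤ) :
    re m (Finsupp.single w a) = Finsupp.single (aff w) a := by simp [re]

lemma map_sum_smul {p q : ℕ} {E : Type*} [AddCommGroup E] [Module ℝ E] (f : Fin p → Fin q)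
    (x : Dl p) (v : Fin q → E) :
    ∑ j, (stdSimplex.map f x) j • v j = ∑ i, x i • v (f i) := by
  have : ∀ j, (stdSimplex.map f x) j = ∑ i, if f i = j then x i else 0 := by
    intro j
    have := congrFun (stdSimplex.map_coe f x) j
    rw [this]
    simp [FunOnFinite.linearMap_apply_apply, Finset.sum_filter]
  simp only [this, Finset.sum_smul]
  rw [Finset.sum_comm]
  refine Finset.sum_congr rfl fun i _ => ?_
  simp [ite_smul]

lemma aff_face {n m : ℕ} (w : Fin (m + 1) → Pr n) (i : Fin (m + 1)) :
    (aff w).comp (face i) = aff (fun k => w (i.succAbove k)) := by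
  ext1 x
  apply Subtype.ext
  simp only [ContinuousMap.comp_apply, aff_apply]
  exact map_sum_smul _ _ _

lemma bd_re {n m : ℕ} (e : Af (m + 1) (Pr n)) : bd m (re (m + 1) e) = re m (bdA m e) := by
  induction e using Finsupp.induction_linear with
  | zero => simp
  | add a b ha hb => simp only [map_add, ha, hb]
  | single w a => simp [re_single, bd_single, bdA_single, aff_face]

/-- Face maps of prisms. -/
def kP {n : ℕ} (i : Fin (n + 1)) : C(Pr n, Pr (n + 1)) where
  toFun p := ⟨((stdSimplex.map i.succAbove ⟨p.1.1, p.2.1⟩ : Dl (n + 1)), p.1.2),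
    ⟨Subtype.property _, p.2.2⟩⟩
  continuous_toFun := by
    refine Continuous.subtype_mk ?_ _
    refine Continuous.prodMk ?_ (continuous_snd.comp continuous_subtype_val)
    exact continuous_subtype_val.comp ((stdSimplex.continuous_map _).comp
      ((continuous_fst.comp continuous_subtype_val).subtype_mk _))

lemma kP_fst {n : ℕ} (i : Fin (n + 1)) (p : Pr n) : ((kP i p).1.1 : Fin (n + 1) → ℝ) =
    FunOnFinite.linearMap ℝ ℝ i.succAbove p.1.1 := rfl

lemma kP_snd {n : ℕ} (i : Fin (n + 1)) (p : Pr n) : (kP i p).1.2 = p.1.2 := rfl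

lemma kP_comp {n : ℕ} {i j : Fin (n + 1)} (h : i ≤ j) (p : Pr n) :
    kP i.castSucc (kP j p) = kP j.succ (kP i p) := by
  apply Subtype.ext
  refine Prod.ext ?_ rfl
  have := congrArg (fun f => ((f ⟨p.1.1, p.2.1⟩ : Dl _) : Fin _ → ℝ)) (face_comp_face h)
  exact this

lemma aff_kP {n m : ℕ} (i : Fin (n + 1)) (w : Fin m → Pr n) :
    (kP i).comp (aff w) = aff (kP i ∘ w) := by
  ext1 x
  apply Subtype.ext
  refine Prod.ext ?_ ?_
  · simp only [ContinuousMap.comp_apply, kP_fst, aff_apply, Function.comp, Prod.fst_sum, map_sum,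
      Prod.smul_fst, map_smul]
  · simp only [ContinuousMap.comp_apply, kP_snd, aff_apply, Function.comp, Prod.snd_sum, 
      Prod.smul_snd]

lemma mapc_kP {n m : ℕ} (i : Fin (n + 1)) (e : Af m (Pr n)) :
    mapc (kP i) m (re m e) = re m (mapA (kP i) m e) := by
  induction e using Finsupp.induction_linear with
  | zero => simp
  | add a b ha hb => simp only [map_add, ha, hb]
  | single w a => simp [re_single, mapA_single, aff_kP]

/-- Extension of a simplex to the prism. -/
def hat {n : ℕ} (σ : C(Dl n, X)) : C(Pr n, X × unitInterval) where
  toFun p := (σ ⟨p.1.1, p.2.1⟩, ⟨p.1.2, p.2.2⟩)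
  continuous_toFun := by
    refine Continuous.prodMk (σ.continuous.comp ?_) ?_
    · exact (continuous_fst.comp continuous_subtype_val).subtype_mk _
    · exact (continuous_snd.comp continuous_subtype_val).subtype_mk _

lemma hat_face {n : ℕ} (σ : C(Dl (n + 1), X)) (i : Fin (n + 1)) :
    hat (σ.comp (face i)) = (hat σ).comp (kP i) := rfl

/-- `f × id`. -/
def timesI (f : C(X, Y)) : C(X × unitInterval, Y × unitInterval) :=
  f.prodMap (ContinuousMap.id _)

lemma hat_comp {n : ℕ} (σ : C(Dl n, X)) (f : C(X, Y)) :
    hat (f.comp σ) = (timesI f).comp (hat σ) := rfl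

/-- The natural operator defined by an affine chain of the prism. -/
def op {n m : ℕ} (e : Af m (Pr n)) : Ch n X →ₗ[ℤ] Ch m (X × unitInterval) :=
  ext n fun σ => mapc (hat σ) m (re m e)

lemma op_single {n m : ℕ} (e : Af m (Pr n)) (σ : C(Dl n, X)) (a : ℤ) :
    op e (Finsupp.single σ a) = a • mapc (hat σ) m (re m e) := by simp [op]

lemma op_bd {n m : ℕ} (e : Af (m + 1) (Pr n)) (c : Ch n X) : bd m (op e c) = op (bdA m e) c := by
  induction c using Finsupp.induction_linear with
  | zero => simp
  | add a b ha hb => simp only [map_add, ha, hb]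
  | single σ a => simp only [op_single, map_smul, bd_mapc, bd_re]

lemma op_add {n m : ℕ} (e e' : Af m (Pr n)) (c : Ch n X) : op (e + e') c = op e c + op e' c := by
  induction c using Finsupp.induction_linear with
  | zero => simp
  | add a b ha hb => simp only [map_add, ha, hb]; abel
  | single σ a => simp only [op_single, map_add, smul_add]

lemma op_sub {n m : ℕ} (e e' : Af m (Pr n)) (c : Ch n X) : op (e - e') c = op e c - op e' c := by
  rw [eq_sub_iff_add_eq, ← op_add, sub_add_cancel]

lemma op_zero {n m : ℕ} (c : Ch n X) : op (0 : Af m (Pr n)) c = 0 := by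
  have := op_add (0 : Af m (Pr n)) 0 c
  simpa using this

/-- Coboundary-type operator on families. -/
def coD {n m : ℕ} (e : Af m (Pr n)) : Af m (Pr (n + 1)) :=
  ∑ i : Fin (n + 1), (-1 : ℤ) ^ (i : ℕ) • mapA (kP i) m e

lemma op_coD {n m : ℕ} (e : Af m (Pr n)) (c : Ch (n + 1) X) : op (coD e) c = op e (bd n c) := by
  induction c using Finsupp.induction_linear with
  | zero => simp
  | add a b ha hb => simp only [map_add, ha, hb]
  | single σ a =>
    simp only [op_single, bd_single, map_smul, map_sum, coD, hat_face, one_smul]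
    simp only [← mapc_mapc, mapc_kP]

lemma coD_coD {n m : ℕ} (e : Af m (Pr n)) : coD (coD e) = 0 := by
  simp only [coD, map_sum, map_smul, Finset.smul_sum, smul_smul]
  refine alt_sum_zero (fun i j => mapA (kP i) m (mapA (kP j) m e)) fun i j h => ?_
  induction e using Finsupp.induction_linear with
  | zero => simp
  | add a b ha hb => simp only [map_add, ha, hb]
  | single w a =>
    simp only [mapA_single]
    congr 1
    ext1 k
    exact kP_comp h _

lemma coD_sub {n m : ℕ} (e e' : Af m (Pr n)) : coD (e - e') = coD e - coD e' := by
  simp [coD, smul_sub]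

lemma bdA_coD {n m : ℕ} (e : Af (m + 1) (Pr n)) : bdA m (coD e) = coD (bdA m e) := by
  simp only [coD, map_sum, map_smul, bdA_mapA]

lemma mapc_op {n m : ℕ} (f : C(X, Y)) (e : Af m (Pr n)) (c : Ch n X) :
    mapc (timesI f) m (op e c) = op e (mapc f n c) := by
  induction c using Finsupp.induction_linear with
  | zero => simp
  | add a b ha hb => simp only [map_add, ha, hb]
  | single σ a => simp only [op_single, map_smul, mapc_single, hat_comp, mapc_mapc]

/-- The cone point. -/
def bp (n : ℕ) : Pr (n + 1) :=
  ⟨((stdSimplex.barycenter : Dl (n + 1)), 0), ⟨Subtype.property _, by simp⟩⟩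

/-- A point of the prism. -/
def prpt {n : ℕ} (t : unitInterval) (x : Dl n) : Pr n := ⟨((x : Fin n → ℝ), t), ⟨x.2, t.2⟩⟩

/-- The identity simplex at height `t`. -/
def iot (t : unitInterval) (n : ℕ) : Af n (Pr n) :=
  Finsupp.single (fun j => prpt t (stdSimplex.vertex j)) 1

lemma bdA_iot (t : unitInterval) (n : ℕ) : bdA n (iot t (n + 1)) = coD (iot t n) := by
  simp only [iot, bdA_single, coD, mapA_single, one_smul]
  refine Finset.sum_congr rfl fun i _ => ?_
  refine congrArg (fun τ => (-1 : ℤ) ^ (i : ℕ) • Finsupp.single τ (1 : ℤ)) ?_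
  funext k
  apply Subtype.ext
  refine Prod.ext ?_ rfl
  have := stdSimplex.map_vertex (S := ℝ) i.succAbove k
  exact (congrArg Subtype.val this).symm

/-- Inclusion at height `t`. -/
def inc (t : unitInterval) : C(X, X × unitInterval) := ⟨fun x => (x, t), by fun_prop⟩

lemma op_iot (t : unitInterval) (n : ℕ) (c : Ch n X) : op (iot t n) c = mapc (inc t) n c := by
  induction c using Finsupp.induction_linear with
  | zero => simp
  | add a b ha hb => simp only [map_add, ha, hb]
  | single σ a =>
    simp only [op_single, iot, re_single, mapc_single, Finsupp.smul_single, smul_eq_mul, mul_one]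
    refine congrArg (fun τ => Finsupp.single τ a) ?_
    ext1 x
    have hx : aff (fun j => prpt t (stdSimplex.vertex j)) x = prpt t x := by
      apply Subtype.ext
      rw [aff_apply]
      refine Prod.ext ?_ ?_
      · simp only [Prod.fst_sum, Prod.smul_fst, stdSimplex.vertex_coe, prpt]
        ext k
        simp [Finset.sum_apply, Pi.single_apply]
      · simp only [Prod.snd_sum, Prod.smul_snd, smul_eq_mul, prpt]
        rw [← Finset.sum_mul, stdSimplex.sum_eq_one, one_mul]
    rw [ContinuousMap.comp_apply, hx]
    rfl

/-- Generic acyclic-models homotopy. -/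
def htp (φ : ∀ n, Af n (Pr n)) : ∀ n, Af (n + 1) (Pr n)
  | 0 => 0
  | n + 1 => cone (bp n) (n + 1) (φ (n + 1) - coD (htp φ n))

lemma bdA_htp (φ : ∀ n, Af n (Pr n)) (h0 : φ 0 = 0) (hφ : ∀ n, bdA n (φ (n + 1)) = coD (φ n))
    (n : ℕ) : bdA (n + 1) (htp φ (n + 1)) = φ (n + 1) - coD (htp φ n) := by
  rw [htp, bdA_cone, sub_eq_self]
  cases n with
  | zero => simp [htp, coD, hφ, h0]
  | succ n =>
    rw [map_sub, hφ, bdA_coD, bdA_htp φ h0 hφ n, coD_sub, coD_coD]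
    simp

/-- Barycentric subdivision. -/
def Sd : ∀ n, Af n (Pr n)
  | 0 => iot 0 0
  | n + 1 => cone (bp n) n (coD (Sd n))

lemma bdA_Sd (n : ℕ) : bdA n (Sd (n + 1)) = coD (Sd n) := by
  cases n with
  | zero => exact bdA_cone_zero _ _
  | succ n => rw [Sd, bdA_cone, bdA_coD, bdA_Sd n, coD_coD]; simp

lemma iot_zero (t t' : unitInterval) : iot t 0 = iot t' 0 := by
  simp only [iot]
  congr 1
  exact Subsingleton.elim _ _

/-- Projection. -/
def prX : C(X × unitInterval, X) := ⟨Prod.fst, continuous_fst⟩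

/-- Subdivision operator. -/
def sd (n : ℕ) : Ch n X →ₗ[ℤ] Ch n X := mapc prX n ∘ₗ op (Sd n)

/-- Subdivision homotopy. -/
def tt (n : ℕ) : Ch n X →ₗ[ℤ] Ch (n + 1) X :=
  mapc prX (n + 1) ∘ₗ op (htp (fun n => iot 0 n - Sd n) n)

lemma bd_sd (n : ℕ) (c : Ch (n + 1) X) : bd n (sd (n + 1) c) = sd n (bd n c) := by
  simp only [sd, LinearMap.comp_apply, bd_mapc, op_bd, bdA_Sd, op_coD]

lemma prX_inc (n : ℕ) (t : unitInterval) (c : Ch n X) : mapc prX n (mapc (inc t) n c) = c := by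
  rw [mapc_mapc]
  exact mapc_id n c

lemma sd_zero (c : Ch 0 X) : sd 0 c = c := by
  simp only [sd, LinearMap.comp_apply, Sd, op_iot, prX_inc]

lemma tt_zero (c : Ch 0 X) : tt 0 c = 0 := by
  simp only [tt, LinearMap.comp_apply, htp, op_zero, map_zero]

lemma bd_tt (n : ℕ) (c : Ch (n + 1) X) :
    bd (n + 1) (tt (n + 1) c) = c - sd (n + 1) c - tt n (bd n c) := by
  simp only [tt, sd, LinearMap.comp_apply, bd_mapc, op_bd]
  rw [bdA_htp _ (by simp [Sd]) (by intro n; simp [bdA_iot, bdA_Sd, coD_sub])]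
  simp only [op_sub, op_coD, op_iot, map_sub, prX_inc]

/-- The prism operator. -/
def pp (n : ℕ) : Ch n X →ₗ[ℤ] Ch (n + 1) (X × unitInterval) :=
  op (htp (fun n => iot 1 n - iot 0 n) n)

lemma bd_pp (n : ℕ) (c : Ch (n + 1) X) :
    bd (n + 1) (pp (n + 1) c) = mapc (inc 1) _ c - mapc (inc 0) _ c - pp n (bd n c) := by
  simp only [pp, op_bd]
  rw [bdA_htp _ (by simp [iot_zero 1 0]) (by intro n; simp [bdA_iot, coD_sub])]
  simp only [op_sub, op_coD, op_iot]

lemma pp_zero (c : Ch 0 X) : pp 0 c = 0 := by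
  simp only [pp, htp, op_zero]

lemma Dl_zero_elim (x : Dl 0) : False := by
  have := stdSimplex.sum_eq_one x
  simp at this

instance : Subsingleton C(Dl 0, X) := ⟨fun f g => by ext x; exact (Dl_zero_elim x).elim⟩

lemma mapc_zero_eq (f g : C(X, Y)) (c : Ch 0 X) : mapc f 0 c = mapc g 0 c := by
  have : (fun σ : C(Dl 0, X) => f.comp σ) = fun σ => g.comp σ := by
    ext1 σ; exact Subsingleton.elim _ _
  simp only [mapc, this]

end GT

namespace GT
variable {X Y Z : Type} [TopologicalSpace X] [TopologicalSpace Y] [TopologicalSpace Z]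

/-! ### Reduced homology, indexed by the number of vertices -/

/-- Cycles. -/
def Zc (X : Type) [TopologicalSpace X] : ∀ n, Submodule ℤ (Ch n X)
  | 0 => ⊤
  | n + 1 => LinearMap.ker (bd n)

/-- Boundaries. -/
def Bc (X : Type) [TopologicalSpace X] (n : ℕ) : Submodule ℤ (Ch n X) := LinearMap.range (bd n)

lemma mem_Zc_succ {n : ℕ} {c : Ch (n + 1) X} : c ∈ Zc X (n + 1) ↔ bd n c = 0 := LinearMap.mem_ker

lemma bd_mem_Zc (n : ℕ) (c : Ch (n + 1) X) : bd n c ∈ Zc X n := by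
  cases n with
  | zero => trivial
  | succ n => rw [mem_Zc_succ, bd_bd]

lemma mapc_mem_Zc (f : C(X, Y)) {n : ℕ} {c : Ch n X} (hc : c ∈ Zc X n) : mapc f n c ∈ Zc Y n := by
  cases n with
  | zero => trivial
  | succ n => rw [mem_Zc_succ] at *; rw [bd_mapc, hc, map_zero]

/-- Reduced homology; index `n` is reduced degree `n - 1`. -/
def H (n : ℕ) (X : Type) [TopologicalSpace X] : Type := Zc X n ⧸ (Bc X n).submoduleOf (Zc X n)

instance (n : ℕ) : AddCommGroup (H n X) :=
  inferInstanceAs (AddCommGroup (Zc X n ⧸ (Bc X n).submoduleOf (Zc X n)))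

/-- The class of a cycle. -/
def cls (n : ℕ) : Zc X n →ₗ[ℤ] H n X := Submodule.mkQ _

lemma cls_surj (n : ℕ) (x : H n X) : ∃ c, cls n c = x := Submodule.mkQ_surjective _ x

lemma cls_eq_zero {n : ℕ} (c : Zc X n) : cls n c = 0 ↔ ∃ b, bd n b = (c : Ch n X) := by
  have h := Submodule.Quotient.mk_eq_zero ((Bc X n).submoduleOf (Zc X n)) (x := c)
  exact h

lemma cls_eq {n : ℕ} (c d : Zc X n) : cls n c = cls n d ↔ ∃ b, bd n b = (c : Ch n X) - (d : Ch n X) := by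
  rw [← sub_eq_zero, ← map_sub, cls_eq_zero]
  rfl

/-- Pushforward of cycles. -/
def mapz (f : C(X, Y)) (n : ℕ) : Zc X n →ₗ[ℤ] Zc Y n :=
  (mapc f n).restrict fun _ hc => mapc_mem_Zc f hc

@[simp] lemma mapz_coe (f : C(X, Y)) (n : ℕ) (c : Zc X n) : (mapz f n c : Ch n Y) = mapc f n c := rfl

/-- Induced map. -/
def hmap (f : C(X, Y)) (n : ℕ) : H n X →ₗ[ℤ] H n Y :=
  Submodule.liftQ _ (cls n ∘ₗ mapz f n) (by
    intro c hc
    rw [LinearMap.mem_ker, LinearMap.comp_apply, cls_eq_zero]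
    obtain ⟨b, hb⟩ := hc
    exact ⟨mapc f _ b, by rw [bd_mapc, hb]; rfl⟩)

@[simp] lemma hmap_cls (f : C(X, Y)) (n : ℕ) (c : Zc X n) : hmap f n (cls n c) = cls n (mapz f n c) :=
  rfl

lemma hmap_comp (g : C(Y, Z)) (f : C(X, Y)) (n : ℕ) (x : H n X) :
    hmap (g.comp f) n x = hmap g n (hmap f n x) := by
  obtain ⟨c, rfl⟩ := cls_surj n x
  simp only [hmap_cls]
  congr 1
  apply Subtype.ext
  simp [mapc_mapc]

lemma hmap_id (n : ℕ) (x : H n X) : hmap (ContinuousMap.id X) n x = x := by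
  obtain ⟨c, rfl⟩ := cls_surj n x
  simp only [hmap_cls]
  congr 1
  apply Subtype.ext
  simp [mapc_id]

lemma hmap_homotopic {f g : C(X, Y)} (h : f.Homotopic g) (n : ℕ) : hmap f n = hmap g n := by
  ext x
  obtain ⟨c, rfl⟩ := cls_surj n x
  obtain ⟨F⟩ := h
  simp only [hmap_cls]
  cases n with
  | zero =>
    congr 1
    apply Subtype.ext
    exact mapc_zero_eq _ _ _
  | succ n =>
    let F' : C(X × unitInterval, Y) := ⟨fun p => F (p.2, p.1), by fun_prop⟩
    have h0 : F'.comp (inc 0) = f := by ext x; simp [F', inc]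
    have h1 : F'.comp (inc 1) = g := by ext x; simp [F', inc]
    symm
    rw [cls_eq]
    refine ⟨mapc F' _ (pp _ c), ?_⟩
    rw [bd_mapc, bd_pp, mem_Zc_succ.1 c.2, map_sub, map_sub, mapc_mapc, mapc_mapc, h0, h1]
    simp

/-- A homotopy equivalence induces isomorphisms. -/
def hequiv (f : C(X, Y)) (g : C(Y, X)) (h1 : (g.comp f).Homotopic (ContinuousMap.id X))
    (h2 : (f.comp g).Homotopic (ContinuousMap.id Y)) (n : ℕ) : H n X ≃ₗ[ℤ] H n Y :=
  LinearEquiv.ofLinearMap (hmap f n) (hmap g n)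
    (by ext x; simp only [LinearMap.comp_apply, LinearMap.id_apply]
        rw [← hmap_comp, hmap_homotopic h2, hmap_id])
    (by ext x; simp only [LinearMap.comp_apply, LinearMap.id_apply]
        rw [← hmap_comp, hmap_homotopic h1, hmap_id])

/-- Acyclic spaces. -/
def Acy (X : Type) [TopologicalSpace X] : Prop := ∀ n, Subsingleton (H n X)

lemma H_zero_subsingleton (x : X) : Subsingleton (H 0 X) := by
  refine ⟨fun a b => ?_⟩
  obtain ⟨c, rfl⟩ := cls_surj 0 a
  obtain ⟨d, rfl⟩ := cls_surj 0 b
  rw [cls_eq]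
  set e : Ch 0 X := (c : Ch 0 X) - (d : Ch 0 X)
  clear_value e
  induction e using Finsupp.induction_linear with
  | zero => exact ⟨0, by simp⟩
  | add a b ha hb =>
    obtain ⟨a', rfl⟩ := ha
    obtain ⟨b', rfl⟩ := hb
    exact ⟨a' + b', by simp⟩
  | single σ a =>
    refine ⟨Finsupp.single (ContinuousMap.const _ x) a, ?_⟩
    rw [bd_single]
    simp only [Nat.reduceAdd, Finset.univ_unique, Fin.default_eq_zero, Finset.sum_singleton,
      Fin.val_zero, pow_zero, one_smul, Finsupp.smul_single, smul_eq_mul, mul_one]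
    congr 1
    exact Subsingleton.elim _ _

lemma acy_pt (X : Type) [TopologicalSpace X] [Subsingleton X] (x : X) : Acy X := by
  intro n
  cases n with
  | zero => exact H_zero_subsingleton x
  | succ n =>
    have hsub : ∀ m, Subsingleton C(Dl m, X) := fun m =>
      ⟨fun f g => by ext; exact Subsingleton.elim _ _⟩
    let K : ∀ m, Ch m X →ₗ[ℤ] Ch (m + 1) X := fun m =>
      ext m fun _ => Finsupp.single (ContinuousMap.const _ x) 1
    have hK : ∀ c, bd (n + 1) (K (n + 1) c) = c - K n (bd n c) := by
      intro c
      induction c using Finsupp.induction_linear with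
      | zero => simp
      | add a b ha hb => simp only [map_add, ha, hb]; abel
      | single σ a =>
        simp only [K, ext_single, bd_single, map_smul, map_sum, one_smul]
        rw [Fin.sum_univ_succ]
        have h1 : ∀ τ : C(Dl (n + 1), X), τ = σ := fun τ => Subsingleton.elim _ _
        have h2 : ∀ (τ : C(Dl (n + 1 + 1), X)) i, τ.comp (face i) = σ := fun τ i => h1 _
        simp only [h2, h1 (ContinuousMap.const _ x)]
        simp [pow_succ, sub_eq_add_neg]
    refine ⟨fun a b => ?_⟩
    have key : ∀ a : H (n + 1) X, a = 0 := by
      intro a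
      obtain ⟨c, rfl⟩ := cls_surj _ a
      rw [cls_eq_zero]
      obtain ⟨c, hc⟩ := c
      rw [mem_Zc_succ] at hc
      refine ⟨K (n + 1) c, ?_⟩
      rw [hK, hc]; simp
    rw [key a, key b]

lemma Acy.of_equiv (hY : Acy Y) (e : ∀ n, H n X ≃ₗ[ℤ] H n Y) : Acy X := fun n =>
  have := hY n
  (e n).toEquiv.subsingleton

/-- Spaces whose identity is homotopic to a constant map are acyclic. -/
lemma acy_of_contr (x : X) (h : (ContinuousMap.const X x).Homotopic (ContinuousMap.id X)) :
    Acy X := by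
  refine (acy_pt Unit ()).of_equiv (hequiv (ContinuousMap.const X ()) (ContinuousMap.const _ x) ?_ ?_)
  · exact h
  · exact ContinuousMap.Homotopic.refl _
end GT

namespace GT
variable {X Y Z : Type} [TopologicalSpace X] [TopologicalSpace Y] [TopologicalSpace Z]

/-! ### Small simplices -/

lemma supp_ind {α M : Type} [AddCommGroup M] (S : Set α) (L : (α →₀ ℤ) →ₗ[ℤ] M) (N : Submodule ℤ M)
    (h : ∀ a ∈ S, L (Finsupp.single a 1) ∈ N) (c : α →₀ ℤ) (hc : c ∈ Finsupp.supported ℤ ℤ S) :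
    L c ∈ N := by
  rw [Finsupp.supported_eq_span_single] at hc
  have : Submodule.span ℤ ((fun i => Finsupp.single i (1 : ℤ)) '' S) ≤ N.comap L := by
    rw [Submodule.span_le]
    rintro _ ⟨a, ha, rfl⟩
    exact h a ha
  exact this hc

lemma single_mem_supported {α : Type} {S : Set α} {a : α} (ha : a ∈ S) (z : ℤ) :
    Finsupp.single a z ∈ Finsupp.supported ℤ ℤ S := Finsupp.single_mem_supported ℤ z ha

/-- The vertices of subdivision are `c`-close. -/
def Cl (n : ℕ) (c : ℝ) (x y : Pr n) : Prop :=
  ∀ (f : Fin n → ℝ) (D : ℝ), (∀ j k, |f j - f k| ≤ D) →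
    |∑ i, x.1.1 i * f i - ∑ i, y.1.1 i * f i| ≤ c * D

lemma sum_sub_le {n : ℕ} (x : Dl n) (f : Fin n → ℝ) (a D : ℝ) (h : ∀ i, |a - f i| ≤ D) :
    |a - ∑ i, x i * f i| ≤ D := by
  have h1 : a - ∑ i, x i * f i = ∑ i, x i * (a - f i) := by
    simp only [mul_sub, Finset.sum_sub_distrib, ← Finset.sum_mul]
    rw [stdSimplex.sum_eq_one, one_mul]
  rw [h1]
  calc |∑ i, x i * (a - f i)| ≤ ∑ i, |x i * (a - f i)| := Finset.abs_sum_le_sum_abs _ _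
    _ ≤ ∑ i, x i * D := by
        refine Finset.sum_le_sum fun i _ => ?_
        rw [abs_mul, abs_of_nonneg (show 0 ≤ x i from x.2.1 i)]
        exact mul_le_mul_of_nonneg_left (h i) (x.2.1 i)
    _ = D := by rw [← Finset.sum_mul, stdSimplex.sum_eq_one, one_mul]

lemma Cl_bp (n : ℕ) (y : Pr (n + 1)) : Cl (n + 1) (n / (n + 1)) (bp n) y := by
  intro f D hD
  refine sum_sub_le ⟨y.1.1, y.2.1⟩ f _ _ fun k => ?_
  have h1 : ∑ i, (bp n).1.1 i * f i - f k = (1 / (n + 1)) * ∑ i, (f i - f k) := by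
    have : ∀ i, (bp n).1.1 i = 1 / ((n : ℝ) + 1) := by
      intro i
      simp [bp, stdSimplex.barycenter]
      rfl
    simp only [this, ← Finset.mul_sum, Finset.sum_sub_distrib]
    simp
    field_simp
  rw [h1, abs_mul, abs_of_nonneg (by positivity), div_mul_eq_mul_div, div_mul_eq_mul_div, one_mul]
  gcongr
  refine (Finset.abs_sum_le_sum_abs _ _).trans ?_
  rw [Fin.sum_univ_succAbove _ k]
  simp only [sub_self, abs_zero, zero_add]
  refine (Finset.sum_le_sum fun i _ => hD _ _).trans ?_
  simp

lemma Cl_symm {n : ℕ} {c : ℝ} {x y : Pr n} (h : Cl n c x y) : Cl n c y x := by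
  intro f D hD
  rw [abs_sub_comm]
  exact h f D hD

lemma kP_dot {n : ℕ} (i : Fin (n + 1)) (p : Pr n) (f : Fin (n + 1) → ℝ) :
    ∑ j, (kP i p).1.1 j * f j = ∑ j, p.1.1 j * f (i.succAbove j) :=
  map_sum_smul i.succAbove ⟨p.1.1, p.2.1⟩ f

lemma Sd_Cl (n : ℕ) : Sd n ∈ Finsupp.supported ℤ ℤ {w | ∀ i k, Cl n (n / (n + 1)) (w i) (w k)} := by
  induction n with
  | zero =>
    refine single_mem_supported ?_ _
    intro i; exact i.elim0
  | succ n ih =>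
    have hle : (n : ℝ) / (n + 1) ≤ ((n + 1 : ℕ) : ℝ) / (((n + 1 : ℕ) : ℝ) + 1) := by
      rw [div_le_div_iff₀ (by positivity) (by positivity)]
      push_cast; nlinarith
    have mono : ∀ {x y : Pr (n + 1)}, Cl (n + 1) (n / (n + 1)) x y →
        Cl (n + 1) (((n + 1 : ℕ) : ℝ) / (((n + 1 : ℕ) : ℝ) + 1)) x y := by
      intro x y h f D hD
      refine (h f D hD).trans ?_
      refine mul_le_mul_of_nonneg_right hle ?_
      exact (abs_nonneg _).trans (hD 0 0)
    rw [Sd]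
    simp only [coD, map_sum, map_smul]
    refine Submodule.sum_mem _ fun i _ => Submodule.smul_mem _ _ ?_
    refine supp_ind _ (cone (bp n) n ∘ₗ mapA (kP i) n) _ ?_ _ ih
    intro w hw
    simp only [LinearMap.comp_apply, mapA_single, cone_single]
    refine single_mem_supported ?_ _
    intro j k
    apply mono
    refine Fin.cases ?_ (fun j => ?_) j
    · exact Cl_bp n _
    · refine Fin.cases ?_ (fun k => ?_) k
      · exact Cl_symm (Cl_bp n _)
      · intro f D hD
        simp only [Fin.cons_succ, Function.comp]
        rw [kP_dot, kP_dot]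
        exact hw j k (fun j => f (i.succAbove j)) D (fun j k => hD _ _)

/-- Contracting affine self-maps of the simplex. -/
def Pc (n : ℕ) (r : ℝ) (τ : C(Dl n, Dl n)) : Prop :=
  ∀ (f : Fin n → ℝ) (D : ℝ), (∀ j k, |f j - f k| ≤ D) →
    ∃ f' : Fin n → ℝ, (∀ j k, |f' j - f' k| ≤ r * D) ∧ ∀ x, ∑ j, τ x j * f j = ∑ i, x i * f' i

lemma Pc_id (n : ℕ) : Pc n 1 (ContinuousMap.id _) := fun f D hD => ⟨f, by simpa using hD, fun _ => rfl⟩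

lemma Pc_comp {n : ℕ} {r s : ℝ} {τ τ' : C(Dl n, Dl n)} (h : Pc n r τ) (h' : Pc n s τ') :
    Pc n (s * r) (τ.comp τ') := by
  intro f D hD
  obtain ⟨f', h1, h2⟩ := h f D hD
  obtain ⟨f'', h3, h4⟩ := h' f' _ h1
  exact ⟨f'', fun j k => by rw [mul_assoc]; exact h3 j k, fun x => by
    rw [← h4, ← h2]; rfl⟩

lemma Pc_aff {n : ℕ} {r : ℝ} (w : Fin n → Pr n) (hw : ∀ i k, Cl n r (w i) (w k)) :
    Pc n r ((prX.comp (hat (ContinuousMap.id (Dl n)))).comp (aff w)) := by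
  intro f D hD
  refine ⟨fun i => ∑ j, (w i).1.1 j * f j, fun j k => hw j k f D hD, fun x => ?_⟩
  have : ∀ j, ((prX.comp (hat (ContinuousMap.id (Dl n)))).comp (aff w)) x j =
      ∑ i, x i * (w i).1.1 j := by
    intro j
    change (aff w x).1.1 j = _
    rw [aff_apply]
    simp [Prod.fst_sum, Finset.sum_apply]
  simp only [this, Finset.sum_mul, Finset.mul_sum]
  rw [Finset.sum_comm]
  simp only [mul_assoc]

lemma sd_mapc (f : C(X, Y)) (n : ℕ) (c : Ch n X) : sd n (mapc f n c) = mapc f n (sd n c) := by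
  simp only [sd, LinearMap.comp_apply, ← mapc_op, mapc_mapc]
  rfl

lemma tt_mapc (f : C(X, Y)) (n : ℕ) (c : Ch n X) :
    tt n (mapc f n c) = mapc f (n + 1) (tt n c) := by
  simp only [tt, LinearMap.comp_apply, ← mapc_op, mapc_mapc]
  rfl

lemma sd_Pc {n : ℕ} {r : ℝ} (c : Ch n (Dl n)) (hc : c ∈ Finsupp.supported ℤ ℤ {τ | Pc n r τ}) :
    sd n c ∈ Finsupp.supported ℤ ℤ {τ | Pc n (n / (n + 1) * r) τ} := by
  refine supp_ind _ (sd n) _ (fun τ hτ => ?_) c hc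
  have h1 : Finsupp.single τ (1 : ℤ) = mapc τ n (Finsupp.single (ContinuousMap.id _) 1) := by simp
  rw [h1, sd_mapc]
  simp only [sd, LinearMap.comp_apply, op_single, one_smul]
  refine supp_ind _ (mapc τ n ∘ₗ mapc prX n ∘ₗ mapc (hat (ContinuousMap.id _)) n ∘ₗ re n) _ ?_ _
    (Sd_Cl n)
  intro w hw
  simp only [LinearMap.comp_apply, re_single, mapc_single]
  refine single_mem_supported ?_ _
  exact Pc_comp hτ (Pc_aff w hw)

lemma sd_iter_Pc (n k : ℕ) : (sd n)^[k] (Finsupp.single (ContinuousMap.id (Dl n)) 1) ∈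
    Finsupp.supported ℤ ℤ {τ | Pc n (((n : ℝ) / (n + 1)) ^ k) τ} := by
  induction k with
  | zero => exact single_mem_supported (by simpa using Pc_id n) _
  | succ k ih =>
    rw [Function.iterate_succ_apply', pow_succ']
    exact sd_Pc _ ih

lemma Pc_dist {n : ℕ} {r : ℝ} (hr : 0 ≤ r) {τ : C(Dl n, Dl n)} (h : Pc n r τ) (x y : Dl n) :
    dist (τ x) (τ y) ≤ r := by
  rw [Subtype.dist_eq, dist_pi_le_iff hr]
  intro i
  rw [Real.dist_eq]
  obtain ⟨f', h1, h2⟩ := h (Pi.single i 1) 1 (by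
    intro j k
    by_cases hj : j = i <;> by_cases hk : k = i <;> simp [hj, hk])
  have e1 := h2 x
  have e2 := h2 y
  simp only [Pi.single_apply, mul_ite, mul_one, mul_zero, Finset.sum_ite_eq', Finset.mem_univ,
    if_true] at e1 e2
  change |τ x i - τ y i| ≤ r
  rw [e1, e2]
  refine sum_sub_le y f' _ _ fun k => ?_
  rw [abs_sub_comm]
  refine sum_sub_le x f' _ _ fun j => ?_
  simpa using h1 k j

lemma sd_iter_mapc (f : C(X, Y)) (n k : ℕ) (c : Ch n X) :
    (sd n)^[k] (mapc f n c) = mapc f n ((sd n)^[k] c) := by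
  induction k with
  | zero => rfl
  | succ k ih => rw [Function.iterate_succ_apply', ih, sd_mapc, Function.iterate_succ_apply']

/-- Every simplex becomes small after subdivision. -/
lemma small_single {n : ℕ} (U V : Set X) (hU : IsOpen U) (hV : IsOpen V) (h : ∀ x, x ∈ U ∨ x ∈ V)
    (σ : C(Dl n, X)) : ∃ k, (sd n)^[k] (Finsupp.single σ 1) ∈
      Finsupp.supported ℤ ℤ {τ : C(Dl n, X) | (∀ x, τ x ∈ U) ∨ (∀ x, τ x ∈ V)} := by
  obtain ⟨δ, hδ, hL⟩ := lebesgue_number_lemma_of_metric (s := (Set.univ : Set (Dl n)))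
    (c := fun b : Bool => σ ⁻¹' (if b then U else V)) isCompact_univ
    (by intro b; cases b
        · exact hV.preimage σ.continuous
        · exact hU.preimage σ.continuous)
    (by intro x _
        rcases h (σ x) with hx | hx
        · exact Set.mem_iUnion.2 ⟨true, hx⟩
        · exact Set.mem_iUnion.2 ⟨false, hx⟩)
  have hc1 : (n : ℝ) / (n + 1) < 1 := by rw [div_lt_one (by positivity)]; linarith
  obtain ⟨k, hk⟩ := exists_pow_lt_of_lt_one hδ hc1
  refine ⟨k, ?_⟩
  have h1 : Finsupp.single σ (1 : ℤ) = mapc σ n (Finsupp.single (ContinuousMap.id _) 1) := by simp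
  rw [h1, sd_iter_mapc]
  refine supp_ind _ (mapc σ n) _ ?_ _ (sd_iter_Pc n k)
  intro τ hτ
  rw [mapc_single]
  refine single_mem_supported ?_ _
  by_cases hne : Nonempty (Dl n)
  · obtain ⟨x0⟩ := hne
    obtain ⟨b, hb⟩ := hL (τ x0) trivial
    have : ∀ x, τ x ∈ σ ⁻¹' (if b then U else V) := fun x =>
      hb ((Pc_dist (by positivity) hτ x x0).trans_lt hk)
    cases b
    · exact Or.inr this
    · exact Or.inl this
  · exact Or.inl fun x => (hne ⟨x⟩).elim
end GT

namespace GT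
variable {X Y Z : Type} [TopologicalSpace X] [TopologicalSpace Y] [TopologicalSpace Z]

/-! ### Mayer-Vietoris -/

lemma mapc_inj {f : C(X, Y)} (hf : Function.Injective f) (n : ℕ) : Function.Injective (mapc f n) := by
  refine Finsupp.mapDomain_injective fun σ τ h => ?_
  ext x
  exact hf (congrArg (fun g : C(Dl n, Y) => g x) h)

lemma exists_lift {f : C(X, Y)} (hf : Topology.IsEmbedding f) (τ : C(Z, Y))
    (h : ∀ x, τ x ∈ Set.range f) : ∃ σ : C(Z, X), f.comp σ = τ := by
  choose g hg using h
  refine ⟨⟨g, ?_⟩, ?_⟩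
  · rw [hf.continuous_iff]
    convert τ.continuous using 1
    ext x; exact hg x
  · ext x; exact hg x

variable {A U V : Type} [TopologicalSpace A] [TopologicalSpace U] [TopologicalSpace V]
variable {A' U' V' X' : Type} [TopologicalSpace A'] [TopologicalSpace U'] [TopologicalSpace V']
  [TopologicalSpace X']

/-- Mayer-Vietoris squares. -/
structure Sq (kU : C(A, U)) (kV : C(A, V)) (jU : C(U, X)) (jV : C(V, X)) : Prop where
  comm : jU.comp kU = jV.comp kV
  oU : Topology.IsOpenEmbedding jU
  oV : Topology.IsOpenEmbedding jV
  cov : ∀ x, x ∈ Set.range jU ∨ x ∈ Set.range jV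
  eU : Topology.IsEmbedding kU
  eV : Topology.IsEmbedding kV
  cap : ∀ u v, jU u = jV v → ∃ a, kU a = u ∧ kV a = v

variable {kU : C(A, U)} {kV : C(A, V)} {jU : C(U, X)} {jV : C(V, X)}
variable {kU' : C(A', U')} {kV' : C(A', V')} {jU' : C(U', X')} {jV' : C(V', X')}

namespace Sq

lemma swap (S : Sq kU kV jU jV) : Sq kV kU jV jU where
  comm := S.comm.symm
  oU := S.oV
  oV := S.oU
  cov x := (S.cov x).symm
  eU := S.eV
  eV := S.eU
  cap u v h := by
    obtain ⟨a, h1, h2⟩ := S.cap v u h.symm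
    exact ⟨a, h2, h1⟩

lemma comm_c (S : Sq kU kV jU jV) (n : ℕ) (c : Ch n A) :
    mapc jU n (mapc kU n c) = mapc jV n (mapc kV n c) := by
  rw [mapc_mapc, mapc_mapc, S.comm]

lemma iU (S : Sq kU kV jU jV) (n : ℕ) : Function.Injective (mapc jU n) := mapc_inj S.oU.injective n
lemma iV (S : Sq kU kV jU jV) (n : ℕ) : Function.Injective (mapc jV n) := mapc_inj S.oV.injective n
lemma ikU (S : Sq kU kV jU jV) (n : ℕ) : Function.Injective (mapc kU n) := mapc_inj S.eU.injective n

lemma mid (S : Sq kU kV jU jV) {n : ℕ} (a : Ch n U) (b : Ch n V)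
    (h : mapc jU n a + mapc jV n b = 0) : ∃ c, mapc kU n c = a ∧ mapc kV n c = - b := by
  have hiU : Function.Injective (fun σ : C(Dl n, U) => jU.comp σ) := fun σ τ h => by
    ext x; exact S.oU.injective (congrArg (fun g : C(Dl n, X) => g x) h)
  have hiV : Function.Injective (fun σ : C(Dl n, V) => jV.comp σ) := fun σ τ h => by
    ext x; exact S.oV.injective (congrArg (fun g : C(Dl n, X) => g x) h)
  have hiA : Function.Injective (fun σ : C(Dl n, A) => kU.comp σ) := fun σ τ h => by
    ext x; exact S.eU.injective (congrArg (fun g : C(Dl n, U) => g x) h)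
  have h1 : a ∈ Set.range (Finsupp.mapDomain (M := ℤ) (fun σ : C(Dl n, A) => kU.comp σ)) := by
    rw [Finsupp.mem_range_mapDomain_iff _ hiA]
    intro σ hσ
    by_contra hne
    apply hσ
    have e1 : mapc jU n a (jU.comp σ) = a σ := Finsupp.mapDomain_apply hiU a σ
    have e2 : mapc jV n b (jU.comp σ) ≠ 0 := by
      intro h0
      have := DFunLike.congr_fun h (jU.comp σ)
      rw [Finsupp.add_apply, e1, h0] at this
      simp at this
      exact hne this
    have e3 : jU.comp σ ∈ Set.range (fun σ : C(Dl n, V) => jV.comp σ) := by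
      by_contra h0
      exact e2 ((Finsupp.mem_range_mapDomain_iff _ hiV _).1 ⟨b, rfl⟩ _ h0)
    obtain ⟨σ', h'⟩ := e3
    obtain ⟨ρ, hρ⟩ := exists_lift S.eU σ (fun x => by
      obtain ⟨a, ha, -⟩ := S.cap (σ x) (σ' x) (congrArg (fun g : C(Dl n, X) => g x) h').symm
      exact ⟨a, ha⟩)
    exact ⟨ρ, hρ⟩
  obtain ⟨c, hc⟩ := h1
  have hc : mapc kU n c = a := hc
  refine ⟨c, hc, S.iV n ?_⟩
  rw [← S.comm_c, hc, map_neg]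
  exact eq_neg_of_add_eq_zero_left h

/-- Small chains. -/
def Sm (_ : Sq kU kV jU jV) (n : ℕ) : Submodule ℤ (Ch n X) :=
  LinearMap.range (mapc jU n) ⊔ LinearMap.range (mapc jV n)

lemma mem_Sm (S : Sq kU kV jU jV) {n : ℕ} {c : Ch n X} :
    c ∈ S.Sm n ↔ ∃ a b, mapc jU n a + mapc jV n b = c := by
  rw [Sm, Submodule.mem_sup]
  constructor
  · rintro ⟨_, ⟨a, rfl⟩, _, ⟨b, rfl⟩, h⟩
    exact ⟨a, b, h⟩
  · rintro ⟨a, b, h⟩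
    exact ⟨_, ⟨a, rfl⟩, _, ⟨b, rfl⟩, h⟩

lemma sd_Sm (S : Sq kU kV jU jV) {n : ℕ} {c : Ch n X} (h : c ∈ S.Sm n) : sd n c ∈ S.Sm n := by
  rw [S.mem_Sm] at *
  obtain ⟨a, b, rfl⟩ := h
  exact ⟨sd n a, sd n b, by simp [sd_mapc]⟩

lemma sd_iter_Sm (S : Sq kU kV jU jV) {n : ℕ} {c : Ch n X} (h : c ∈ S.Sm n) (k : ℕ) :
    (sd n)^[k] c ∈ S.Sm n := by
  induction k with
  | zero => exact h
  | succ k ih => rw [Function.iterate_succ_apply']; exact S.sd_Sm ih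

lemma tt_Sm (S : Sq kU kV jU jV) {n : ℕ} {c : Ch n X} (h : c ∈ S.Sm n) : tt n c ∈ S.Sm (n + 1) := by
  rw [S.mem_Sm] at *
  obtain ⟨a, b, rfl⟩ := h
  exact ⟨tt n a, tt n b, by simp [tt_mapc]⟩

lemma small (S : Sq kU kV jU jV) {n : ℕ} (c : Ch n X) : ∃ k, (sd n)^[k] c ∈ S.Sm n := by
  induction c using Finsupp.induction_linear with
  | zero => exact ⟨0, Submodule.zero_mem _⟩
  | add a b ha hb =>
    obtain ⟨k, hk⟩ := ha
    obtain ⟨l, hl⟩ := hb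
    refine ⟨k + l, ?_⟩
    have e : (sd n)^[k + l] (a + b) = (sd n)^[l] ((sd n)^[k] a) + (sd n)^[k] ((sd n)^[l] b) := by
      rw [← Function.iterate_add_apply, ← Function.iterate_add_apply, add_comm l k,
        ← Module.End.coe_pow, map_add]
    rw [e]
    exact Submodule.add_mem _ (S.sd_iter_Sm hk l) (S.sd_iter_Sm hl k)
  | single σ a =>
    obtain ⟨k, hk⟩ := small_single (Set.range jU) (Set.range jV) S.oU.isOpen_range S.oV.isOpen_range
      S.cov σ
    refine ⟨k, ?_⟩
    have h1 : Finsupp.single σ a = a • Finsupp.single σ (1 : ℤ) := by simp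
    rw [← Module.End.coe_pow] at *
    rw [h1, map_smul]
    refine Submodule.smul_mem _ _ ?_
    refine supp_ind _ LinearMap.id _ ?_ _ hk
    rintro τ (hτ | hτ)
    · obtain ⟨τ', rfl⟩ := exists_lift S.oU.isEmbedding τ hτ
      exact S.mem_Sm.2 ⟨Finsupp.single τ' 1, 0, by simp⟩
    · obtain ⟨τ', rfl⟩ := exists_lift S.oV.isEmbedding τ hτ
      exact S.mem_Sm.2 ⟨0, Finsupp.single τ' 1, by simp⟩

lemma cyc_small (S : Sq kU kV jU jV) {n : ℕ} (z : Ch (n + 1) X) (hz : bd n z = 0) :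
    ∃ z' ∈ S.Sm (n + 1), bd n z' = 0 ∧ ∃ w, bd (n + 1) w = z - z' := by
  obtain ⟨k, hk⟩ := S.small z
  refine ⟨_, hk, ?_⟩
  clear hk
  induction k with
  | zero => exact ⟨hz, 0, by simp⟩
  | succ k ih =>
    obtain ⟨h1, w, hw⟩ := ih
    rw [Function.iterate_succ_apply']
    refine ⟨by rw [bd_sd, h1, map_zero], w + tt _ ((sd (n + 1))^[k] z), ?_⟩
    rw [map_add, hw, bd_tt, h1]
    simp

lemma bd_small (S : Sq kU kV jU jV) {n : ℕ} (w : Ch (n + 1) X) (hz : bd n w ∈ S.Sm n) :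
    ∃ w' ∈ S.Sm (n + 1), bd n w' = bd n w := by
  have key : ∀ k, ∃ s ∈ S.Sm (n + 1), bd n ((sd (n + 1))^[k] w + s) = bd n w := by
    intro k
    induction k with
    | zero => exact ⟨0, Submodule.zero_mem _, by simp⟩
    | succ k ih =>
      obtain ⟨s, hs, h⟩ := ih
      refine ⟨sd _ s + tt n (bd n w), Submodule.add_mem _ (S.sd_Sm hs) (S.tt_Sm hz), ?_⟩
      have h2 : bd n (tt n (bd n w)) = bd n w - sd n (bd n w) := by
        cases n with
        | zero => rw [tt_zero, sd_zero]; simp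
        | succ n => rw [bd_tt, bd_bd]; simp
      rw [Function.iterate_succ_apply', ← add_assoc, ← map_add, map_add, bd_sd, h, h2]
      abel
  obtain ⟨k, hk⟩ := S.small w
  obtain ⟨s, hs, h⟩ := key k
  exact ⟨_, Submodule.add_mem _ hk hs, h⟩

lemma bd_tr (S : Sq kU kV jU jV) {n : ℕ} {a : Ch (n + 1) U} {b : Ch (n + 1) V} {c : Ch n A}
    (h1 : mapc kU n c = bd n a) (h2 : mapc kV n c = - bd n b) :
    mapc jU _ a + mapc jV _ b ∈ Zc X (n + 1) := by
  rw [mem_Zc_succ, map_add, bd_mapc, bd_mapc, ← h1, S.comm_c, h2]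
  simp

lemma mem_Zc_of_tr (S : Sq kU kV jU jV) {n : ℕ} {a : Ch (n + 1) U} {c : Ch n A}
    (h1 : mapc kU n c = bd n a) : c ∈ Zc A n := by
  cases n with
  | zero => trivial
  | succ n =>
    rw [mem_Zc_succ]
    apply S.ikU
    rw [← bd_mapc, h1, bd_bd, map_zero]

/-- Connecting triples. -/
structure Tr (_ : Sq kU kV jU jV) {n : ℕ} (z : Zc X (n + 1)) (c : Zc A n) (a : Ch (n + 1) U)
    (b : Ch (n + 1) V) : Prop where
  h1 : mapc kU n c = bd n a
  h2 : mapc kV n c = - bd n b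
  hz : (z : Ch (n + 1) X) = mapc jU _ a + mapc jV _ b

lemma exists_tr0 (S : Sq kU kV jU jV) {n : ℕ} (x : H (n + 1) X) :
    ∃ (y : H n A) (z : Zc X (n + 1)) (c : Zc A n) (a : Ch (n + 1) U)
    (b : Ch (n + 1) V), S.Tr z c a b ∧ x = cls _ z ∧ y = cls n c := by
  obtain ⟨⟨z, hz⟩, rfl⟩ := cls_surj _ x
  obtain ⟨z', hs, h0, w, hw⟩ := S.cyc_small z (mem_Zc_succ.1 hz)
  obtain ⟨a, b, rfl⟩ := S.mem_Sm.1 hs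
  obtain ⟨c, h1, h2⟩ := S.mid (bd n a) (bd n b) (by
    rw [map_add, bd_mapc, bd_mapc] at h0; exact h0)
  refine ⟨_, ⟨_, S.bd_tr h1 h2⟩, ⟨c, S.mem_Zc_of_tr h1⟩, a, b, ⟨h1, h2, rfl⟩, ?_, rfl⟩
  exact (cls_eq _ _).2 ⟨w, hw⟩

lemma uniq (S : Sq kU kV jU jV) {n : ℕ} {z z' : Zc X (n + 1)} {c c' : Zc A n}
    {a a' : Ch (n + 1) U} {b b' : Ch (n + 1) V} (h : S.Tr z c a b) (h' : S.Tr z' c' a' b')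
    (he : cls _ z = cls _ z') : cls n c = cls n c' := by
  obtain ⟨w, hw⟩ := (cls_eq _ _).1 he
  have hw : bd (n + 1) w = mapc jU _ (a - a') + mapc jV _ (b - b') := by
    rw [hw, h.hz, h'.hz, map_sub, map_sub]; abel
  obtain ⟨w', hs, hw'⟩ := S.bd_small w (by rw [hw]; exact S.mem_Sm.2 ⟨_, _, rfl⟩)
  obtain ⟨u, v, rfl⟩ := S.mem_Sm.1 hs
  obtain ⟨e, he1, he2⟩ := S.mid (a - a' - bd _ u) (b - b' - bd _ v) (by
    rw [map_add, bd_mapc, bd_mapc, hw] at hw'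
    rw [map_sub, map_sub _ (b - b'), sub_add_sub_comm, hw', sub_self])
  refine (cls_eq _ _).2 ⟨e, S.ikU n ?_⟩
  rw [← bd_mapc, he1, map_sub, map_sub, bd_bd, sub_zero, map_sub, h.h1, h'.h1]

/-- The connecting map as an additive map. -/
def deltaAdd (S : Sq kU kV jU jV) (n : ℕ) : H (n + 1) X →+ H n A :=
  AddMonoidHom.mk' (fun x => (S.exists_tr0 x).choose) (by
    intro x x'
    obtain ⟨z, c, a, b, h, hx, hy⟩ := (S.exists_tr0 x).choose_spec
    obtain ⟨z', c', a', b', h', hx', hy'⟩ := (S.exists_tr0 x').choose_spec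
    obtain ⟨z'', c'', a'', b'', h'', hx'', hy''⟩ := (S.exists_tr0 (x + x')).choose_spec
    rw [hy, hy', hy'', ← map_add]
    refine S.uniq h'' (a' := a + a') (b' := b + b') (z' := z + z') ⟨?_, ?_, ?_⟩ ?_
    · simp [h.h1, h'.h1]
    · simp [h.h2, h'.h2]; abel
    · simp [h.hz, h'.hz]; abel
    · rw [← hx'', map_add, hx, hx'])

/-- The connecting map. -/
def delta (S : Sq kU kV jU jV) (n : ℕ) : H (n + 1) X →ₗ[ℤ] H n A :=
  (S.deltaAdd n).toIntLinearMap

lemma delta_spec (S : Sq kU kV jU jV) {n : ℕ} (a : Ch (n + 1) U) (b : Ch (n + 1) V) (c : Zc A n)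
    (h1 : mapc kU n c = bd n a) (h2 : mapc kV n c = - bd n b) (z : Zc X (n + 1))
    (hz : (z : Ch (n + 1) X) = mapc jU _ a + mapc jV _ b) : S.delta n (cls _ z) = cls n c := by
  obtain ⟨z', c', a', b', h', hx', hy'⟩ := (S.exists_tr0 (cls _ z)).choose_spec
  refine hy'.trans (S.uniq h' (a' := a) (b' := b) (z' := z) ⟨h1, h2, hz⟩ hx'.symm)

lemma exists_tr (S : Sq kU kV jU jV) {n : ℕ} (x : H (n + 1) X) :
    ∃ (a : Ch (n + 1) U) (b : Ch (n + 1) V) (c : Zc A n) (_ : mapc kU n c = bd n a)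
      (_ : mapc kV n c = - bd n b) (hz : mapc jU _ a + mapc jV _ b ∈ Zc X (n + 1)),
      x = cls _ ⟨_, hz⟩ ∧ S.delta n x = cls n c := by
  obtain ⟨y, z, c, a, b, h, rfl, rfl⟩ := S.exists_tr0 x
  refine ⟨a, b, c, h.h1, h.h2, S.bd_tr h.h1 h.h2, ?_, S.delta_spec a b c h.h1 h.h2 z h.hz⟩
  congr 1
  exact Subtype.ext h.hz

lemma comm_h (S : Sq kU kV jU jV) (n : ℕ) (x : H n A) :
    hmap jU n (hmap kU n x) = hmap jV n (hmap kV n x) := by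
  rw [← hmap_comp, ← hmap_comp, S.comm]

lemma delta_jU (S : Sq kU kV jU jV) (n : ℕ) (u : H (n + 1) U) : S.delta n (hmap jU _ u) = 0 := by
  obtain ⟨a, rfl⟩ := cls_surj _ u
  rw [hmap_cls, ← map_zero (cls n)]
  refine S.delta_spec a 0 0 ?_ ?_ _ ?_
  · rw [mem_Zc_succ.1 a.2]; simp
  · simp
  · simp

lemma delta_swap (S : Sq kU kV jU jV) (n : ℕ) (x : H (n + 1) X) :
    S.swap.delta n x = - S.delta n x := by
  obtain ⟨a, b, c, h1, h2, hz, rfl, hd⟩ := S.exists_tr x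
  rw [hd, ← map_neg]
  refine S.swap.delta_spec b a (-c) ?_ ?_ _ ?_
  · simp [h2]
  · simp [h1]
  · exact add_comm _ _

lemma delta_jV (S : Sq kU kV jU jV) (n : ℕ) (u : H (n + 1) V) : S.delta n (hmap jV _ u) = 0 := by
  rw [← neg_eq_zero, ← S.delta_swap]
  exact S.swap.delta_jU n u

lemma exact_X (S : Sq kU kV jU jV) (n : ℕ) (x : H (n + 1) X) (hx : S.delta n x = 0) :
    ∃ u v, x = hmap jU _ u + hmap jV _ v := by
  obtain ⟨a, b, c, h1, h2, hz, rfl, hd⟩ := S.exists_tr x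
  rw [hd, cls_eq_zero] at hx
  obtain ⟨e, he⟩ := hx
  refine ⟨cls _ ⟨a - mapc kU _ e, ?_⟩, cls _ ⟨b + mapc kV _ e, ?_⟩, ?_⟩
  · rw [mem_Zc_succ, map_sub, bd_mapc, he, h1, sub_self]
  · rw [mem_Zc_succ, map_add, bd_mapc, he, h2]; simp
  · rw [hmap_cls, hmap_cls, ← map_add]
    congr 1
    apply Subtype.ext
    simp [S.comm_c]

lemma kU_delta (S : Sq kU kV jU jV) (n : ℕ) (x : H (n + 1) X) : hmap kU n (S.delta n x) = 0 := by
  obtain ⟨a, b, c, h1, h2, hz, rfl, hd⟩ := S.exists_tr x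
  rw [hd, hmap_cls, cls_eq_zero]
  exact ⟨a, h1.symm⟩

lemma kV_delta (S : Sq kU kV jU jV) (n : ℕ) (x : H (n + 1) X) : hmap kV n (S.delta n x) = 0 := by
  rw [← neg_eq_zero, ← map_neg, ← S.delta_swap]
  exact S.swap.kU_delta n x

lemma exact_A (S : Sq kU kV jU jV) (n : ℕ) (y : H n A) (h1 : hmap kU n y = 0)
    (h2 : hmap kV n y = 0) : ∃ x, S.delta n x = y := by
  obtain ⟨c, rfl⟩ := cls_surj _ y
  rw [hmap_cls, cls_eq_zero] at h1 h2
  obtain ⟨a, ha⟩ := h1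
  obtain ⟨b, hb⟩ := h2
  have e1 : mapc kU n c = bd n a := ha.symm
  have e2 : mapc kV n c = - bd n (-b) := by rw [map_neg, neg_neg]; exact hb.symm
  exact ⟨cls _ ⟨_, S.bd_tr e1 e2⟩, S.delta_spec a (-b) c e1 e2 _ rfl⟩

lemma exact_UV (S : Sq kU kV jU jV) (n : ℕ) (u : H n U) (v : H n V)
    (h : hmap jU n u + hmap jV n v = 0) : ∃ c, hmap kU n c = u ∧ hmap kV n c = - v := by
  obtain ⟨a, rfl⟩ := cls_surj _ u
  obtain ⟨b, rfl⟩ := cls_surj _ v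
  rw [hmap_cls, hmap_cls, ← map_add, cls_eq_zero] at h
  obtain ⟨w, hw⟩ := h
  have hw : bd n w = mapc jU _ a + mapc jV _ b := hw
  obtain ⟨w', hs, hw'⟩ := S.bd_small w (by rw [hw]; exact S.mem_Sm.2 ⟨a, b, rfl⟩)
  obtain ⟨e, f, rfl⟩ := S.mem_Sm.1 hs
  obtain ⟨c, h1, h2⟩ := S.mid ((a : Ch n U) - bd _ e) ((b : Ch n V) - bd _ f) (by
    rw [map_add, bd_mapc, bd_mapc, hw] at hw'
    rw [map_sub, map_sub, sub_add_sub_comm, hw', sub_self])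
  have hc : c ∈ Zc A n := by
    cases n with
    | zero => trivial
    | succ n =>
      rw [mem_Zc_succ]
      apply S.ikU
      rw [← bd_mapc, h1, map_sub, bd_bd, mem_Zc_succ.1 a.2]; simp
  refine ⟨cls n ⟨c, hc⟩, ?_, ?_⟩
  · rw [hmap_cls]
    symm
    rw [cls_eq]
    exact ⟨e, by simp [h1]⟩
  · rw [hmap_cls, ← map_neg, cls_eq]
    exact ⟨f, by simp [h2]⟩

lemma delta_nat (S : Sq kU kV jU jV) (S' : Sq kU' kV' jU' jV') (α : C(A, A')) (μ : C(U, U'))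
    (ν : C(V, V')) (ξ : C(X, X')) (h1 : kU'.comp α = μ.comp kU) (h2 : kV'.comp α = ν.comp kV)
    (h3 : ξ.comp jU = jU'.comp μ) (h4 : ξ.comp jV = jV'.comp ν) (n : ℕ) (x : H (n + 1) X) :
    S'.delta n (hmap ξ _ x) = hmap α n (S.delta n x) := by
  obtain ⟨a, b, c, e1, e2, hz, rfl, hd⟩ := S.exists_tr x
  rw [hd, hmap_cls, hmap_cls]
  refine S'.delta_spec (mapc μ _ a) (mapc ν _ b) _ ?_ ?_ _ ?_
  · rw [mapz_coe, mapc_mapc, h1, ← mapc_mapc, e1, bd_mapc]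
  · rw [mapz_coe, mapc_mapc, h2, ← mapc_mapc, e2, bd_mapc, map_neg]
  · simp only [mapz_coe, map_add, mapc_mapc, h3, h4]

end Sq
end GT

set_option linter.unusedSectionVars false
set_option linter.unusedVariables false
namespace GT

/-! ### Quotients of subsets by equivalence relations -/

section Q
variable {E E₁ E₂ E₃ : Type} [TopologicalSpace E] [TopologicalSpace E₁] [TopologicalSpace E₂]
  [TopologicalSpace E₃]

/-- The quotient of a subset. -/
def Q (s : Setoid E) (S : Set E) : Type := Quotient (s.comap (Subtype.val : S → E))

instance (s : Setoid E) (S : Set E) : TopologicalSpace (Q s S) :=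
  inferInstanceAs (TopologicalSpace (Quotient (s.comap (Subtype.val : S → E))))

/-- Points of the quotient. -/
def qmk (s : Setoid E) {S : Set E} (x : S) : Q s S := Quotient.mk _ x

lemma qmk_eq {s : Setoid E} {S : Set E} {x y : S} : qmk s x = qmk s y ↔ s x y := Quotient.eq

lemma qmk_surj {s : Setoid E} {S : Set E} (x : Q s S) : ∃ y, qmk s y = x := Quotient.exists_rep x

lemma continuous_qmk (s : Setoid E) (S : Set E) : Continuous (qmk s (S := S)) := continuous_quot_mk

/-- Saturations of open sets are open. -/
class OS (s : Setoid E) : Prop where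
  op : ∀ O : Set E, IsOpen O → IsOpen {y | ∃ x ∈ O, s x y}

/-- Saturated sets. -/
def Sat (s : Setoid E) (S : Set E) : Prop := ∀ x y, s x y → x ∈ S → y ∈ S

lemma qmk_open (s : Setoid E) [OS s] {S : Set E} (hS : Sat s S) : IsOpenQuotientMap (qmk s (S := S)) where
  surjective := qmk_surj
  continuous := continuous_qmk s S
  isOpenMap := by
    rintro _ ⟨O, hO, rfl⟩
    have : IsOpen (qmk s ⁻¹' (qmk s (S := S) '' (Subtype.val ⁻¹' O))) := by
      convert (OS.op (s := s) O hO).preimage continuous_subtype_val using 1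
      ext y
      constructor
      · rintro ⟨x, hx, h⟩
        exact ⟨x, hx, qmk_eq.1 h⟩
      · rintro ⟨x, hx, h⟩
        exact ⟨⟨x, hS _ _ (s.symm h) y.2⟩, hx, qmk_eq.2 h⟩
    exact isOpen_coinduced.2 this

/-- Maps inducing continuous maps of quotients. -/
structure QM (s₁ : Setoid E₁) (S₁ : Set E₁) (s₂ : Setoid E₂) (S₂ : Set E₂) (F : E₁ → E₂) : Prop where
  maps : ∀ x ∈ S₁, F x ∈ S₂
  rel : ∀ x ∈ S₁, ∀ y ∈ S₁, s₁ x y → s₂ (F x) (F y)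
  cont : ∀ x₀ ∈ S₁, ∃ F' : E₁ → E₂, ContinuousWithinAt F' S₁ x₀ ∧
    ∀ᶠ x in nhdsWithin x₀ S₁, F' x ∈ S₂ ∧ s₂ (F' x) (F x)

variable {s : Setoid E} {S : Set E}
variable {s₁ : Setoid E₁} {S₁ : Set E₁} {s₂ : Setoid E₂} {S₂ : Set E₂} {s₃ : Setoid E₃} {S₃ : Set E₃}

lemma QM.mk' {F : E₁ → E₂} (maps : ∀ x ∈ S₁, F x ∈ S₂) (rel : ∀ x y, s₁ x y → s₂ (F x) (F y))
    (cont : ContinuousOn F S₁) : QM s₁ S₁ s₂ S₂ F where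
  maps := maps
  rel x _ y _ := rel x y
  cont x₀ hx₀ := ⟨F, cont x₀ hx₀, by
    filter_upwards [self_mem_nhdsWithin] with x hx
    exact ⟨maps x hx, s₂.refl _⟩⟩

/-- The induced map. -/
def qmap {F : E₁ → E₂} (h : QM s₁ S₁ s₂ S₂ F) : C(Q s₁ S₁, Q s₂ S₂) where
  toFun := Quotient.lift (fun x : S₁ => qmk s₂ ⟨F x, h.maps x x.2⟩)
    (fun x y hxy => qmk_eq.2 (h.rel x x.2 y y.2 hxy))
  continuous_toFun := by
    refine continuous_quot_lift _ ?_
    rw [continuous_iff_continuousAt]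
    rintro ⟨x₀, hx₀⟩
    obtain ⟨F', hc, he⟩ := h.cont x₀ hx₀
    have he' : ∀ᶠ x : S₁ in nhds ⟨x₀, hx₀⟩, F' x ∈ S₂ ∧ s₂ (F' x) (F x) := by
      rw [nhds_subtype_eq_comap_nhdsWithin]
      exact he.comap _
    classical
    have hF0 : F' x₀ ∈ S₂ := he'.self_of_nhds.1
    let g : S₁ → S₂ := fun x => if hx : F' x ∈ S₂ then ⟨F' x, hx⟩ else ⟨F' x₀, hF0⟩
    have hg : ContinuousAt g ⟨x₀, hx₀⟩ := by
      rw [Topology.IsInducing.subtypeVal.continuousAt_iff]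
      have h1 : ContinuousAt (fun x : S₁ => F' x) ⟨x₀, hx₀⟩ := by
        rw [ContinuousAt, nhds_subtype_eq_comap_nhdsWithin]
        exact Filter.Tendsto.comp hc Filter.tendsto_comap
      refine h1.congr ?_
      filter_upwards [he'] with x hx
      simp [g, hx.1]
    have := (continuous_qmk s₂ S₂).continuousAt.comp hg
    refine this.congr ?_
    filter_upwards [he'] with x hx
    simp only [Function.comp, g, hx.1, dite_true]
    exact qmk_eq.2 hx.2

@[simp] lemma qmap_mk {F : E₁ → E₂} (h : QM s₁ S₁ s₂ S₂ F) (x : S₁) :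
    qmap h (qmk s₁ x) = qmk s₂ ⟨F x, h.maps x x.2⟩ := rfl

lemma qext {X : Type} [TopologicalSpace X] {f g : C(Q s S, X)} (h : ∀ x, f (qmk s x) = g (qmk s x)) :
    f = g := by
  ext x
  obtain ⟨y, rfl⟩ := qmk_surj x
  exact h y

lemma qmap_homotopic [OS s₁] (hS : Sat s₁ S₁) (F : ℝ → E₁ → E₂) {F₀ F₁ : E₁ → E₂}
    (h0 : QM s₁ S₁ s₂ S₂ F₀)
    (h1 : QM s₁ S₁ s₂ S₂ F₁) (e0 : ∀ x ∈ S₁, s₂ (F 0 x) (F₀ x)) (e1 : ∀ x ∈ S₁, s₂ (F 1 x) (F₁ x))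
    (maps : ∀ t ∈ Set.Icc (0 : ℝ) 1, ∀ x ∈ S₁, F t x ∈ S₂)
    (rel : ∀ t ∈ Set.Icc (0 : ℝ) 1, ∀ x ∈ S₁, ∀ y ∈ S₁, s₁ x y → s₂ (F t x) (F t y))
    (cont : ContinuousOn (fun p : ℝ × E₁ => F p.1 p.2) (Set.Icc (0 : ℝ) 1 ×ˢ S₁)) :
    (qmap h0).Homotopic (qmap h1) := by
  have hq : IsOpenQuotientMap (Prod.map (id : unitInterval → unitInterval) (qmk s₁ (S := S₁))) :=
    IsOpenQuotientMap.id.prodMap (qmk_open s₁ hS)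
  let Φ : unitInterval × Q s₁ S₁ → Q s₂ S₂ := fun p =>
    Quotient.lift (fun x : S₁ => qmk s₂ ⟨F p.1 x, maps _ p.1.2 x x.2⟩)
    (fun x y hxy => qmk_eq.2 (rel _ p.1.2 x x.2 y y.2 hxy)) p.2
  have hΦ : Continuous Φ := by
    rw [hq.isQuotientMap.continuous_iff]
    refine (continuous_qmk s₂ S₂).comp (f := fun p : unitInterval × S₁ =>
      (⟨F p.1 p.2, maps _ p.1.2 p.2 p.2.2⟩ : S₂)) ?_
    refine Continuous.subtype_mk ?_ _
    exact cont.comp_continuous (f := fun p : unitInterval × S₁ => ((p.1 : ℝ), (p.2 : E₁)))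
      (by fun_prop) (fun p => ⟨p.1.2, p.2.2⟩)
  refine ⟨⟨⟨Φ, hΦ⟩, ?_, ?_⟩⟩
  · intro x
    obtain ⟨y, rfl⟩ := qmk_surj x
    exact qmk_eq.2 (e0 y y.2)
  · intro x
    obtain ⟨y, rfl⟩ := qmk_surj x
    exact qmk_eq.2 (e1 y y.2)

lemma QM.id' {S S' : Set E} (h : S ⊆ S') : QM s S s S' (fun x => x) :=
  QM.mk' (fun _ hx => h hx) (fun _ _ h => h) continuousOn_id

/-- Inclusions. -/
def qinc (s : Setoid E) {S S' : Set E} (h : S ⊆ S') : C(Q s S, Q s S') := qmap (QM.id' h)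

@[simp] lemma qinc_mk {S S' : Set E} (h : S ⊆ S') (x : S) :
    qinc s h (qmk s x) = qmk s ⟨x, h x.2⟩ := rfl

lemma qinc_openEmb [OS s] {S S' : Set E} (h : S ⊆ S') (hO : IsOpen S) (hS : Sat s S) (hS' : Sat s S') :
    Topology.IsOpenEmbedding (qinc s h) := by
  refine Topology.IsOpenEmbedding.of_continuous_injective_isOpenMap (qinc s h).continuous ?_ ?_
  · intro x y hxy
    obtain ⟨x, rfl⟩ := qmk_surj x
    obtain ⟨y, rfl⟩ := qmk_surj y
    have hxy : qmk s (⟨x, h x.2⟩ : S') = qmk s ⟨y, h y.2⟩ := hxy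
    exact qmk_eq.2 ((qmk_eq (s := s) (S := S')).1 hxy)
  · intro W hW
    have h1 : IsOpen (Set.inclusion h '' (qmk s ⁻¹' W)) :=
      (Topology.IsOpenEmbedding.inclusion h (by exact hO.preimage continuous_subtype_val)).isOpenMap _
        (hW.preimage (continuous_qmk s S))
    convert (qmk_open s hS').isOpenMap _ h1 using 1
    ext y
    constructor
    · rintro ⟨x, hx, rfl⟩
      obtain ⟨x, rfl⟩ := qmk_surj x
      exact ⟨_, ⟨x, hx, rfl⟩, rfl⟩
    · rintro ⟨_, ⟨x, hx, rfl⟩, rfl⟩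
      exact ⟨qmk s x, hx, rfl⟩

/-- The Mayer-Vietoris square of an open cover. -/
lemma qsq [OS s] {A U V X : Set E} (hAU : A ⊆ U) (hAV : A ⊆ V) (hU : U ⊆ X) (hV : V ⊆ X)
    (oU : IsOpen U) (oV : IsOpen V) (sU : Sat s U) (sV : Sat s V)
    (cov : ∀ x ∈ X, x ∈ U ∨ x ∈ V) (cap : ∀ x ∈ U, x ∈ V → x ∈ A) :
    Sq (qinc s hAU) (qinc s hAV) (qinc s hU) (qinc s hV) := by
  have hA : A = U ∩ V := Set.Subset.antisymm (Set.subset_inter hAU hAV) fun x hx => cap x hx.1 hx.2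
  have oA : IsOpen A := hA ▸ oU.inter oV
  have sA : Sat s A := by
    intro x y h hx
    exact cap y (sU x y h (hAU hx)) (sV x y h (hAV hx))
  have sX : Sat s X := by
    intro x y h hx
    rcases cov x hx with h' | h'
    · exact hU (sU x y h h')
    · exact hV (sV x y h h')
  refine ⟨qext fun x => rfl, qinc_openEmb _ oU sU sX, qinc_openEmb _ oV sV sX, ?_,
    (qinc_openEmb _ oA sA sU).isEmbedding, (qinc_openEmb _ oA sA sV).isEmbedding, ?_⟩
  · intro x
    obtain ⟨x, rfl⟩ := qmk_surj x
    rcases cov x x.2 with h | h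
    · exact Or.inl ⟨qmk s ⟨x, h⟩, rfl⟩
    · exact Or.inr ⟨qmk s ⟨x, h⟩, rfl⟩
  · intro u v h
    obtain ⟨u, rfl⟩ := qmk_surj u
    obtain ⟨v, rfl⟩ := qmk_surj v
    have h : s u v := qmk_eq.1 h
    have huV : (u : E) ∈ V := sV _ _ (s.symm h) v.2
    exact ⟨qmk s ⟨u, cap u u.2 huV⟩, rfl, qmk_eq.2 h⟩

/-- Acyclicity criterion. -/
lemma acy_q [OS s] (hS : Sat s S) (p : E) (hp : p ∈ S) (F : ℝ → E → E)
    (e0 : ∀ x ∈ S, s (F 0 x) p) (e1 : ∀ x ∈ S, s (F 1 x) x)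
    (maps : ∀ t ∈ Set.Icc (0 : ℝ) 1, ∀ x ∈ S, F t x ∈ S)
    (rel : ∀ t ∈ Set.Icc (0 : ℝ) 1, ∀ x ∈ S, ∀ y ∈ S, s x y → s (F t x) (F t y))
    (cont : ContinuousOn (fun p : ℝ × E => F p.1 p.2) (Set.Icc (0 : ℝ) 1 ×ˢ S)) :
    Acy (Q s S) := by
  refine acy_of_contr (qmk s ⟨p, hp⟩) ?_
  have h0 : QM s S s S (fun _ => p) := QM.mk' (fun _ _ => hp) (fun _ _ _ => s.refl _) continuousOn_const
  have := qmap_homotopic hS F h0 (QM.id' (subset_refl S)) e0 e1 maps rel cont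
  have k0 : qmap h0 = ContinuousMap.const _ (qmk s ⟨p, hp⟩) := qext fun x => rfl
  have k1 : qmap (QM.id' (s := s) (subset_refl S)) = ContinuousMap.id _ := qext fun x => rfl
  rwa [k0, k1] at this

end Q
end GT

set_option linter.unusedSectionVars false
set_option linter.unusedVariables false
set_option linter.unnecessarySimpa false
namespace GT

/-! ### Orbit spaces of representations -/

lemma hmap_bij {X Y : Type} [TopologicalSpace X] [TopologicalSpace Y] (f : C(X, Y)) (g : C(Y, X))
    (h1 : (g.comp f).Homotopic (ContinuousMap.id X)) (h2 : (f.comp g).Homotopic (ContinuousMap.id Y))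
    (n : ℕ) : Function.Bijective (hmap f n) := by
  have e1 : ∀ x, hmap g n (hmap f n x) = x := fun x => by
    rw [← hmap_comp, hmap_homotopic h1, hmap_id]
  have e2 : ∀ x, hmap f n (hmap g n x) = x := fun x => by
    rw [← hmap_comp, hmap_homotopic h2, hmap_id]
  exact ⟨Function.LeftInverse.injective e1, Function.RightInverse.surjective e2⟩

section Rep
variable {G K W F W' F' : Type} [Group G] [Group K] [TopologicalSpace G]
  [NormedAddCommGroup W] [NormedSpace ℝ W] [FiniteDimensional ℝ W]
  [NormedAddCommGroup F] [NormedSpace ℝ F] [FiniteDimensional ℝ F]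
  [NormedAddCommGroup W'] [NormedSpace ℝ W'] [FiniteDimensional ℝ W']
  [NormedAddCommGroup F'] [NormedSpace ℝ F'] [FiniteDimensional ℝ F']

/-- The orbit relation. -/
def orb (ρ : Representation ℝ G W) : Setoid W where
  r x y := ∃ g, ρ g x = y
  iseqv := ⟨fun x => ⟨1, by simp⟩, by
    rintro x _ ⟨g, rfl⟩
    exact ⟨g⁻¹, by simp⟩, by
    rintro x _ _ ⟨g, rfl⟩ ⟨h, rfl⟩
    exact ⟨h * g, by simp⟩⟩

lemma orb_iff {ρ : Representation ℝ G W} {x y : W} : orb ρ x y ↔ ∃ g, ρ g x = y := Iff.rfl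

lemma rep_inv_apply (ρ : Representation ℝ G W) (g : G) (x : W) : ρ g⁻¹ (ρ g x) = x := by
  simp

lemma rep_eq_zero (ρ : Representation ℝ G W) (g : G) {x : W} (h : ρ g x = 0) : x = 0 := by
  rw [← rep_inv_apply ρ g x, h, map_zero]

instance (ρ : Representation ℝ G W) : OS (orb ρ) where
  op O hO := by
    have : {y | ∃ x ∈ O, orb ρ x y} = ⋃ g : G, (ρ g) ⁻¹' O := by
      ext y
      simp only [Set.mem_ofPred_eq, Set.mem_iUnion, Set.mem_preimage]
      constructor
      · rintro ⟨x, hx, g, rfl⟩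
        exact ⟨g⁻¹, by rwa [rep_inv_apply]⟩
      · rintro ⟨g, hg⟩
        exact ⟨_, hg, g⁻¹, rep_inv_apply _ _ _⟩
    rw [this]
    exact isOpen_iUnion fun g => hO.preimage (ρ g).continuous_of_finiteDimensional

/-- Nonzero vectors. -/
def nz (W : Type) [NormedAddCommGroup W] : Set W := {x | x ≠ 0}

lemma mem_nz {x : W} : x ∈ nz W ↔ x ≠ 0 := Iff.rfl

lemma sat_nz (ρ : Representation ℝ G W) : Sat (orb ρ) (nz W) := by
  rintro x _ ⟨g, rfl⟩ hx h
  exact hx (rep_eq_zero ρ g h)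

lemma open_nz : IsOpen (nz W) := isOpen_compl_singleton

/-- Orbit space of nonzero vectors. -/
abbrev P (ρ : Representation ℝ G W) : Type := Q (orb ρ) (nz W)

lemma P_congr {ρ : Representation ℝ G W} {ρ' : Representation ℝ K W'} (e : W ≃ₗ[ℝ] W')
    (h : ∀ x y, orb ρ x y ↔ orb ρ' (e x) (e y)) :
    ∃ f : C(P ρ, P ρ'), (∀ x : nz W, f (qmk _ x) = qmk (orb ρ') (⟨e x, fun h => x.2 (e.map_eq_zero_iff.1 h)⟩ : nz W')) ∧
      ∀ n, Function.Bijective (hmap f n) := by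
  have q1 : QM (orb ρ) (nz W) (orb ρ') (nz W') e := QM.mk' (fun x hx => by simpa [mem_nz] using hx)
    (fun x y => (h x y).1) (LinearMap.continuous_of_finiteDimensional e.toLinearMap).continuousOn
  have q2 : QM (orb ρ') (nz W') (orb ρ) (nz W) e.symm := QM.mk'
    (fun x hx => by simpa [mem_nz] using hx)
    (fun x y hxy => (h _ _).2 (by simpa using hxy))
    (LinearMap.continuous_of_finiteDimensional e.symm.toLinearMap).continuousOn
  refine ⟨qmap q1, fun x => rfl, hmap_bij _ (qmap q2) ?_ ?_⟩
  · have : (qmap q2).comp (qmap q1) = ContinuousMap.id _ := qext fun x => by simp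
    rw [this]
  · have : (qmap q1).comp (qmap q2) = ContinuousMap.id _ := qext fun x => by simp
    rw [this]

/-- The hypotheses for the pair step. -/
structure PairD (ρ : Representation ℝ G W) (σ : Representation ℝ G F) (ι : K →* G) (e : F)
    (ν : F → ℝ) : Prop where
  ca : Continuous (fun p : G × W => ρ p.1 p.2)
  νc : Continuous ν
  νi : ∀ g f, ν (σ g f) = ν f
  νh : ∀ (c : ℝ) f, 0 ≤ c → ν (c • f) = c * ν f
  νp : ∀ f, f ≠ 0 → 0 < ν f
  νe : ν e = 1
  h1 : ∀ k, σ (ι k) e = e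
  h2 : ∀ g, σ g e = e → ∃ k, ρ (ι k) = ρ g
  h3 : ∀ f₀, f₀ ≠ 0 → ∃ u : F → G, ContinuousAt u f₀ ∧ ∀ᶠ f in nhds f₀, σ (u f) f = ν f • e

/-- First open set. -/
def sU (W F : Type) [NormedAddCommGroup W] [NormedAddCommGroup F] : Set (W × F) := {p | p.2 ≠ 0}
/-- Second open set. -/
def sV (W F : Type) [NormedAddCommGroup W] [NormedAddCommGroup F] : Set (W × F) := {p | p.1 ≠ 0}
/-- Intersection. -/
def sA (W F : Type) [NormedAddCommGroup W] [NormedAddCommGroup F] : Set (W × F) :=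
  {p | p.1 ≠ 0 ∧ p.2 ≠ 0}

lemma sAU : sA W F ⊆ sU W F := fun _ h => h.2
lemma sAV : sA W F ⊆ sV W F := fun _ h => h.1
lemma sUX : sU W F ⊆ nz (W × F) := fun _ h h' => h (by rw [h']; rfl)
lemma sVX : sV W F ⊆ nz (W × F) := fun _ h h' => h (by rw [h']; rfl)
lemma open_sU : IsOpen (sU W F) := isOpen_compl_singleton.preimage continuous_snd
lemma open_sV : IsOpen (sV W F) := isOpen_compl_singleton.preimage continuous_fst

section
variable (ρ : Representation ℝ G W) (σ : Representation ℝ G F)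

lemma sat_sU : Sat (orb (ρ.prod σ)) (sU W F) := by
  rintro x _ ⟨g, rfl⟩ hx h
  exact hx (rep_eq_zero σ g h)

lemma sat_sV : Sat (orb (ρ.prod σ)) (sV W F) := by
  rintro x _ ⟨g, rfl⟩ hx h
  exact hx (rep_eq_zero ρ g h)

lemma sat_sA : Sat (orb (ρ.prod σ)) (sA W F) := fun x y h hx =>
  ⟨sat_sV ρ σ x y h hx.1, sat_sU ρ σ x y h hx.2⟩

/-- The square for a product. -/
lemma psq : Sq (qinc (orb (ρ.prod σ)) (sAU (W := W) (F := F))) (qinc (orb (ρ.prod σ)) sAV)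
    (qinc (orb (ρ.prod σ)) sUX) (qinc (orb (ρ.prod σ)) sVX) :=
  qsq _ _ _ _ open_sU open_sV (sat_sU ρ σ) (sat_sV ρ σ) (fun x hx => by
    by_contra! h
    have h1 : x.2 = 0 := not_not.1 h.1
    have h2 : x.1 = 0 := not_not.1 h.2
    exact hx (Prod.ext h2 h1)) (fun x h1 h2 => ⟨h2, h1⟩)

lemma qm_prV : QM (orb (ρ.prod σ)) (sV W F) (orb ρ) (nz W) Prod.fst :=
  QM.mk' (fun x hx => hx) (by rintro x _ ⟨g, rfl⟩; exact ⟨g, rfl⟩) continuous_fst.continuousOn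

lemma qm_inV : QM (orb ρ) (nz W) (orb (ρ.prod σ)) (sV W F) (fun w => (w, 0)) :=
  QM.mk' (fun x hx => hx) (by rintro x _ ⟨g, rfl⟩; exact ⟨g, by simp⟩)
    (by fun_prop)

lemma prV_inV : (qmap (qm_prV ρ σ)).comp (qmap (qm_inV ρ σ)) = ContinuousMap.id _ :=
  qext fun x => rfl

lemma inV_prV : ((qmap (qm_inV ρ σ)).comp (qmap (qm_prV ρ σ))).Homotopic (ContinuousMap.id _) := by
  have h0 : QM (orb (ρ.prod σ)) (sV W F) (orb (ρ.prod σ)) (sV W F) (fun p => (p.1, 0)) :=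
    QM.mk' (fun x hx => hx) (by rintro x _ ⟨g, rfl⟩; exact ⟨g, by simp⟩) (by fun_prop)
  have := qmap_homotopic (sat_sV ρ σ) (fun t p => (p.1, t • p.2)) h0 (QM.id' (subset_refl _))
    (fun x hx => by simpa using (orb _).refl _) (fun x hx => by simpa using (orb _).refl _)
    (fun t ht x hx => hx)
    (by rintro t ht x hx _ hy ⟨g, rfl⟩; exact ⟨g, by simp⟩) (by fun_prop)
  convert this using 1
  all_goals exact qext fun x => rfl

lemma bij_prV (n : ℕ) : Function.Bijective (hmap (qmap (qm_prV ρ σ)) n) :=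
  hmap_bij _ (qmap (qm_inV ρ σ)) (inV_prV ρ σ) (by rw [prV_inV]) n

lemma bij_inV (n : ℕ) : Function.Bijective (hmap (qmap (qm_inV ρ σ)) n) :=
  hmap_bij _ (qmap (qm_prV ρ σ)) (by rw [prV_inV]) (inV_prV ρ σ) n

lemma qm_inc : QM (orb ρ) (nz W) (orb (ρ.prod σ)) (nz (W × F)) (fun w => (w, 0)) :=
  QM.mk' (fun x hx => sVX hx) (by rintro x _ ⟨g, rfl⟩; exact ⟨g, by simp⟩)
    (by fun_prop)

/-- Inclusion of the first factor. -/
def pinc : C(P ρ, P (ρ.prod σ)) := qmap (qm_inc ρ σ)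

lemma qm_proj (ι : K →* G) : QM (orb (MonoidHom.comp ρ ι)) (nz W) (orb ρ) (nz W) (fun w => w) :=
  QM.mk' (fun x hx => hx) (by rintro x _ ⟨g, rfl⟩; exact ⟨ι g, by simp⟩)
    (by fun_prop)

/-- Projection from the quotient by a smaller group. -/
def pproj (ι : K →* G) : C(P (MonoidHom.comp ρ ι), P ρ) := qmap (qm_proj ρ ι)

end

namespace PairD
variable {ρ : Representation ℝ G W} {σ : Representation ℝ G F} {ι : K →* G} {e : F} {ν : F → ℝ}

lemma e_ne (D : PairD ρ σ ι e ν) : e ≠ 0 := by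
  rintro rfl
  have := D.νh 0 0 le_rfl
  simp [D.νe] at this

lemma scale_pos (D : PairD ρ σ ι e ν) {t : ℝ} (ht : t ∈ Set.Icc (0 : ℝ) 1) {f : F} (hf : f ≠ 0) :
    0 < (1 - t) / ν f + t := by
  have := D.νp f hf
  rcases ht.1.eq_or_lt with h | h
  · subst h
    simpa using this
  · have : 0 ≤ (1 - t) / ν f := div_nonneg (by linarith [ht.2]) this.le
    linarith

lemma cont_scale (D : PairD ρ σ ι e ν) (S : Set (W × F)) (hS : ∀ p ∈ S, p.2 ≠ 0) :
    ContinuousOn (fun p : ℝ × (W × F) => ((1 - p.1) / ν p.2.2 + p.1) • p.2.2)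
      (Set.Icc (0 : ℝ) 1 ×ˢ S) := by
  have := D.νc
  refine ContinuousOn.smul (ContinuousOn.add (ContinuousOn.div ?_ ?_ ?_) ?_) ?_
  · fun_prop
  · fun_prop
  · rintro ⟨t, p⟩ ⟨ht, hp⟩
    exact (D.νp _ (hS p hp)).ne'
  · fun_prop
  · fun_prop

/-- Any nonzero vector can be moved to the standard position. -/
lemma ex_u (D : PairD ρ σ ι e ν) (f : F) (hf : f ≠ 0) : ∃ g, σ g f = ν f • e := by
  obtain ⟨u, _, hu⟩ := D.h3 f hf
  exact ⟨u f, hu.self_of_nhds⟩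

open Classical in
/-- A choice of element moving to standard position. -/
def gf (D : PairD ρ σ ι e ν) (f : F) : G := if h : f ≠ 0 then (D.ex_u f h).choose else 1

lemma gf_spec (D : PairD ρ σ ι e ν) {f : F} (hf : f ≠ 0) : σ (D.gf f) f = ν f • e := by
  rw [gf, dif_pos hf]
  exact (D.ex_u f hf).choose_spec

lemma rel_of (D : PairD ρ σ ι e ν) {f f' : F} (hf : f ≠ 0) {g a b : G} (hg : σ g f = f')
    (ha : σ a f = ν f • e) (hb : σ b f' = ν f' • e) (w : W) :
    orb (MonoidHom.comp ρ ι) (ρ a w) (ρ b (ρ g w)) := by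
  have hν : ν f' = ν f := by rw [← hg, D.νi]
  have hp := D.νp f hf
  have : σ (b * g * a⁻¹) e = e := by
    have h1 : σ (b * g * a⁻¹) (ν f • e) = ν f • e := by
      have h2 : σ a⁻¹ (ν f • e) = f := by rw [← ha, rep_inv_apply]
      simp only [map_mul, Module.End.mul_apply, h2, hg, hb, hν]
    rw [map_smul] at h1
    exact smul_right_injective _ hp.ne' h1
  obtain ⟨k, hk⟩ := D.h2 _ this
  refine ⟨k, ?_⟩
  simp only [MonoidHom.comp_apply, hk, map_mul, Module.End.mul_apply, rep_inv_apply]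

lemma qm_psi (D : PairD ρ σ ι e ν) : QM (orb (ρ.prod σ)) (sA W F) (orb (MonoidHom.comp ρ ι)) (nz W)
    (fun p => ρ (D.gf p.2) p.1) where
  maps p hp h := hp.1 (rep_eq_zero ρ _ h)
  rel := by
    rintro ⟨w, f⟩ hx _ hy ⟨g, rfl⟩
    exact D.rel_of hx.2 (g := g) rfl (D.gf_spec hx.2) (D.gf_spec hy.2) w
  cont := by
    rintro ⟨w₀, f₀⟩ h0
    obtain ⟨u, hu, hu'⟩ := D.h3 f₀ h0.2
    refine ⟨fun p => ρ (u p.2) p.1, ?_, ?_⟩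
    · apply ContinuousAt.continuousWithinAt
      have h1 : ContinuousAt (fun p : W × F => (u p.2, p.1)) (w₀, f₀) :=
        (hu.comp (x := (w₀, f₀)) (f := Prod.snd) continuousAt_snd).prodMk continuousAt_fst
      exact ContinuousAt.comp (g := fun p : G × W => ρ p.1 p.2) D.ca.continuousAt h1
    · have := (continuousAt_snd (p := (w₀, f₀)) |>.eventually hu')
      filter_upwards [self_mem_nhdsWithin, nhdsWithin_le_nhds this] with p hp hpu
      refine ⟨fun h => hp.1 (rep_eq_zero ρ _ h), ?_⟩
      have := D.rel_of hp.2 (g := 1) (f' := p.2) (by simp) hpu (D.gf_spec hp.2) p.1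
      simpa using this

/-- The map from the intersection. -/
def psi (D : PairD ρ σ ι e ν) : C(Q (orb (ρ.prod σ)) (sA W F), P (MonoidHom.comp ρ ι)) :=
  qmap D.qm_psi

lemma psi_mk (D : PairD ρ σ ι e ν) (p : sA W F) (g : G) (hg : σ g p.1.2 = ν p.1.2 • e) :
    D.psi (qmk _ p) = qmk _ (⟨ρ g p.1.1, fun h => p.2.1 (rep_eq_zero ρ _ h)⟩ : nz W) := by
  refine qmk_eq.2 ?_
  have := D.rel_of p.2.2 (g := 1) (f' := p.1.2) (by simp) (D.gf_spec p.2.2) hg p.1.1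
  simpa using this

lemma qm_phi (D : PairD ρ σ ι e ν) : QM (orb (MonoidHom.comp ρ ι)) (nz W) (orb (ρ.prod σ)) (sA W F)
    (fun w => (w, e)) :=
  QM.mk' (fun x hx => ⟨hx, D.e_ne⟩)
    (by rintro x _ ⟨g, rfl⟩; exact ⟨ι g, by simp [D.h1]⟩) (by fun_prop)

/-- The map to the intersection. -/
def phi (D : PairD ρ σ ι e ν) : C(P (MonoidHom.comp ρ ι), Q (orb (ρ.prod σ)) (sA W F)) :=
  qmap D.qm_phi

lemma psi_phi (D : PairD ρ σ ι e ν) : D.psi.comp D.phi = ContinuousMap.id _ := qext fun x => by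
  have := D.psi_mk ⟨((x : W), e), x.2, D.e_ne⟩ 1 (by simp [D.νe])
  refine Eq.trans this ?_
  exact qmk_eq.2 (by simpa using (orb _).refl _)

lemma phi_psi (D : PairD ρ σ ι e ν) : (D.phi.comp D.psi).Homotopic (ContinuousMap.id _) := by
  have rl : ∀ t, ∀ x : W × F, ∀ y : W × F, orb (ρ.prod σ) x y → orb (ρ.prod σ)
      (x.1, ((1 - t) / ν x.2 + t) • x.2) (y.1, ((1 - t) / ν y.2 + t) • y.2) := by
    rintro t x _ ⟨g, rfl⟩
    exact ⟨g, by simp [D.νi]⟩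
  have ct := continuousOn_fst.comp (f := Prod.snd) (t := sA W F)
    (continuousOn_snd (s := Set.Icc (0 : ℝ) 1 ×ˢ sA W F)) (fun p hp => hp.2)
    |>.prodMk (D.cont_scale (sA W F) (fun p hp => hp.2))
  have h0 : QM (orb (ρ.prod σ)) (sA W F) (orb (ρ.prod σ)) (sA W F)
      (fun p => (p.1, ((1 - (0:ℝ)) / ν p.2 + 0) • p.2)) :=
    QM.mk' (fun x hx => ⟨hx.1, smul_ne_zero (D.scale_pos (by simp) hx.2).ne' hx.2⟩)
      (rl 0) (ct.comp (f := fun p : W × F => ((0:ℝ), p)) (by fun_prop) (fun p hp => ⟨by simp, hp⟩))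
  have := qmap_homotopic (sat_sA ρ σ) (fun t p => (p.1, ((1 - t) / ν p.2 + t) • p.2)) h0
    (QM.id' (subset_refl _))
    (fun x hx => (orb _).refl _) (fun x hx => by simpa using (orb _).refl _)
    (fun t ht x hx => ⟨hx.1, smul_ne_zero (D.scale_pos ht hx.2).ne' hx.2⟩)
    (fun t ht x _ y _ => rl t x y) ct
  convert this using 1
  swap
  · exact qext fun x => rfl
  refine qext fun x => qmk_eq.2 ?_
  refine (orb _).symm ⟨D.gf x.1.2, ?_⟩
  have hp := D.νp _ x.2.2
  simp [D.gf_spec x.2.2, smul_smul, hp.ne']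

lemma bij_psi (D : PairD ρ σ ι e ν) (n : ℕ) : Function.Bijective (hmap D.psi n) :=
  hmap_bij _ D.phi D.phi_psi (by rw [psi_phi]) n

lemma acyU (D : PairD ρ σ ι e ν) : Acy (Q (orb (ρ.prod σ)) (sU W F)) := by
  refine acy_q (sat_sU ρ σ) (0, e) D.e_ne (fun t p => (t • p.1, ((1 - t) / ν p.2 + t) • p.2)) ?_ ?_
    ?_ ?_ ?_
  · intro x hx
    refine ⟨D.gf x.2, ?_⟩
    have hp := D.νp _ hx
    simp [D.gf_spec hx, smul_smul, hp.ne']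
  · intro x hx
    simpa using (orb _).refl _
  · intro t ht x hx
    exact smul_ne_zero (D.scale_pos ht hx).ne' hx
  · rintro t ht x hx _ hy ⟨g, rfl⟩
    exact ⟨g, by simp [D.νi]⟩
  · exact ContinuousOn.prodMk (by fun_prop) (D.cont_scale (sU W F) (fun p hp => hp))

lemma pr_kV (D : PairD ρ σ ι e ν) : (qmap (qm_prV ρ σ)).comp (qinc (orb (ρ.prod σ)) sAV) =
    (pproj ρ ι).comp D.psi := qext fun x => qmk_eq.2 ⟨D.gf x.1.2, rfl⟩

lemma jV_inV (ρ : Representation ℝ G W) (σ : Representation ℝ G F) :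
    (qinc (orb (ρ.prod σ)) sVX).comp (qmap (qm_inV ρ σ)) = pinc ρ σ :=
  qext fun x => rfl

/-- The connecting map. -/
def dl (D : PairD ρ σ ι e ν) (n : ℕ) : H (n + 1) (P (ρ.prod σ)) →ₗ[ℤ] H n (P (MonoidHom.comp ρ ι)) :=
  (hmap D.psi n).comp ((psq ρ σ).delta n)

lemma dl_apply (D : PairD ρ σ ι e ν) (n : ℕ) (x) : D.dl n x = hmap D.psi n ((psq ρ σ).delta n x) := rfl

lemma ex_X (D : PairD ρ σ ι e ν) (n : ℕ) (x) (h : D.dl n x = 0) : ∃ v, hmap (pinc ρ σ) (n + 1) v = x := by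
  have h : (psq ρ σ).delta n x = 0 := (D.bij_psi n).1 (by rw [← dl_apply, h, map_zero])
  obtain ⟨u, v, rfl⟩ := (psq ρ σ).exact_X n x h
  obtain ⟨w, rfl⟩ := (bij_inV ρ σ _).2 v
  refine ⟨w, ?_⟩
  rw [← jV_inV, hmap_comp, (D.acyU (n + 1)).elim u 0, map_zero, zero_add]

lemma dl_inc (D : PairD ρ σ ι e ν) (n : ℕ) (v) : D.dl n (hmap (pinc ρ σ) (n + 1) v) = 0 := by
  rw [← jV_inV, hmap_comp, dl_apply, (psq ρ σ).delta_jV, map_zero]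

lemma ex_A (D : PairD ρ σ ι e ν) (n : ℕ) (y) (h : hmap (pproj ρ ι) n y = 0) : ∃ x, D.dl n x = y := by
  obtain ⟨z, rfl⟩ := (D.bij_psi n).2 y
  have h2 : hmap (qinc (orb (ρ.prod σ)) sAV) n z = 0 := by
    apply (bij_prV ρ σ n).1
    rw [← hmap_comp, D.pr_kV, hmap_comp, h, map_zero]
  obtain ⟨x, rfl⟩ := (psq ρ σ).exact_A n z ((D.acyU n).elim _ _) h2
  exact ⟨x, rfl⟩

lemma proj_dl (D : PairD ρ σ ι e ν) (n : ℕ) (x) : hmap (pproj ρ ι) n (D.dl n x) = 0 := by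
  rw [dl_apply, ← hmap_comp, ← D.pr_kV, hmap_comp, (psq ρ σ).kV_delta, map_zero]

lemma ex_V (D : PairD ρ σ ι e ν) (n : ℕ) (v) (h : hmap (pinc ρ σ) n v = 0) :
    ∃ y, hmap (pproj ρ ι) n y = v := by
  rw [← jV_inV, hmap_comp] at h
  obtain ⟨c, _, hc⟩ := (psq ρ σ).exact_UV n 0 (hmap (qmap (qm_inV ρ σ)) n v) (by rw [map_zero, zero_add, h])
  refine ⟨hmap D.psi n (-c), ?_⟩
  rw [← hmap_comp, ← D.pr_kV, hmap_comp, map_neg, hc, neg_neg, ← hmap_comp, prV_inV, hmap_id]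

lemma inc_proj (D : PairD ρ σ ι e ν) (n : ℕ) (y) : hmap (pinc ρ σ) n (hmap (pproj ρ ι) n y) = 0 := by
  obtain ⟨z, rfl⟩ := (D.bij_psi n).2 y
  rw [← hmap_comp (pproj ρ ι), ← D.pr_kV, hmap_comp, ← jV_inV, hmap_comp]
  have : hmap (qmap (qm_inV ρ σ)) n (hmap (qmap (qm_prV ρ σ)) n (hmap (qinc (orb (ρ.prod σ)) sAV) n z))
      = hmap (qinc (orb (ρ.prod σ)) sAV) n z := by
    rw [← hmap_comp, hmap_homotopic (inV_prV ρ σ), hmap_id]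
  rw [this, ← hmap_comp, ← (psq ρ σ).comm, hmap_comp, (D.acyU n).elim (hmap _ n z) 0, map_zero]

end PairD

end Rep
end GT

set_option linter.unusedSectionVars false
set_option linter.unusedVariables false
set_option linter.unnecessarySimpa false
namespace GT

section Susp
variable {G K W F W' F' : Type} [Group G] [Group K] [TopologicalSpace G]
  [NormedAddCommGroup W] [NormedSpace ℝ W] [FiniteDimensional ℝ W]
  [NormedAddCommGroup F] [NormedSpace ℝ F] [FiniteDimensional ℝ F]
  [NormedAddCommGroup W'] [NormedSpace ℝ W'] [FiniteDimensional ℝ W']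

/-- The trivial one dimensional representation. -/
abbrev tr (G : Type) [Group G] : Representation ℝ G ℝ := Representation.trivial ℝ G ℝ

/-- Half of the suspension. -/
def uP (W : Type) [NormedAddCommGroup W] : Set (W × ℝ) := {p | p.1 ≠ 0 ∨ 0 < p.2}
/-- Half of the suspension. -/
def uN (W : Type) [NormedAddCommGroup W] : Set (W × ℝ) := {p | p.1 ≠ 0 ∨ p.2 < 0}

lemma uPX : uP W ⊆ nz (W × ℝ) := by
  rintro p h rfl
  simp [uP] at h
lemma uNX : uN W ⊆ nz (W × ℝ) := by
  rintro p h rfl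
  simp [uN] at h
lemma sVP : sV W ℝ ⊆ uP W := fun p h => Or.inl h
lemma sVN : sV W ℝ ⊆ uN W := fun p h => Or.inl h

variable (ρ : Representation ℝ G W)

lemma sat_uP : Sat (orb (ρ.prod (tr G))) (uP W) := by
  rintro x _ ⟨g, rfl⟩ (h | h)
  · exact Or.inl fun h' => h (rep_eq_zero ρ g h')
  · exact Or.inr h

lemma sat_uN : Sat (orb (ρ.prod (tr G))) (uN W) := by
  rintro x _ ⟨g, rfl⟩ (h | h)
  · exact Or.inl fun h' => h (rep_eq_zero ρ g h')
  · exact Or.inr h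

lemma open_uP : IsOpen (uP W) :=
  (isOpen_compl_singleton.preimage continuous_fst).union (isOpen_lt continuous_const continuous_snd)
lemma open_uN : IsOpen (uN W) :=
  (isOpen_compl_singleton.preimage continuous_fst).union (isOpen_lt continuous_snd continuous_const)

lemma ssq : Sq (qinc (orb (ρ.prod (tr G))) (sVP (W := W))) (qinc (orb (ρ.prod (tr G))) sVN)
    (qinc (orb (ρ.prod (tr G))) uPX) (qinc (orb (ρ.prod (tr G))) uNX) :=
  qsq _ _ _ _ open_uP open_uN (sat_uP ρ) (sat_uN ρ) (fun x hx => by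
    by_cases h : x.1 = 0
    · have : x.2 ≠ 0 := fun h' => hx (Prod.ext h h')
      rcases lt_or_gt_of_ne this with h | h
      · exact Or.inr (Or.inr h)
      · exact Or.inl (Or.inr h)
    · exact Or.inl (Or.inl h)) (fun x h1 h2 => by
    rcases h1 with h1 | h1
    · exact h1
    · rcases h2 with h2 | h2
      · exact h2
      · exact absurd h1 h2.not_gt)

lemma acy_uP : Acy (Q (orb (ρ.prod (tr G))) (uP W)) := by
  refine acy_q (sat_uP ρ) (0, 1) (Or.inr one_pos) (fun t p => (t • p.1, t * p.2 + (1 - t))) ?_ ?_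
    ?_ ?_ ?_
  · intro x hx
    simpa using (orb _).refl _
  · intro x hx
    simpa using (orb _).refl _
  · intro t ht x hx
    rcases ht.1.eq_or_lt with h | h
    · subst h
      exact Or.inr (by simp)
    · rcases hx with hx | hx
      · exact Or.inl (smul_ne_zero h.ne' hx)
      · have := mul_pos h hx
        exact Or.inr (by simp only; linarith [ht.2])
  · rintro t ht x hx _ hy ⟨g, rfl⟩
    exact ⟨g, by simp⟩
  · fun_prop

lemma acy_uN : Acy (Q (orb (ρ.prod (tr G))) (uN W)) := by
  refine acy_q (sat_uN ρ) (0, -1) (Or.inr (by simp)) (fun t p => (t • p.1, t * p.2 - (1 - t))) ?_ ?_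
    ?_ ?_ ?_
  · intro x hx
    simpa using (orb _).refl _
  · intro x hx
    simpa using (orb _).refl _
  · intro t ht x hx
    rcases ht.1.eq_or_lt with h | h
    · subst h
      exact Or.inr (by simp)
    · rcases hx with hx | hx
      · exact Or.inl (smul_ne_zero h.ne' hx)
      · have := mul_neg_of_pos_of_neg h hx
        exact Or.inr (by simp only; linarith [ht.2])
  · rintro t ht x hx _ hy ⟨g, rfl⟩
    exact ⟨g, by simp⟩
  · fun_prop

/-- The suspension map. -/
def sdl (n : ℕ) : H (n + 1) (P (ρ.prod (tr G))) →ₗ[ℤ] H n (P ρ) :=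
  (hmap (qmap (qm_prV ρ (tr G))) n).comp ((ssq ρ).delta n)

lemma sdl_bij (n : ℕ) : Function.Bijective (sdl ρ n) := by
  refine (bij_prV ρ (tr G) n).comp ⟨?_, ?_⟩
  · refine (injective_iff_map_eq_zero _).2 fun x hx => ?_
    obtain ⟨u, v, rfl⟩ := (ssq ρ).exact_X n x hx
    rw [(acy_uP ρ _).elim u 0, (acy_uN ρ _).elim v 0, map_zero, map_zero, add_zero]
  · intro y
    exact (ssq ρ).exact_A n y ((acy_uP ρ _).elim _ _) ((acy_uN ρ _).elim _ _)

/-- Swapping the two halves of a suspension. -/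
lemma swap_neg (r : W →ₗ[ℝ] W) (hr : Function.Injective r) (hrel : ∀ x y, orb ρ x y → orb ρ (r x) (r y))
    (q : QM (orb ρ) (nz W) (orb ρ) (nz W) r)
    (k : QM (orb (ρ.prod (tr G))) (nz (W × ℝ)) (orb (ρ.prod (tr G))) (nz (W × ℝ))
      (fun p => (r p.1, -p.2)))
    (n : ℕ) (h : ∀ x, hmap (qmap q) n x = x) (x) : hmap (qmap k) (n + 1) x = -x := by
  have hc := r.continuous_of_finiteDimensional
  have hz : ∀ {x}, x ≠ 0 → r x ≠ 0 := fun hx h' => hx (hr (by rw [h', map_zero]))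
  have rl : ∀ x y, orb (ρ.prod (tr G)) x y → orb (ρ.prod (tr G)) (r x.1, -x.2) (r y.1, -y.2) := by
    rintro x _ ⟨g, rfl⟩
    obtain ⟨g', hg'⟩ := hrel x.1 _ ⟨g, rfl⟩
    exact ⟨g', by simp [hg']⟩
  have ct : Continuous (fun p : W × ℝ => (r p.1, -p.2)) := by fun_prop
  have m1 : QM (orb (ρ.prod (tr G))) (uP W) (orb (ρ.prod (tr G))) (uN W) (fun p => (r p.1, -p.2)) :=
    QM.mk' (fun x hx => hx.imp hz (fun h => by simpa using h)) rl ct.continuousOn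
  have m2 : QM (orb (ρ.prod (tr G))) (uN W) (orb (ρ.prod (tr G))) (uP W) (fun p => (r p.1, -p.2)) :=
    QM.mk' (fun x hx => hx.imp hz (fun h => by simpa using h)) rl ct.continuousOn
  have m3 : QM (orb (ρ.prod (tr G))) (sV W ℝ) (orb (ρ.prod (tr G))) (sV W ℝ) (fun p => (r p.1, -p.2)) :=
    QM.mk' (fun x hx => hz hx) rl ct.continuousOn
  have key := Sq.delta_nat (ssq ρ) (ssq ρ).swap (qmap m3) (qmap m1) (qmap m2) (qmap k)
    (qext fun x => rfl) (qext fun x => rfl) (qext fun x => rfl) (qext fun x => rfl) n x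
  rw [Sq.delta_swap (ssq ρ)] at key
  apply (sdl_bij ρ n).1
  have e : (qmap (qm_prV ρ (tr G))).comp (qmap m3) = (qmap q).comp (qmap (qm_prV ρ (tr G))) :=
    qext fun x => rfl
  have key2 := congrArg (hmap (qmap (qm_prV ρ (tr G))) n) key
  rw [map_neg, ← hmap_comp, e, hmap_comp, h] at key2
  rw [map_neg]
  exact neg_eq_iff_eq_neg.1 key2

/-- Acyclicity by retracting representatives. -/
lemma acy_ret (p : W) (r : W → W) (hr : Continuous r) (hrel : ∀ x, orb ρ (r x) x)
    (hw : ∀ x y, orb ρ x y → ∃ g, ρ g (r x) = r y ∧ ρ g p = p) (hp : p ≠ 0)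
    (hs : ∀ x, x ≠ 0 → ∀ t ∈ Set.Icc (0 : ℝ) 1, t • r x + (1 - t) • p ≠ 0) : Acy (P ρ) := by
  refine acy_q (sat_nz ρ) p hp (fun t x => t • r x + (1 - t) • p) ?_ ?_ ?_ ?_ ?_
  · intro x hx
    simpa using (orb _).refl _
  · intro x hx
    simpa using hrel x
  · intro t ht x hx
    exact hs x hx t ht
  · rintro t ht x hx y hy h
    obtain ⟨g, h1, h2⟩ := hw x y h
    exact ⟨g, by simp [h1, h2]⟩
  · fun_prop

lemma H_empty (X : Type) [TopologicalSpace X] [IsEmpty X] :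
    (∀ n, n ≠ 0 → Subsingleton (H n X)) ∧ Nonempty (H 0 X ≃ₗ[ℤ] ℤ) := by
  have hE : ∀ n, Subsingleton (Ch (n + 1) X) := by
    intro n
    have : IsEmpty C(Dl (n + 1), X) := ⟨fun f => isEmptyElim (f (Classical.arbitrary _))⟩
    exact inferInstanceAs (Subsingleton (C(Dl (n + 1), X) →₀ ℤ))
  constructor
  · intro n hn
    obtain ⟨n, rfl⟩ := Nat.exists_eq_succ_of_ne_zero hn
    refine ⟨fun a b => ?_⟩
    obtain ⟨a, rfl⟩ := cls_surj _ a
    obtain ⟨b, rfl⟩ := cls_surj _ b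
    have : a = b := Subtype.ext ((hE n).elim _ _)
    rw [this]
  · let c0 : C(Dl 0, X) := ⟨fun x => (Dl_zero_elim x).elim, by
      rw [continuous_iff_continuousAt]; exact fun x => (Dl_zero_elim x).elim⟩
    let L : ℤ →ₗ[ℤ] H 0 X := (cls 0).comp
      (LinearMap.toSpanSingleton ℤ (Zc X 0) ⟨Finsupp.single c0 1, trivial⟩)
    refine ⟨(LinearEquiv.ofBijective L ⟨?_, ?_⟩).symm⟩
    · refine (injective_iff_map_eq_zero _).2 fun a ha => ?_
      obtain ⟨b, hb⟩ := (cls_eq_zero _).1 ha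
      rw [(hE 0).elim b 0, map_zero] at hb
      have := DFunLike.congr_fun hb c0
      simpa using this.symm
    · intro y
      obtain ⟨⟨c, hc⟩, rfl⟩ := cls_surj _ y
      refine ⟨c c0, congrArg _ (Subtype.ext ?_)⟩
      refine Finsupp.ext fun σ => ?_
      rw [Subsingleton.elim σ c0]
      simp

lemma sphere (N : ℕ) : ∀ (W : Type) [NormedAddCommGroup W] [NormedSpace ℝ W] [FiniteDimensional ℝ W]
    (ρ : Representation ℝ Unit W), Module.finrank ℝ W = N →
    (∀ n, n ≠ N → Subsingleton (H n (P ρ))) ∧ Nonempty (H N (P ρ) ≃ₗ[ℤ] ℤ) := by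
  induction N with
  | zero =>
    intro W _ _ _ ρ hN
    have := Module.finrank_zero_iff.1 hN
    have : IsEmpty (P ρ) := ⟨fun x => by
      obtain ⟨y, rfl⟩ := qmk_surj x
      exact y.2 (Subsingleton.elim _ _)⟩
    exact H_empty _
  | succ N ih =>
    intro W _ _ _ ρ hN
    have e : W ≃ₗ[ℝ] (Fin N → ℝ) × ℝ := LinearEquiv.ofFinrankEq _ _ (by simp [hN])
    have hu : ∀ u : Unit, ρ u = 1 := fun u => map_one ρ
    let ρ' : Representation ℝ Unit (Fin N → ℝ) := 1
    obtain ⟨f, _, hf⟩ := P_congr (ρ := ρ) (ρ' := ρ'.prod (tr Unit)) e (by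
      intro x y
      simp [orb_iff, hu, ρ'])
    obtain ⟨h1, ⟨h2⟩⟩ := ih (Fin N → ℝ) ρ' (by simp)
    have E : ∀ n, H (n + 1) (P ρ) ≃ₗ[ℤ] H n (P ρ') := fun n =>
      (LinearEquiv.ofBijective _ (hf (n + 1))).trans (LinearEquiv.ofBijective _ (sdl_bij ρ' n))
    refine ⟨?_, ⟨(E N).trans h2⟩⟩
    intro n hn
    cases n with
    | zero => exact H_zero_subsingleton (qmk _ ⟨e.symm (0, 1), by simp [mem_nz]⟩)
    | succ n =>
      have := h1 n (by omega)
      exact (E n).toEquiv.subsingleton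
end Susp
end GT

set_option linter.unusedSectionVars false
set_option linter.unusedVariables false
set_option linter.unnecessarySimpa false
namespace GT

/-! ### The circle -/
section Circ
variable {G K W F W' F' : Type} [Group G] [Group K] [TopologicalSpace G]
  [NormedAddCommGroup W] [NormedSpace ℝ W] [FiniteDimensional ℝ W]
  [NormedAddCommGroup F] [NormedSpace ℝ F] [FiniteDimensional ℝ F]

/-- Continuity of an action. -/
def CA (ρ : Representation ℝ G W) : Prop := Continuous (fun p : G × W => ρ p.1 p.2)

lemma CA.prod {ρ : Representation ℝ G W} {σ : Representation ℝ G F} (h : CA ρ) (h' : CA σ) :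
    CA (ρ.prod σ) := by
  have h1 : Continuous (fun p : G × (W × F) => ρ p.1 p.2.1) :=
    Continuous.comp (g := fun p : G × W => ρ p.1 p.2) (f := fun p : G × (W × F) => (p.1, p.2.1)) h
      (by fun_prop)
  have h2 : Continuous (fun p : G × (W × F) => σ p.1 p.2.2) :=
    Continuous.comp (g := fun p : G × F => σ p.1 p.2) (f := fun p : G × (W × F) => (p.1, p.2.2)) h'
      (by fun_prop)
  exact h1.prodMk h2

lemma CA.comp [TopologicalSpace K] {ρ : Representation ℝ G W} (h : CA ρ) (ι : K →* G) (hι : Continuous ι) :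
    CA (MonoidHom.comp ρ ι) :=
  Continuous.comp (g := fun p : G × W => ρ p.1 p.2) h (f := fun p : K × W => (ι p.1, p.2)) (by fun_prop)

lemma CA.triv : CA (Representation.trivial ℝ G W) := continuous_snd

/-- The standard representation of the circle. -/
def c1 : Representation ℝ Circle ℂ where
  toFun g := LinearMap.mulLeft ℝ (g : ℂ)
  map_one' := by ext; all_goals simp
  map_mul' g h := by ext; all_goals simp

@[simp] lemma c1_apply (g : Circle) (z : ℂ) : c1 g z = g * z := rfl

lemma CA.c1 : CA c1 := by
  have : Continuous (fun p : Circle × ℂ => (p.1 : ℂ) * p.2) := by fun_prop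
  exact this

/-- The unique map from the trivial group. -/
abbrev un (G : Type) [Group G] : Unit →* G := 1

lemma ex_ph {z : ℂ} (h : z ≠ 0) : ∃ c : Circle, (c : ℂ) = (starRingEnd ℂ) z / ‖z‖ :=
  ⟨⟨(starRingEnd ℂ) z / ‖z‖, mem_sphere_zero_iff_norm.2 (by simp [h])⟩, rfl⟩

open Classical in
/-- The phase. -/
def ph (z : ℂ) : Circle := if h : z ≠ 0 then (ex_ph h).choose else 1

lemma ph_spec {z : ℂ} (h : z ≠ 0) : (ph z : ℂ) = (starRingEnd ℂ) z / ‖z‖ := by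
  rw [ph, dif_pos h]
  exact (ex_ph h).choose_spec

lemma ph_mul {z : ℂ} (h : z ≠ 0) : (ph z : ℂ) * z = ‖z‖ := by
  rw [ph_spec h]
  have : (‖z‖ : ℂ) ≠ 0 := by simpa using h
  field_simp
  rw [mul_comm, Complex.mul_conj, Complex.normSq_eq_norm_sq]
  push_cast
  rfl

lemma ph_cont {z : ℂ} (h : z ≠ 0) : ContinuousAt ph z := by
  have hI : Topology.IsInducing (fun c : Circle => (c : ℂ)) := ⟨rfl⟩
  rw [hI.continuousAt_iff]
  have : ContinuousAt (fun z : ℂ => (starRingEnd ℂ) z / ‖z‖) z := by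
    refine ContinuousAt.div ?_ ?_ (by simpa using h)
    · exact Complex.continuous_conj.continuousAt
    · fun_prop
  refine this.congr ?_
  filter_upwards [isOpen_compl_singleton.mem_nhds h] with y hy
  exact (ph_spec hy).symm

lemma pairC {ρ : Representation ℝ Circle W} (h : CA ρ) : PairD ρ c1 (un Circle) 1 (fun z => ‖z‖) where
  ca := h
  νc := continuous_norm
  νi g f := by simp [Circle.norm_coe]
  νh c f hc := by simp [abs_of_nonneg hc]
  νp f hf := norm_pos_iff.2 hf
  νe := by simp
  h1 k := by simp
  h2 g hg := ⟨(), by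
    have : g = 1 := by
      ext
      simpa using hg
    rw [this]; rfl⟩
  h3 f hf := ⟨ph, ph_cont hf, by
    filter_upwards [isOpen_compl_singleton.mem_nhds hf] with y hy
    simp [ph_mul hy]⟩

end Circ

/-! ### The unitary group -/

/-- The unitary group. -/
abbrev U2 : Type := Matrix.unitaryGroup (Fin 2) ℂ

/-- Three-space. -/
abbrev V3 : Type := ℝ × ℂ

/-- Traceless hermitian matrices. -/
def herm : V3 →ₗ[ℝ] Matrix (Fin 2) (Fin 2) ℂ where
  toFun f := !![(f.1 : ℂ), f.2; (starRingEnd ℂ) f.2, -(f.1 : ℂ)]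
  map_add' f g := by
    ext i j
    fin_cases i <;> fin_cases j <;> simp [add_comm]
  map_smul' c f := by
    ext i j
    fin_cases i <;> fin_cases j <;> simp

lemma herm_apply (f : V3) : herm f = !![(f.1 : ℂ), f.2; (starRingEnd ℂ) f.2, -(f.1 : ℂ)] := rfl

/-- Coordinates. -/
def co : Matrix (Fin 2) (Fin 2) ℂ →ₗ[ℝ] V3 where
  toFun M := ((M 0 0).re, M 0 1)
  map_add' f g := by simp
  map_smul' c f := by simp

lemma co_apply (M) : co M = ((M 0 0).re, M 0 1) := rfl

@[simp] lemma co_herm (f : V3) : co (herm f) = f := by simp [co_apply, herm_apply]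

lemma herm_co (M : Matrix (Fin 2) (Fin 2) ℂ) (h1 : star M = M) (h2 : M.trace = 0) : herm (co M) = M := by
  have e00 := congrFun (congrFun h1 0) 0
  have e10 := congrFun (congrFun h1 1) 0
  simp only [Matrix.star_apply, Complex.star_def] at e00 e10
  rw [Matrix.trace_fin_two] at h2
  ext i j
  fin_cases i <;> fin_cases j <;> simp [herm_apply, co_apply]
  · exact Complex.conj_eq_iff_re.1 e00
  · exact e10
  · rw [Complex.conj_eq_iff_re.1 e00]
    linear_combination -h2

lemma star_herm (f : V3) : star (herm f) = herm f := by
  ext i j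
  fin_cases i <;> fin_cases j <;> simp [herm_apply, Matrix.star_apply]

lemma trace_herm (f : V3) : (herm f).trace = 0 := by
  simp [herm_apply, Matrix.trace_fin_two]

lemma herm_inj : Function.Injective herm := Function.LeftInverse.injective co_herm

/-- Underlying function of conjugation. -/
def taufun (g : U2) : V3 →ₗ[ℝ] V3 :=
  co ∘ₗ LinearMap.mulRight ℝ (star (g : Matrix (Fin 2) (Fin 2) ℂ)) ∘ₗ
    LinearMap.mulLeft ℝ (g : Matrix (Fin 2) (Fin 2) ℂ) ∘ₗ herm

lemma herm_taufun (g : U2) (f : V3) : herm (taufun g f) =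
    (g : Matrix (Fin 2) (Fin 2) ℂ) * herm f * star (g : Matrix (Fin 2) (Fin 2) ℂ) := by
  refine herm_co _ ?_ ?_
  · simp [star_mul, star_herm, mul_assoc]
  · have : star (g : Matrix (Fin 2) (Fin 2) ℂ) * (g : Matrix (Fin 2) (Fin 2) ℂ) = 1 :=
      Matrix.UnitaryGroup.star_mul_self g
    simp only [LinearMap.mulLeft_apply, LinearMap.mulRight_apply, LinearMap.comp_apply]
    rw [Matrix.trace_mul_comm, ← mul_assoc, this, one_mul, trace_herm]

/-- The conjugation representation. -/
def tau : Representation ℝ U2 V3 where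
  toFun := taufun
  map_one' := by
    refine LinearMap.ext fun f => herm_inj ?_
    rw [herm_taufun]; simp
  map_mul' g h := by
    refine LinearMap.ext fun f => herm_inj ?_
    rw [Module.End.mul_apply, herm_taufun, herm_taufun, herm_taufun]
    simp [mul_assoc]

lemma herm_tau (g : U2) (f : V3) : herm (tau g f) =
    (g : Matrix (Fin 2) (Fin 2) ℂ) * herm f * star (g : Matrix (Fin 2) (Fin 2) ℂ) := herm_taufun g f

lemma CA.tau : CA tau := by
  have h : Continuous herm := herm.continuous_of_finiteDimensional
  have h' : Continuous co := co.continuous_of_finiteDimensional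
  have : Continuous (fun p : U2 × V3 => co ((p.1 : Matrix (Fin 2) (Fin 2) ℂ) * herm p.2 *
    star (p.1 : Matrix (Fin 2) (Fin 2) ℂ))) := by fun_prop
  exact this

/-- The norm. -/
def nu (f : V3) : ℝ := Real.sqrt (f.1 ^ 2 + ‖f.2‖ ^ 2)

lemma nu_sq (f : V3) : nu f ^ 2 = f.1 ^ 2 + ‖f.2‖ ^ 2 := Real.sq_sqrt (by positivity)

lemma nu_nonneg (f : V3) : 0 ≤ nu f := Real.sqrt_nonneg _

lemma herm_mul (f : V3) : herm f * herm f = ((nu f ^ 2 : ℝ) : ℂ) • (1 : Matrix (Fin 2) (Fin 2) ℂ) := by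
  rw [nu_sq]
  have h : f.2 * (starRingEnd ℂ) f.2 = ((‖f.2‖ ^ 2 : ℝ) : ℂ) := by
    rw [Complex.mul_conj, Complex.normSq_eq_norm_sq]
  push_cast at h
  ext i j
  fin_cases i <;> fin_cases j <;> simp [herm_apply, Matrix.mul_apply]
  · rw [h]; ring
  · ring
  · ring
  · rw [mul_comm _ f.2, h]; ring

lemma nu_tau (g : U2) (f : V3) : nu (tau g f) = nu f := by
  have h1 := herm_mul (tau g f)
  have h2 := herm_mul f
  have hg : star (g : Matrix (Fin 2) (Fin 2) ℂ) * (g : Matrix (Fin 2) (Fin 2) ℂ) = 1 :=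
      Matrix.UnitaryGroup.star_mul_self g
  have hg' : (g : Matrix (Fin 2) (Fin 2) ℂ) * star (g : Matrix (Fin 2) (Fin 2) ℂ) = 1 :=
      Matrix.mem_unitaryGroup_iff.1 g.2
  have h3 : herm (tau g f) * herm (tau g f) = ((nu f ^ 2 : ℝ) : ℂ) • (1 : Matrix (Fin 2) (Fin 2) ℂ) := by
    rw [herm_tau]
    calc _ = (g : Matrix (Fin 2) (Fin 2) ℂ) * (herm f * (star (g : Matrix (Fin 2) (Fin 2) ℂ) *
        (g : Matrix (Fin 2) (Fin 2) ℂ)) * herm f) * star (g : Matrix (Fin 2) (Fin 2) ℂ) := by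
          simp only [mul_assoc]
      _ = _ := by rw [hg, mul_one, h2]; simp [hg']
  rw [h1] at h3
  have := congrFun (congrFun h3 0) 0
  simp only [Matrix.smul_apply, Matrix.one_apply_eq, smul_eq_mul, mul_one] at this
  have h4 : nu (tau g f) ^ 2 = nu f ^ 2 := by exact_mod_cast this
  exact (sq_eq_sq₀ (nu_nonneg _) (nu_nonneg _)).1 h4

/-- The circle in the unitary group. -/
def io : Circle →* U2 where
  toFun c := ⟨!![(c : ℂ), 0; 0, 1], by
    rw [Matrix.mem_unitaryGroup_iff]
    ext i j
    fin_cases i <;> fin_cases j <;> simp [Matrix.mul_apply, Matrix.star_apply, ← Circle.coe_inv_eq_conj]⟩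
  map_one' := by
    ext i j
    fin_cases i <;> fin_cases j <;> simp
  map_mul' a b := by
    ext i j
    fin_cases i <;> fin_cases j <;> simp

lemma io_coe (c : Circle) : (io c : Matrix (Fin 2) (Fin 2) ℂ) = !![(c : ℂ), 0; 0, 1] := rfl

lemma continuous_io : Continuous io := by
  refine Continuous.subtype_mk ?_ _
  refine continuous_matrix fun i j => ?_
  fin_cases i <;> fin_cases j <;> simp <;> fun_prop

lemma tau_io (c : Circle) (f : V3) : tau (io c) f = (f.1, c * f.2) := by
  apply herm_inj
  rw [herm_tau, io_coe]
  ext i j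
  fin_cases i <;> fin_cases j <;> simp [Matrix.mul_apply, Matrix.star_apply, herm_apply]
  · rw [mul_right_comm, ← Circle.coe_inv_eq_conj]; simp
  · ring

/-- A unitary matrix from a vector. -/
def uv (a b : ℂ) (h : ‖a‖ ^ 2 + ‖b‖ ^ 2 = 1) : U2 :=
  ⟨!![(starRingEnd ℂ) a, (starRingEnd ℂ) b; -b, a], by
    have ha : a * (starRingEnd ℂ) a = ((‖a‖ ^ 2 : ℝ) : ℂ) := by
      rw [Complex.mul_conj, Complex.normSq_eq_norm_sq]
    have hb : b * (starRingEnd ℂ) b = ((‖b‖ ^ 2 : ℝ) : ℂ) := by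
      rw [Complex.mul_conj, Complex.normSq_eq_norm_sq]
    have h' : ((‖a‖ ^ 2 : ℝ) : ℂ) + ((‖b‖ ^ 2 : ℝ) : ℂ) = 1 := by exact_mod_cast h
    rw [Matrix.mem_unitaryGroup_iff]
    ext i j
    fin_cases i <;> fin_cases j <;> simp [Matrix.mul_apply, Matrix.star_apply]
    · linear_combination ha + hb + h'
    · ring
    · ring
    · linear_combination ha + hb + h'⟩

end GT

set_option linter.unusedSectionVars false
set_option linter.unusedVariables false
set_option linter.unnecessarySimpa false
namespace GT

/-- The hermitian length of a pair. -/
def nn (a b : ℂ) : ℝ := Real.sqrt (‖a‖ ^ 2 + ‖b‖ ^ 2)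

lemma nn_sq (a b : ℂ) : nn a b ^ 2 = ‖a‖ ^ 2 + ‖b‖ ^ 2 := Real.sq_sqrt (by positivity)

lemma nn_pos {a b : ℂ} (h : a ≠ 0 ∨ b ≠ 0) : 0 < nn a b := by
  refine Real.sqrt_pos.2 ?_
  rcases h with h | h
  · have := norm_pos_iff.2 h
    positivity
  · have := norm_pos_iff.2 h
    positivity

lemma nn_unit {a b : ℂ} (h : a ≠ 0 ∨ b ≠ 0) : ‖a / nn a b‖ ^ 2 + ‖b / nn a b‖ ^ 2 = 1 := by
  have hp := nn_pos h
  simp only [norm_div, Complex.norm_real, Real.norm_eq_abs, abs_of_pos hp, div_pow]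
  rw [← add_div, ← nn_sq, div_self (by positivity)]

open Classical in
/-- The normalized unitary matrix. -/
def un2 (a b : ℂ) : U2 := if h : a ≠ 0 ∨ b ≠ 0 then uv (a / nn a b) (b / nn a b) (nn_unit h) else 1

lemma un2_coe {a b : ℂ} (h : a ≠ 0 ∨ b ≠ 0) : (un2 a b : Matrix (Fin 2) (Fin 2) ℂ) =
    !![(starRingEnd ℂ) (a / nn a b), (starRingEnd ℂ) (b / nn a b); -(b / nn a b), a / nn a b] := by
  rw [un2, dif_pos h]
  rfl

lemma open_pair : IsOpen {p : ℂ × ℂ | p.1 ≠ 0 ∨ p.2 ≠ 0} :=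
  (isOpen_compl_singleton.preimage continuous_fst).union
    (isOpen_compl_singleton.preimage continuous_snd)

lemma un2_cont {a b : ℂ} (h : a ≠ 0 ∨ b ≠ 0) : ContinuousAt (fun p : ℂ × ℂ => un2 p.1 p.2) (a, b) := by
  rw [Topology.IsInducing.subtypeVal.continuousAt_iff]
  have hn : ContinuousAt (fun p : ℂ × ℂ => ((nn p.1 p.2 : ℝ) : ℂ)) (a, b) := by
    unfold nn
    fun_prop
  have hne : ((nn a b : ℝ) : ℂ) ≠ 0 := by exact_mod_cast (nn_pos h).ne'
  have h1 : ContinuousAt (fun p : ℂ × ℂ => p.1 / ((nn p.1 p.2 : ℝ) : ℂ)) (a, b) :=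
    continuousAt_fst.div hn hne
  have h2 : ContinuousAt (fun p : ℂ × ℂ => p.2 / ((nn p.1 p.2 : ℝ) : ℂ)) (a, b) :=
    continuousAt_snd.div hn hne
  have h1' := Complex.continuous_conj.continuousAt.comp h1
  have h2' := Complex.continuous_conj.continuousAt.comp h2
  have : ContinuousAt (fun p : ℂ × ℂ =>
      !![(starRingEnd ℂ) (p.1 / nn p.1 p.2), (starRingEnd ℂ) (p.2 / nn p.1 p.2);
        -(p.2 / nn p.1 p.2), p.1 / nn p.1 p.2]) (a, b) := by
    refine continuousAt_pi.2 fun i => continuousAt_pi.2 fun j => ?_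
    fin_cases i <;> fin_cases j
    · exact h1'
    · exact h2'
    · exact h2.neg
    · exact h1
  refine this.congr ?_
  filter_upwards [open_pair.mem_nhds (x := (a, b)) h] with p hp
  exact (un2_coe hp).symm

lemma tau_un2 {f : V3} {a b : ℂ} (h : a ≠ 0 ∨ b ≠ 0) (e1 : f.1 * a + f.2 * b = nu f * a)
    (e2 : (starRingEnd ℂ) f.2 * a - f.1 * b = nu f * b) : tau (un2 a b) f = nu f • ((1, 0) : V3) := by
  apply herm_inj
  rw [herm_tau]
  set g := (un2 a b : Matrix (Fin 2) (Fin 2) ℂ) with hg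
  have hgg : g * star g = 1 := Matrix.mem_unitaryGroup_iff.1 (un2 a b).2
  have hne : ((nn a b : ℝ) : ℂ) ≠ 0 := by exact_mod_cast (nn_pos h).ne'
  have c1 := congrArg (starRingEnd ℂ) e1
  have c2 := congrArg (starRingEnd ℂ) e2
  simp only [map_add, map_sub, map_mul, Complex.conj_ofReal, Complex.conj_conj] at c1 c2
  have key : g * herm f = herm (nu f • ((1, 0) : V3)) * g := by
    rw [hg, un2_coe h]
    ext i j
    fin_cases i <;> fin_cases j <;>
      simp [Matrix.mul_apply, herm_apply] <;> field_simp
    · linear_combination c1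
    · linear_combination c2
    · linear_combination e2
    · linear_combination -e1
  rw [key, mul_assoc, hgg, mul_one]

lemma nu_cont : Continuous nu := by
  unfold nu
  fun_prop

lemma nu_pos {f : V3} (h : f ≠ 0) : 0 < nu f := by
  refine Real.sqrt_pos.2 ?_
  by_cases h1 : f.1 = 0
  · have : f.2 ≠ 0 := fun h2 => h (Prod.ext h1 h2)
    have := norm_pos_iff.2 this
    positivity
  · positivity

lemma nu_smul (c : ℝ) (f : V3) (hc : 0 ≤ c) : nu (c • f) = c * nu f := by
  unfold nu
  rw [← Real.sqrt_sq hc, ← Real.sqrt_mul (by positivity), Real.sqrt_sq hc]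
  congr 1
  simp [abs_of_nonneg hc]
  ring

lemma nu_e : nu ((1, 0) : V3) = 1 := by simp [nu]

lemma nu_zero : nu (0 : V3) = 0 := by simp [nu]

/-- The flip. -/
def J : U2 := ⟨!![0, 1; 1, 0], by
  rw [Matrix.mem_unitaryGroup_iff]
  ext i j
  fin_cases i <;> fin_cases j <;> simp [Matrix.mul_apply, Matrix.star_apply]⟩

lemma tau_J (f : V3) : tau J f = (-f.1, (starRingEnd ℂ) f.2) := by
  apply herm_inj
  rw [herm_tau]
  ext i j
  fin_cases i <;> fin_cases j <;> simp [J, Matrix.mul_apply, Matrix.star_apply, herm_apply]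

lemma stab {g : U2} (h : tau g (1, 0) = (1, 0)) : ∃ c, tau (io c) = tau g := by
  have h1 := herm_tau g (1, 0)
  rw [h] at h1
  set M := (g : Matrix (Fin 2) (Fin 2) ℂ) with hM
  have hgg : star M * M = 1 := Matrix.UnitaryGroup.star_mul_self g
  have h2 : herm (1, 0) * M = M * herm (1, 0) := by
    conv_lhs => rw [h1]
    rw [mul_assoc, hgg, mul_one]
  have e01 := congrFun (congrFun h2 0) 1
  have e10 := congrFun (congrFun h2 1) 0
  simp [herm_apply, Matrix.mul_apply] at e01 e10
  have z01 : M 0 1 = 0 := by linear_combination e01 / 2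
  have z10 : M 1 0 = 0 := by linear_combination -e10 / 2
  have u0 := congrFun (congrFun hgg 0) 0
  have u1 := congrFun (congrFun hgg 1) 1
  simp [Matrix.mul_apply, Matrix.star_apply, z01, z10] at u0 u1
  have n0 : ‖M 0 0‖ = 1 := by
    have := congrArg norm u0
    simp at this
    nlinarith [norm_nonneg (M 0 0)]
  have n1 : ‖M 1 1‖ = 1 := by
    have := congrArg norm u1
    simp at this
    nlinarith [norm_nonneg (M 1 1)]
  obtain ⟨c, hc⟩ : ∃ c : Circle, (c : ℂ) = M 0 0 * (starRingEnd ℂ) (M 1 1) :=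
    ⟨⟨M 0 0 * (starRingEnd ℂ) (M 1 1), mem_sphere_zero_iff_norm.2 (by simp [n0, n1])⟩, rfl⟩
  refine ⟨c, ?_⟩
  refine LinearMap.ext fun f => herm_inj ?_
  rw [tau_io, herm_tau, ← hM]
  ext i j
  fin_cases i <;> fin_cases j <;>
    simp [Matrix.mul_apply, Matrix.star_apply, herm_apply, z01, z10, hc]
  · linear_combination -(f.1 : ℂ) * u0
  · ring
  · ring
  · linear_combination -(f.1 : ℂ) * u1

section
variable {W : Type} [NormedAddCommGroup W] [NormedSpace ℝ W] [FiniteDimensional ℝ W]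

lemma pairU {ρ : Representation ℝ U2 W} (h : CA ρ) (hρ : ∀ g g', tau g = tau g' → ρ g = ρ g') :
    PairD ρ tau io ((1, 0) : V3) nu where
  ca := h
  νc := nu_cont
  νi := nu_tau
  νh := nu_smul
  νp f hf := nu_pos hf
  νe := nu_e
  h1 k := by simp [tau_io]
  h2 g hg := by
    obtain ⟨k, hk⟩ := stab hg
    exact ⟨k, hρ _ _ hk⟩
  h3 f₀ hf₀ := by
    have hcs : ∀ f : V3, (starRingEnd ℂ) f.2 * f.2 = ((nu f ^ 2 - f.1 ^ 2 : ℝ) : ℂ) := by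
      intro f
      rw [nu_sq, mul_comm, Complex.mul_conj, Complex.normSq_eq_norm_sq]
      congr 1
      ring
    have hc := nu_cont
    by_cases hh : f₀.1 + nu f₀ = 0
    · refine ⟨fun f => un2 f.2 (nu f - f.1), ?_, ?_⟩
      · have hne : (((nu f₀ - f₀.1 : ℝ)) : ℂ) ≠ 0 := by
          have := nu_pos hf₀
          have h' : nu f₀ - f₀.1 ≠ 0 := by linarith
          exact_mod_cast h'
        refine ContinuousAt.comp (g := fun p : ℂ × ℂ => un2 p.1 p.2)
          (f := fun f : V3 => (f.2, (nu f - f.1 : ℂ))) (un2_cont (Or.inr (by simpa using hne))) ?_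
        fun_prop
      · have ho : IsOpen {f : V3 | nu f - f.1 ≠ 0} :=
          isOpen_compl_singleton.preimage (f := fun f : V3 => nu f - f.1) (by fun_prop)
        have := nu_pos hf₀
        filter_upwards [ho.mem_nhds (show nu f₀ - f₀.1 ≠ 0 by linarith)] with f hf
        have hne : ((nu f : ℂ) - f.1) ≠ 0 := by exact_mod_cast hf
        have := hcs f
        push_cast at this
        refine tau_un2 (Or.inr hne) ?_ ?_
        · ring
        · rw [this]; ring
    · refine ⟨fun f => un2 (nu f + f.1) ((starRingEnd ℂ) f.2), ?_, ?_⟩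
      · have hne : ((nu f₀ : ℂ) + f₀.1) ≠ 0 := by
          rw [add_comm]
          exact_mod_cast hh
        refine ContinuousAt.comp (g := fun p : ℂ × ℂ => un2 p.1 p.2)
          (f := fun f : V3 => ((nu f + f.1 : ℂ), (starRingEnd ℂ) f.2))
          (un2_cont (Or.inl (by simpa using hne))) ?_
        have := Complex.continuous_conj
        fun_prop
      · have ho : IsOpen {f : V3 | f.1 + nu f ≠ 0} :=
          isOpen_compl_singleton.preimage (f := fun f : V3 => f.1 + nu f) (by fun_prop)
        filter_upwards [ho.mem_nhds (show f₀.1 + nu f₀ ≠ 0 from hh)] with f hf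
        have hne : ((nu f : ℂ) + f.1) ≠ 0 := by rw [add_comm]; exact_mod_cast hf
        have := hcs f
        push_cast at this
        refine tau_un2 (Or.inl hne) ?_ ?_
        · linear_combination this
        · ring

end
end GT

set_option linter.unusedSectionVars false
set_option linter.unusedVariables false
set_option linter.unnecessarySimpa false
namespace GT

/-! ### First computations -/

section
variable {G K W F : Type} [Group G] [Group K] [TopologicalSpace G]
  [NormedAddCommGroup W] [NormedSpace ℝ W] [FiniteDimensional ℝ W]
  [NormedAddCommGroup F] [NormedSpace ℝ F] [FiniteDimensional ℝ F]

lemma PairD.dl_bij {ρ : Representation ℝ G W} {σ : Representation ℝ G F} {ι : K →* G} {e : F}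
    {ν : F → ℝ} (D : PairD ρ σ ι e ν) (h : Acy (P ρ)) (n : ℕ) : Function.Bijective (D.dl n) := by
  constructor
  · refine (injective_iff_map_eq_zero _).2 fun x hx => ?_
    obtain ⟨v, rfl⟩ := D.ex_X n x hx
    rw [(h (n + 1)).elim v 0, map_zero]
  · intro y
    exact D.ex_A n y ((h n).elim _ _)

lemma subsing_of_bij {A B : Type} {f : A → B} (hf : Function.Bijective f) (h : Subsingleton B) :
    Subsingleton A := (Equiv.ofBijective f hf).subsingleton

lemma H_zero_P (ρ : Representation ℝ G W) (x : W) (hx : x ≠ 0) : Subsingleton (H 0 (P ρ)) :=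
  H_zero_subsingleton (qmk _ ⟨x, hx⟩)

end

/-- Two copies. -/
abbrev t2 : Representation ℝ U2 (V3 × V3) := tau.prod tau
/-- Three copies. -/
abbrev t3 : Representation ℝ U2 ((V3 × V3) × V3) := t2.prod tau
/-- Four copies. -/
abbrev t4 : Representation ℝ U2 (((V3 × V3) × V3) × V3) := t3.prod tau
/-- Restriction to the circle. -/
abbrev l1 : Representation ℝ Circle V3 := MonoidHom.comp tau io
/-- Restriction to the circle. -/
abbrev l2 : Representation ℝ Circle (V3 × V3) := MonoidHom.comp t2 io
/-- Restriction to the circle. -/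
abbrev l3 : Representation ℝ Circle ((V3 × V3) × V3) := MonoidHom.comp t3 io

lemma l2_apply (c : Circle) (w : V3 × V3) : l2 c w = ((w.1.1, c * w.1.2), (w.2.1, c * w.2.2)) := by
  change (tau (io c) w.1, tau (io c) w.2) = _
  rw [tau_io, tau_io]

lemma l3_apply (c : Circle) (w : (V3 × V3) × V3) : l3 c w = (l2 c w.1, (w.2.1, c * w.2.2)) := by
  change (l2 c w.1, tau (io c) w.2) = _
  rw [tau_io]

lemma prod_tau {W : Type} [NormedAddCommGroup W] [NormedSpace ℝ W] {ρ : Representation ℝ U2 W}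
    (h : ∀ g g', tau g = tau g' → ρ g = ρ g') : ∀ g g', tau g = tau g' → (ρ.prod tau) g = (ρ.prod tau) g' := by
  intro g g' hg
  refine LinearMap.ext fun w => ?_
  simp [h g g' hg, hg]

lemma D2 : PairD tau tau io ((1, 0) : V3) nu := pairU CA.tau fun _ _ h => h
lemma D3 : PairD t2 tau io ((1, 0) : V3) nu := pairU (CA.tau.prod CA.tau) (prod_tau fun _ _ h => h)
lemma D4 : PairD t3 tau io ((1, 0) : V3) nu :=
  pairU ((CA.tau.prod CA.tau).prod CA.tau) (prod_tau (prod_tau fun _ _ h => h))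

lemma acy_t1 : Acy (P tau) := by
  have hc := nu_cont
  refine acy_ret tau (1, 0) (fun f => nu f • (1, 0)) (by fun_prop) ?_ ?_ (by simp) ?_
  · intro x
    by_cases hx : x = 0
    · subst hx
      exact ⟨1, by simp [nu_zero]⟩
    · obtain ⟨g, hg⟩ := D2.ex_u x hx
      exact (orb _).symm ⟨g, hg⟩
  · rintro x _ ⟨g, rfl⟩
    exact ⟨1, by simp [nu_tau]⟩
  · intro x hx t ht h
    have h1 := congrArg Prod.fst h
    simp at h1
    have := nu_pos hx
    rcases ht.1.eq_or_lt with h | h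
    · subst h; simp at h1
    · nlinarith [ht.2, mul_pos h this]

lemma acy_l1 : Acy (P l1) := by
  refine acy_ret l1 (0, 1) (fun f => (f.1, (‖f.2‖ : ℂ))) (by fun_prop) ?_ ?_ (by simp) ?_
  · intro x
    by_cases hx : x.2 = 0
    · exact ⟨1, by rw [map_one]; ext <;> simp [hx]⟩
    · refine (orb _).symm ⟨ph x.2, ?_⟩
      change tau _ _ = _
      rw [tau_io, ph_mul hx]
  · rintro x _ ⟨g, rfl⟩
    refine ⟨1, ?_, by simp⟩
    have : l1 g x = (x.1, g * x.2) := tau_io g x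
    rw [this]
    simp [Circle.norm_coe]
  · intro x hx t ht h
    have h1 := congrArg Prod.fst h
    have h2 := congrArg (fun f : V3 => f.2.re) h
    simp at h1 h2
    have hn := norm_nonneg x.2
    have h3 : t * ‖x.2‖ = 0 := by nlinarith [ht.1, ht.2, mul_nonneg ht.1 hn]
    have h4 : t = 1 := by linarith
    subst h4
    simp at h1 h3
    exact hx (Prod.ext h1 h3)

lemma acy_t2 : Acy (P t2) := by
  intro n
  cases n with
  | zero => exact H_zero_P t2 ((1, 0), 0) (by simp)
  | succ n => exact subsing_of_bij (D2.dl_bij acy_t1 n) (acy_l1 n)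

lemma bij_t3 (n : ℕ) : Function.Bijective (D3.dl n) := D3.dl_bij acy_t2 n

/-- Rearranged version of `l2`, first part. -/
abbrev b2 : Representation ℝ Circle ((ℝ × ℝ) × ℂ) := (Representation.trivial ℝ Circle (ℝ × ℝ)).prod c1
/-- Rearranged version of `l2`. -/
abbrev c2 : Representation ℝ Circle (((ℝ × ℝ) × ℂ) × ℂ) := b2.prod c1

lemma DC2 : PairD b2 c1 (un Circle) 1 (fun z => ‖z‖) := pairC (CA.triv.prod CA.c1)

lemma acy_b2 : Acy (P b2) := by
  refine acy_ret b2 (0, 1) (fun f => (f.1, (‖f.2‖ : ℂ))) (by fun_prop) ?_ ?_ (by simp) ?_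
  · intro x
    by_cases hx : x.2 = 0
    · exact ⟨1, by rw [map_one]; ext <;> simp [hx]⟩
    · refine (orb _).symm ⟨ph x.2, ?_⟩
      change (x.1, (ph x.2 : ℂ) * x.2) = _
      rw [ph_mul hx]
  · rintro x _ ⟨g, rfl⟩
    refine ⟨1, ?_, by simp⟩
    simp [Circle.norm_coe]
  · intro x hx t ht h
    have h1 := congrArg Prod.fst h
    have h2 := congrArg (fun f : (ℝ × ℝ) × ℂ => f.2.re) h
    simp at h1 h2
    have hn := norm_nonneg x.2
    have h3 : t * ‖x.2‖ = 0 := by nlinarith [ht.1, ht.2, mul_nonneg ht.1 hn]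
    have h4 : t = 1 := by linarith
    subst h4
    simp at h1 h3
    exact hx (Prod.ext h1 h3)

/-- The rearrangement. -/
def e2 : (V3 × V3) ≃ₗ[ℝ] (((ℝ × ℝ) × ℂ) × ℂ) where
  toFun w := (((w.1.1, w.2.1), w.1.2), w.2.2)
  invFun w := ((w.1.1.1, w.1.2), (w.1.1.2, w.2))
  map_add' _ _ := rfl
  map_smul' _ _ := rfl
  left_inv _ := rfl
  right_inv _ := rfl

lemma e2_orb (x y : V3 × V3) : orb l2 x y ↔ orb c2 (e2 x) (e2 y) := by
  simp only [orb_iff]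
  refine exists_congr fun c => ?_
  rw [l2_apply]
  constructor
  · rintro rfl
    rfl
  · intro h
    exact e2.injective h

/-- Homology of `P l2`. -/
lemma H_c2 : (∀ n, n ≠ 5 → Subsingleton (H n (P c2))) ∧ Nonempty (H 5 (P c2) ≃ₗ[ℤ] ℤ) := by
  obtain ⟨h1, ⟨h2⟩⟩ := sphere 4 ((ℝ × ℝ) × ℂ) (MonoidHom.comp b2 (un Circle)) (by simp)
  refine ⟨?_, ⟨(LinearEquiv.ofBijective _ (DC2.dl_bij acy_b2 4)).trans h2⟩⟩
  intro n hn
  cases n with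
  | zero => exact H_zero_P c2 (((1, 0), 0), 0) (by simp)
  | succ n => exact subsing_of_bij (DC2.dl_bij acy_b2 n) (h1 n (by omega))

lemma H_l2 : (∀ n, n ≠ 5 → Subsingleton (H n (P l2))) ∧ Nonempty (H 5 (P l2) ≃ₗ[ℤ] ℤ) := by
  obtain ⟨f, _, hf⟩ := P_congr e2 e2_orb
  obtain ⟨h1, ⟨h2⟩⟩ := H_c2
  exact ⟨fun n hn => subsing_of_bij (hf n) (h1 n hn), ⟨(LinearEquiv.ofBijective _ (hf 5)).trans h2⟩⟩

/-- The suspension of `l2`. -/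
abbrev m2 : Representation ℝ Circle ((V3 × V3) × ℝ) := l2.prod (tr Circle)
/-- Rearranged version of `l3`. -/
abbrev m3 : Representation ℝ Circle (((V3 × V3) × ℝ) × ℂ) := m2.prod c1

lemma CA_l2 : CA l2 := (CA.tau.prod CA.tau).comp io continuous_io

lemma DM : PairD m2 c1 (un Circle) 1 (fun z => ‖z‖) := pairC (CA_l2.prod CA.triv)

lemma H_m2 (n : ℕ) (hn : n ≠ 6) : Subsingleton (H n (P m2)) := by
  cases n with
  | zero => exact H_zero_P m2 (0, 1) (by simp)
  | succ n => exact subsing_of_bij (sdl_bij l2 n) (H_l2.1 n (by omega))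

/-- The rearrangement. -/
def e3 : ((V3 × V3) × V3) ≃ₗ[ℝ] (((V3 × V3) × ℝ) × ℂ) := (LinearEquiv.prodAssoc ℝ (V3 × V3) ℝ ℂ).symm

lemma e3_orb (x y) : orb l3 x y ↔ orb m3 (e3 x) (e3 y) := by
  simp only [orb_iff]
  refine exists_congr fun c => ?_
  rw [l3_apply]
  constructor
  · rintro rfl
    rfl
  · intro h
    exact e3.injective h

lemma H_sph7 : (∀ n, n ≠ 7 → Subsingleton (H n (P (MonoidHom.comp m2 (un Circle))))) ∧
    Nonempty (H 7 (P (MonoidHom.comp m2 (un Circle))) ≃ₗ[ℤ] ℤ) :=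
  sphere 7 ((V3 × V3) × ℝ) (MonoidHom.comp m2 (un Circle)) (by simp)

lemma H_m3 : (∀ n, n ≠ 6 → n ≠ 8 → Subsingleton (H n (P m3))) ∧ Nonempty (H 8 (P m3) ≃ₗ[ℤ] ℤ) ∧
    Function.Surjective (hmap (pinc m2 c1) 6) := by
  obtain ⟨h1, ⟨h2⟩⟩ := H_sph7
  have inj : ∀ n, n + 1 ≠ 6 → Function.Injective (DM.dl n) := by
    intro n hn
    refine (injective_iff_map_eq_zero _).2 fun x hx => ?_
    obtain ⟨v, rfl⟩ := DM.ex_X n x hx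
    rw [(H_m2 (n + 1) hn).elim v 0, map_zero]
  refine ⟨?_, ⟨(LinearEquiv.ofBijective _ ⟨inj 7 (by norm_num), ?_⟩).trans h2⟩, ?_⟩
  · intro n h6 h8
    cases n with
    | zero => exact H_zero_P m3 (0, 1) (by simp)
    | succ n =>
      have := h1 n (by omega)
      exact (inj n h6).subsingleton
  · intro y
    exact DM.ex_A 7 y ((H_m2 7 (by norm_num)).elim _ _)
  · intro x
    exact DM.ex_X 5 x ((h1 5 (by norm_num)).elim _ _)

end GT

set_option linter.unusedSectionVars false
set_option linter.unusedVariables false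
set_option linter.unnecessarySimpa false
namespace GT

/-! ### The flip acts by minus one -/

section
variable {G K W F : Type} [Group G] [Group K] [TopologicalSpace G]
  [NormedAddCommGroup W] [NormedSpace ℝ W] [FiniteDimensional ℝ W]
  [NormedAddCommGroup F] [NormedSpace ℝ F] [FiniteDimensional ℝ F]

lemma PairD.dl_nat {ρ : Representation ℝ G W} {σ : Representation ℝ G F} {ι : K →* G} {e : F}
    {ν : F → ℝ} (D : PairD ρ σ ι e ν) (R : W →ₗ[ℝ] W) (S : F →ₗ[ℝ] F) (hR : Function.Injective R)
    (hS : Function.Injective S) (α : G → G) (hRα : ∀ g w, R (ρ g w) = ρ (α g) (R w))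
    (hSα : ∀ g w, S (σ g w) = σ (α g) (S w)) (hSe : S e = e) (hSν : ∀ f, ν (S f) = ν f)
    (q : QM (orb (MonoidHom.comp ρ ι)) (nz W) (orb (MonoidHom.comp ρ ι)) (nz W) R)
    (k : QM (orb (ρ.prod σ)) (nz (W × F)) (orb (ρ.prod σ)) (nz (W × F)) (fun p => (R p.1, S p.2)))
    (n : ℕ) (x) : D.dl n (hmap (qmap k) (n + 1) x) = hmap (qmap q) n (D.dl n x) := by
  have hRc := R.continuous_of_finiteDimensional
  have hSc := S.continuous_of_finiteDimensional
  have hRz : ∀ {x}, x ≠ 0 → R x ≠ 0 := fun hx h' => hx (hR (by rw [h', map_zero]))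
  have hSz : ∀ {x}, x ≠ 0 → S x ≠ 0 := fun hx h' => hx (hS (by rw [h', map_zero]))
  have rl : ∀ x y, orb (ρ.prod σ) x y → orb (ρ.prod σ) (R x.1, S x.2) (R y.1, S y.2) := by
    rintro x _ ⟨g, rfl⟩
    exact ⟨α g, by simp [hRα, hSα]⟩
  have ct : Continuous (fun p : W × F => (R p.1, S p.2)) := by fun_prop
  have m1 : QM (orb (ρ.prod σ)) (sU W F) (orb (ρ.prod σ)) (sU W F) (fun p => (R p.1, S p.2)) :=
    QM.mk' (fun x hx => hSz hx) rl ct.continuousOn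
  have m2 : QM (orb (ρ.prod σ)) (sV W F) (orb (ρ.prod σ)) (sV W F) (fun p => (R p.1, S p.2)) :=
    QM.mk' (fun x hx => hRz hx) rl ct.continuousOn
  have m3 : QM (orb (ρ.prod σ)) (sA W F) (orb (ρ.prod σ)) (sA W F) (fun p => (R p.1, S p.2)) :=
    QM.mk' (fun x hx => ⟨hRz hx.1, hSz hx.2⟩) rl ct.continuousOn
  have key := Sq.delta_nat (psq ρ σ) (psq ρ σ) (qmap m3) (qmap m1) (qmap m2) (qmap k)
    (qext fun x => rfl) (qext fun x => rfl) (qext fun x => rfl) (qext fun x => rfl) n x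
  rw [D.dl_apply, D.dl_apply, key, ← hmap_comp, ← hmap_comp]
  congr 2
  refine qext fun p => ?_
  have e1 := D.psi_mk ⟨(R p.1.1, S p.1.2), hRz p.2.1, hSz p.2.2⟩ (α (D.gf p.1.2))
    (by rw [← hSα, D.gf_spec p.2.2, map_smul, hSe, hSν])
  refine Eq.trans e1 ?_
  refine qmk_eq.2 ?_
  simp only [← hRα]
  exact (orb _).refl _
end

/-- Conjugation as a real linear map. -/
abbrev cj : ℂ →ₗ[ℝ] ℂ := Complex.conjAe.toLinearMap

lemma cj_inj : Function.Injective cj := Complex.conjAe.injective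

/-- The flip on the small sphere. -/
def R4 : ((ℝ × ℝ) × ℂ) →ₗ[ℝ] ((ℝ × ℝ) × ℂ) := LinearMap.prodMap (-LinearMap.id) cj

lemma R4_apply (w) : R4 w = (-w.1, (starRingEnd ℂ) w.2) := rfl

/-- Rearrangement. -/
def e4 : ((ℝ × ℝ) × ℂ) ≃ₗ[ℝ] (((ℝ × ℝ) × ℝ) × ℝ) where
  toFun w := ((w.1, w.2.re), w.2.im)
  invFun w := (w.1.1, ⟨w.1.2, w.2⟩)
  map_add' _ _ := rfl
  map_smul' _ _ := by simp
  left_inv _ := rfl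
  right_inv _ := rfl

/-- Rotation by pi. -/
def R3 : ((ℝ × ℝ) × ℝ) →ₗ[ℝ] ((ℝ × ℝ) × ℝ) := LinearMap.prodMap (-LinearMap.id) LinearMap.id

lemma R3_apply (w) : R3 w = (-w.1, w.2) := rfl

lemma orb_unit {W : Type} [NormedAddCommGroup W] [NormedSpace ℝ W] (ρ : Representation ℝ Unit W) (x y : W) :
    orb ρ x y ↔ x = y := by
  have : ∀ u : Unit, ρ u = 1 := fun u => map_one ρ
  constructor
  · rintro ⟨u, h⟩
    rw [this] at h
    exact h
  · rintro rfl
    exact ⟨(), by rw [this]; rfl⟩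

/-- Trivial representation of the trivial group. -/
abbrev s3 : Representation ℝ Unit ((ℝ × ℝ) × ℝ) := 1

lemma R3_id (q : QM (orb s3) (nz ((ℝ × ℝ) × ℝ)) (orb s3) (nz ((ℝ × ℝ) × ℝ)) R3) (n : ℕ) (x) :
    hmap (qmap q) n x = x := by
  have : (ContinuousMap.id _).Homotopic (qmap q) := by
    have h := qmap_homotopic (sat_nz s3) (fun (t : ℝ) (w : (ℝ × ℝ) × ℝ) =>
      (((Real.cos (Real.pi * t) * w.1.1 - Real.sin (Real.pi * t) * w.1.2,
        Real.sin (Real.pi * t) * w.1.1 + Real.cos (Real.pi * t) * w.1.2), w.2) : (ℝ × ℝ) × ℝ))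
      (QM.id' (subset_refl _)) q ?_ ?_ ?_ ?_ ?_
    · convert h using 1
      exact qext fun x => rfl
    · intro x hx
      rw [orb_unit]
      simp
    · intro x hx
      rw [orb_unit]
      simp [R3_apply]
      rfl
    · intro t ht x hx h
      apply hx
      simp only [Prod.ext_iff, Prod.fst_zero, Prod.snd_zero] at h
      obtain ⟨⟨h1, h2⟩, h3⟩ := h
      have hcs := Real.sin_sq_add_cos_sq (Real.pi * t)
      refine Prod.ext (Prod.ext ?_ ?_) h3
      · change x.1.1 = 0
        linear_combination -x.1.1 * hcs + Real.cos (Real.pi * t) * h1 + Real.sin (Real.pi * t) * h2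
      · change x.1.2 = 0
        linear_combination -x.1.2 * hcs - Real.sin (Real.pi * t) * h1 + Real.cos (Real.pi * t) * h2
    · intro t ht x hx y hy h
      rw [orb_unit] at h ⊢
      rw [h]
    · fun_prop
  rw [← hmap_homotopic this, hmap_id]

lemma R4_neg (q : QM (orb (MonoidHom.comp b2 (un Circle))) (nz ((ℝ × ℝ) × ℂ))
    (orb (MonoidHom.comp b2 (un Circle))) (nz ((ℝ × ℝ) × ℂ)) R4) (n : ℕ) (x) :
    hmap (qmap q) (n + 1) x = -x := by
  obtain ⟨f, hf, hb⟩ := P_congr (ρ := MonoidHom.comp b2 (un Circle)) (ρ' := s3.prod (tr Unit)) e4 (by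
    intro x y
    rw [orb_unit, orb_unit]
    simp)
  have i3 : Function.Injective R3 := by
    intro x y h
    simpa [R3_apply, Prod.ext_iff] using h
  have hz : ∀ x, x ≠ 0 → R3 x ≠ 0 := fun x hx h' => hx (i3 (by rw [h', map_zero]))
  have c3 := R3.continuous_of_finiteDimensional
  have q3 : QM (orb s3) (nz ((ℝ × ℝ) × ℝ)) (orb s3) (nz ((ℝ × ℝ) × ℝ)) R3 :=
    QM.mk' hz (fun x y h => by rw [orb_unit] at *; rw [h]) c3.continuousOn
  have k3 : QM (orb (s3.prod (tr Unit))) (nz (((ℝ × ℝ) × ℝ) × ℝ)) (orb (s3.prod (tr Unit)))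
      (nz (((ℝ × ℝ) × ℝ) × ℝ)) (fun p => (R3 p.1, -p.2)) :=
    QM.mk' (fun x hx h => hx (by
      simp only [Prod.ext_iff (y := (0 : ((ℝ × ℝ) × ℝ) × ℝ)), Prod.fst_zero, Prod.snd_zero, neg_eq_zero] at h
      exact Prod.ext (i3 (by rw [h.1]; simp)) h.2)) (fun x y h => by rw [orb_unit] at *; rw [h]) (by fun_prop)
  have key := swap_neg s3 R3 i3 (fun x y h => by rw [orb_unit] at *; rw [h]) q3 k3 n (R3_id q3 n)
  apply (hb (n + 1)).1
  have : f.comp (qmap q) = (qmap k3).comp f := qext fun x => by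
    simp only [ContinuousMap.comp_apply, qmap_mk, hf]
    rfl
  rw [← hmap_comp, this, hmap_comp, key, map_neg]

/-- The flip. -/
abbrev Rho : (V3 × V3) →ₗ[ℝ] (V3 × V3) := t2 J

lemma Rho_apply (w) : Rho w = ((-w.1.1, (starRingEnd ℂ) w.1.2), (-w.2.1, (starRingEnd ℂ) w.2.2)) := by
  change (tau J w.1, tau J w.2) = _
  rw [tau_J, tau_J]

lemma conj_inv (c : Circle) : (starRingEnd ℂ) (c : ℂ) = (c : ℂ)⁻¹ := by
  rw [← Circle.coe_inv_eq_conj, Circle.coe_inv]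

lemma Rho_l2 (c : Circle) (w) : Rho (l2 c w) = l2 c⁻¹ (Rho w) := by
  rw [Rho_apply, Rho_apply, l2_apply, l2_apply]
  simp [conj_inv]

lemma qm_Rho : QM (orb l2) (nz (V3 × V3)) (orb l2) (nz (V3 × V3)) Rho :=
  QM.mk' (fun x hx h => hx (rep_eq_zero t2 J h)) (by
    rintro x _ ⟨g, rfl⟩
    exact ⟨g⁻¹, (Rho_l2 g x).symm⟩) Rho.continuous_of_finiteDimensional.continuousOn

lemma Rho_neg (n : ℕ) (x) : hmap (qmap qm_Rho) (n + 2) x = -x := by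
  obtain ⟨f, hf, hb⟩ := P_congr e2 e2_orb
  have i4 : Function.Injective R4 := by
    intro x y h
    rw [R4_apply, R4_apply] at h
    exact Prod.ext (neg_injective (congrArg Prod.fst h)) (cj_inj (congrArg Prod.snd h))
  have c4 := R4.continuous_of_finiteDimensional
  have hz : ∀ x, x ≠ 0 → R4 x ≠ 0 := fun x hx h' => hx (i4 (by rw [h', map_zero]))
  have q4 : QM (orb (MonoidHom.comp b2 (un Circle))) (nz ((ℝ × ℝ) × ℂ))
    (orb (MonoidHom.comp b2 (un Circle))) (nz ((ℝ × ℝ) × ℂ)) R4 :=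
    QM.mk' hz (fun x y h => by rw [orb_unit] at *; rw [h]) c4.continuousOn
  have hR : ∀ (g : Circle) w, R4 (b2 g w) = b2 g⁻¹ (R4 w) := by
    intro g w
    simp [R4_apply, conj_inv]
  have hS : ∀ (g : Circle) w, cj (c1 g w) = c1 g⁻¹ (cj w) := by
    intro g w
    simp [conj_inv]
  have k : QM (orb c2) (nz (((ℝ × ℝ) × ℂ) × ℂ)) (orb c2) (nz (((ℝ × ℝ) × ℂ) × ℂ))
      (fun p => (R4 p.1, cj p.2)) := QM.mk' (fun x hx h => hx (by
      simp only [Prod.ext_iff (y := (0 : ((ℝ × ℝ) × ℂ) × ℂ)), Prod.fst_zero, Prod.snd_zero] at h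
      exact Prod.ext (i4 (by rw [h.1]; simp)) (cj_inj (by rw [h.2]; simp)))) (by
      rintro x _ ⟨g, rfl⟩
      refine ⟨g⁻¹, ?_⟩
      exact Prod.ext (hR g x.1).symm (hS g x.2).symm) (by
      have : Continuous cj := cj.continuous_of_finiteDimensional
      fun_prop)
  have key := DC2.dl_nat R4 cj i4 cj_inj (fun g => g⁻¹) hR hS (by simp) (by simp) q4 k
  have key2 : ∀ x, hmap (qmap k) (n + 1 + 1) x = -x := by
    intro x
    apply (DC2.dl_bij acy_b2 (n + 1)).1
    rw [key, R4_neg, map_neg]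
  apply (hb (n + 2)).1
  have : f.comp (qmap qm_Rho) = (qmap k).comp f := qext fun x => by
    simp only [ContinuousMap.comp_apply, qmap_mk, hf]
    refine qmk_eq.2 ?_
    simp only [Rho_apply]
    exact (orb _).refl _
  rw [← hmap_comp, this, hmap_comp, key2, map_neg]

end GT

set_option linter.unusedSectionVars false
set_option linter.unusedVariables false
set_option linter.unnecessarySimpa false
namespace GT

/-! ### The degree two computation -/

/-- Half lines. -/
def hh (ε : ℝ) : Set ((V3 × V3) × ℝ) := {p | 0 < ε * p.2}
/-- Punctured half lines. -/
def ha (ε : ℝ) : Set ((V3 × V3) × ℝ) := {p | p.1 ≠ 0 ∧ 0 < ε * p.2}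

lemma m2_snd (g : Circle) (p : (V3 × V3) × ℝ) : (m2 g p).2 = p.2 := rfl

lemma m2_fst (g : Circle) (p : (V3 × V3) × ℝ) : (m2 g p).1 = l2 g p.1 := rfl

lemma sat_hh (ε : ℝ) : Sat (orb m2) (hh ε) := by
  rintro x _ ⟨g, rfl⟩ h
  exact h

lemma sat_ha (ε : ℝ) : Sat (orb m2) (ha ε) := by
  rintro x _ ⟨g, rfl⟩ h
  exact ⟨fun h' => h.1 (rep_eq_zero l2 g h'), h.2⟩

lemma open_hh (ε : ℝ) : IsOpen (hh ε) := isOpen_lt (by fun_prop) (by fun_prop)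

lemma open_ha (ε : ℝ) : IsOpen (ha ε) :=
  (isOpen_compl_singleton.preimage continuous_fst).inter (open_hh ε)

lemma hhU (ε : ℝ) : hh ε ⊆ sU (V3 × V3) ℝ := by
  intro p (h : 0 < ε * p.2) (h' : p.2 = 0)
  simp [h'] at h

lemma haA (ε : ℝ) : ha ε ⊆ sA (V3 × V3) ℝ := fun p h => ⟨h.1, hhU ε h.2⟩

lemma sign_or {r : ℝ} (h : r ≠ 0) : 0 < 1 * r ∨ 0 < (-1) * r := by
  rcases h.lt_or_gt with h | h
  · exact Or.inr (by linarith)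
  · exact Or.inl (by linarith)

lemma hsq : Sq (qinc (orb m2) (Set.empty_subset (hh 1))) (qinc (orb m2) (Set.empty_subset (hh (-1))))
    (qinc (orb m2) (hhU 1)) (qinc (orb m2) (hhU (-1))) :=
  qsq _ _ _ _ (open_hh 1) (open_hh (-1)) (sat_hh 1) (sat_hh (-1)) (fun x hx => sign_or hx)
    (fun x (h1 : 0 < 1 * x.2) (h2 : 0 < (-1) * x.2) => by linarith)

lemma asq : Sq (qinc (orb m2) (Set.empty_subset (ha 1))) (qinc (orb m2) (Set.empty_subset (ha (-1))))
    (qinc (orb m2) (haA 1)) (qinc (orb m2) (haA (-1))) :=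
  qsq _ _ _ _ (open_ha 1) (open_ha (-1)) (sat_ha 1) (sat_ha (-1))
    (fun x hx => (sign_or hx.2).imp (fun h => ⟨hx.1, h⟩) (fun h => ⟨hx.1, h⟩))
    (fun x h1 h2 => by have a1 := h1.2; have a2 := h2.2; linarith)

instance : IsEmpty (Q (orb m2) ∅) := ⟨fun x => by
  obtain ⟨y, -⟩ := qmk_surj x
  exact y.2⟩

lemma acy_hh (ε : ℝ) (hε : ε * ε = 1) : Acy (Q (orb m2) (hh ε)) := by
  refine acy_q (sat_hh ε) (0, ε) (by simp [hh, hε]) (fun t p => (t • p.1, t * p.2 + (1 - t) * ε)) ?_ ?_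
    ?_ ?_ ?_
  · intro x hx
    simpa using (orb _).refl _
  · intro x hx
    simpa using (orb _).refl _
  · intro t ht x (hx : 0 < ε * x.2)
    change 0 < ε * (t * x.2 + (1 - t) * ε)
    have : ε * (t * x.2 + (1 - t) * ε) = t * (ε * x.2) + (1 - t) := by linear_combination (1 - t) * hε
    rw [this]
    rcases ht.1.eq_or_lt with h | h
    · subst h; simp
    · nlinarith [ht.2, mul_pos h hx]
  · rintro t ht x hx _ hy ⟨g, rfl⟩
    exact ⟨g, by simp⟩
  · fun_prop

lemma H_sUm (n : ℕ) : Subsingleton (H (n + 2) (Q (orb m2) (sU (V3 × V3) ℝ))) := by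
  refine subsingleton_of_forall_eq 0 fun x => ?_
  obtain ⟨u, v, rfl⟩ := hsq.exact_X (n + 1) x (((H_empty _).1 (n + 1) (by omega)).elim _ _)
  rw [(acy_hh 1 (by norm_num) _).elim u 0, (acy_hh (-1) (by norm_num) _).elim v 0]
  simp

lemma qm_ha (ε : ℝ) : QM (orb m2) (ha ε) (orb l2) (nz (V3 × V3)) Prod.fst :=
  QM.mk' (fun x hx => hx.1) (by rintro x _ ⟨g, rfl⟩; exact ⟨g, rfl⟩) continuous_fst.continuousOn

lemma bij_ha (ε : ℝ) (hε : ε * ε = 1) (n : ℕ) : Function.Bijective (hmap (qmap (qm_ha ε)) n) := by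
  have q1 : QM (orb l2) (nz (V3 × V3)) (orb m2) (ha ε) (fun w => (w, ε)) :=
    QM.mk' (fun x hx => ⟨hx, by simp [hε]⟩) (by rintro x _ ⟨g, rfl⟩; exact ⟨g, rfl⟩) (by fun_prop)
  refine hmap_bij _ (qmap q1) ?_ ?_ n
  · have h0 : QM (orb m2) (ha ε) (orb m2) (ha ε) (fun p => (p.1, ε)) :=
      QM.mk' (fun x hx => ⟨hx.1, by simp [hε]⟩) (by rintro x _ ⟨g, rfl⟩; exact ⟨g, rfl⟩) (by fun_prop)
    have := qmap_homotopic (sat_ha ε) (fun t p => (p.1, t * p.2 + (1 - t) * ε)) h0 (QM.id' (subset_refl _))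
      (fun x hx => by simpa using (orb _).refl _) (fun x hx => by simpa using (orb _).refl _)
      (fun t ht x hx => ⟨hx.1, by
        have hx := hx.2
        change 0 < ε * (t * x.2 + (1 - t) * ε)
        have : ε * (t * x.2 + (1 - t) * ε) = t * (ε * x.2) + (1 - t) := by
          linear_combination (1 - t) * hε
        rw [this]
        rcases ht.1.eq_or_lt with h | h
        · subst h; simp
        · nlinarith [ht.2, mul_pos h hx]⟩)
      (by rintro t ht x hx _ hy ⟨g, rfl⟩; exact ⟨g, by simp⟩) (by fun_prop)
    convert this using 1
    all_goals exact qext fun x => rfl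
  · rw [show (qmap (qm_ha ε)).comp (qmap q1) = ContinuousMap.id _ from qext fun x => rfl]

/-- The linear map inducing the attaching map. -/
def gl (p : (V3 × V3) × ℝ) : (V3 × V3) × V3 := (p.1, (p.2, 0))

lemma gl_rel (x y) (h : orb m2 x y) : orb t3 (gl x) (gl y) := by
  obtain ⟨g, rfl⟩ := h
  refine ⟨io g, ?_⟩
  change l3 g (gl x) = _
  rw [l3_apply]
  simp [gl]

lemma gl_cont : Continuous gl := by unfold gl; fun_prop

lemma qm_gl : QM (orb m2) (nz _) (orb t3) (nz _) gl :=
  QM.mk' (fun x hx h => hx (by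
    have h1 := congrArg Prod.fst h
    have h2 := congrArg (fun p : (V3 × V3) × V3 => p.2.1) h
    exact Prod.ext h1 h2)) gl_rel gl_cont.continuousOn

lemma gl_ne {r : ℝ} (h : r ≠ 0) : ((r, 0) : V3) ≠ 0 := fun h' => h (congrArg Prod.fst h')

lemma qm_glU : QM (orb m2) (sU _ _) (orb t3) (sU _ _) gl :=
  QM.mk' (fun x hx => gl_ne hx) gl_rel gl_cont.continuousOn
lemma qm_glV : QM (orb m2) (sV _ _) (orb t3) (sV _ _) gl :=
  QM.mk' (fun x hx => hx) gl_rel gl_cont.continuousOn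
lemma qm_glA : QM (orb m2) (sA _ _) (orb t3) (sA _ _) gl :=
  QM.mk' (fun x hx => ⟨hx.1, gl_ne hx.2⟩) gl_rel gl_cont.continuousOn

lemma nu_real (r : ℝ) : nu ((r, 0) : V3) = |r| := by simp [nu, Real.sqrt_sq_eq_abs]

lemma psi_glP : (D3.psi.comp (qmap qm_glA)).comp (qinc (orb m2) (haA 1)) = qmap (qm_ha 1) := qext fun x => by
  have hx : 0 < 1 * x.1.2 := x.2.2
  refine (D3.psi_mk ⟨gl x, x.2.1, gl_ne (hhU 1 x.2.2)⟩ 1 ?_).trans ?_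
  · simp only [gl, nu_real, map_one]
    rw [abs_of_pos (by linarith)]
    simp
  · refine qmk_eq.2 ?_
    simp only [map_one]
    exact (orb _).refl _

lemma psi_glN : (D3.psi.comp (qmap qm_glA)).comp (qinc (orb m2) (haA (-1))) =
    (qmap qm_Rho).comp (qmap (qm_ha (-1))) := qext fun x => by
  have hx : 0 < (-1) * x.1.2 := x.2.2
  refine (D3.psi_mk ⟨gl x, x.2.1, gl_ne (hhU (-1) x.2.2)⟩ J ?_).trans ?_
  · simp only [gl, nu_real, tau_J]
    rw [abs_of_neg (by linarith)]
    simp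
  · refine qmk_eq.2 ?_
    exact (orb _).refl _

/-- The attaching map composed with the boundary isomorphism. -/
def TT : H 6 (P m2) →ₗ[ℤ] H 5 (P l2) := (D3.dl 5).comp (hmap (qmap qm_gl) 6)

lemma TT_eq (x : H 6 (P m2)) (a b) (h : (psq l2 (tr Circle)).delta 5 x =
    hmap (qinc (orb m2) (haA 1)) 5 a + hmap (qinc (orb m2) (haA (-1))) 5 b) :
    TT x = hmap (qmap (qm_ha 1)) 5 a - hmap (qmap (qm_ha (-1))) 5 b := by
  have key := Sq.delta_nat (psq l2 (tr Circle)) (psq t2 tau) (qmap qm_glA) (qmap qm_glU) (qmap qm_glV)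
    (qmap qm_gl) (qext fun x => rfl) (qext fun x => rfl) (qext fun x => rfl) (qext fun x => rfl) 5 x
  change D3.dl 5 (hmap (qmap qm_gl) 6 x) = _
  rw [D3.dl_apply, key, ← hmap_comp, h, map_add, ← hmap_comp, ← hmap_comp, psi_glP, psi_glN, hmap_comp,
    Rho_neg 3, sub_eq_add_neg]

lemma prV_ha (ε : ℝ) (n : ℕ) (a) : hmap (qmap (qm_prV l2 (tr Circle))) n
    (hmap (qinc (orb m2) sAV) n (hmap (qinc (orb m2) (haA ε)) n a)) = hmap (qmap (qm_ha ε)) n a := by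
  rw [← hmap_comp, ← hmap_comp]
  congr 2
  exact qext fun x => rfl

lemma TT_spec (x : H 6 (P m2)) : ∃ a b, (psq l2 (tr Circle)).delta 5 x =
    hmap (qinc (orb m2) (haA 1)) 5 a + hmap (qinc (orb m2) (haA (-1))) 5 b ∧
    hmap (qmap (qm_ha (-1))) 5 b = - hmap (qmap (qm_ha 1)) 5 a := by
  obtain ⟨a, b, h⟩ := asq.exact_X 4 ((psq l2 (tr Circle)).delta 5 x) (((H_empty _).1 4 (by omega)).elim _ _)
  refine ⟨a, b, h, ?_⟩
  have h1 := (psq l2 (tr Circle)).kV_delta 5 x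
  have h2 := congrArg (hmap (qmap (qm_prV l2 (tr Circle))) 5) h1
  rw [h, map_add, map_add, prV_ha, prV_ha, map_zero] at h2
  exact (neg_eq_of_add_eq_zero_right h2).symm

lemma TT_two (x : H 6 (P m2)) : ∃ c, TT x = (2 : ℤ) • c := by
  obtain ⟨a, b, h1, h2⟩ := TT_spec x
  refine ⟨hmap (qmap (qm_ha 1)) 5 a, ?_⟩
  rw [TT_eq x a b h1, h2, sub_neg_eq_add, two_smul]

lemma TT_surj (c : H 5 (P l2)) : ∃ x, TT x = (2 : ℤ) • c := by
  obtain ⟨a, ha'⟩ := (bij_ha 1 (by norm_num) 5).2 c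
  obtain ⟨b, hb⟩ := (bij_ha (-1) (by norm_num) 5).2 (-c)
  obtain ⟨x, hx⟩ := (psq l2 (tr Circle)).exact_A 5
    (hmap (qinc (orb m2) (haA 1)) 5 a + hmap (qinc (orb m2) (haA (-1))) 5 b)
    ((H_sUm 3).elim _ _) (by
      apply (bij_prV l2 (tr Circle) 5).1
      rw [map_add, map_add, prV_ha, prV_ha, map_zero, ha', hb, add_neg_cancel])
  exact ⟨x, by rw [TT_eq x a b hx, ha', hb, sub_neg_eq_add, two_smul]⟩

lemma l2_tf (c : H 5 (P l2)) (h : (2 : ℤ) • c = 0) : c = 0 := by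
  obtain ⟨e⟩ := H_l2.2
  apply e.injective
  have := congrArg e h
  rw [map_smul, map_zero] at this
  rw [map_zero]
  simpa using this

lemma TT_inj (x : H 6 (P m2)) (h : TT x = 0) : x = 0 := by
  obtain ⟨a, b, h1, h2⟩ := TT_spec x
  rw [TT_eq x a b h1, h2, sub_neg_eq_add, ← two_smul ℤ] at h
  have h3 := l2_tf _ h
  have ha0 : a = 0 := (bij_ha 1 (by norm_num) 5).1 (by rw [h3, map_zero])
  have hb0 : b = 0 := (bij_ha (-1) (by norm_num) 5).1 (by rw [h2, h3, map_zero, neg_zero])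
  rw [ha0, hb0, map_zero, map_zero, add_zero] at h1
  obtain ⟨u, v, rfl⟩ := (psq l2 (tr Circle)).exact_X 5 x h1
  have hv := subsing_of_bij (bij_prV l2 (tr Circle) 6) (H_l2.1 6 (by norm_num))
  rw [(H_sUm 4).elim u 0, hv.elim v 0, map_zero, map_zero, add_zero]

/-! ### Homology of `P t4` -/

lemma H_l3 : (∀ n, n ≠ 6 → n ≠ 8 → Subsingleton (H n (P l3))) ∧ Nonempty (H 8 (P l3) ≃ₗ[ℤ] ℤ) := by
  obtain ⟨f, _, hf⟩ := P_congr e3 e3_orb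
  obtain ⟨h1, ⟨h2⟩, _⟩ := H_m3
  exact ⟨fun n h6 h8 => subsing_of_bij (hf n) (h1 n h6 h8),
    ⟨(LinearEquiv.ofBijective _ (hf 8)).trans h2⟩⟩

lemma l3_fac (y : H 6 (P l3)) : ∃ x : H 6 (P m2), hmap (pproj t3 io) 6 y = hmap (qmap qm_gl) 6 x ∧
    (x = 0 → y = 0) := by
  obtain ⟨f, hf, hb⟩ := P_congr e3 e3_orb
  obtain ⟨x, hx⟩ := H_m3.2.2 (hmap f 6 y)
  refine ⟨x, ?_, fun h => (hb 6).1 (by rw [← hx, h, map_zero, map_zero])⟩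
  have q : QM (orb m2) (nz _) (orb l3) (nz _) gl :=
    QM.mk' qm_gl.maps (by
      rintro x _ ⟨g, rfl⟩
      refine ⟨g, ?_⟩
      rw [l3_apply]
      simp [gl]) gl_cont.continuousOn
  have hy : y = hmap (qmap q) 6 x := by
    apply (hb 6).1
    rw [← hx, ← hmap_comp]
    congr 2
    refine qext fun x => ?_
    rw [ContinuousMap.comp_apply, qmap_mk, hf]
    rfl
  rw [hy, ← hmap_comp]
  congr 2
  exact qext fun x => rfl

lemma l3_fac' (x : H 6 (P m2)) : ∃ y : H 6 (P l3), hmap (pproj t3 io) 6 y = hmap (qmap qm_gl) 6 x := by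
  have q : QM (orb m2) (nz _) (orb l3) (nz _) gl :=
    QM.mk' qm_gl.maps (by
      rintro x _ ⟨g, rfl⟩
      refine ⟨g, ?_⟩
      rw [l3_apply]
      simp [gl]) gl_cont.continuousOn
  refine ⟨hmap (qmap q) 6 x, ?_⟩
  rw [← hmap_comp]
  congr 2
  exact qext fun x => rfl

lemma H_t3 (n : ℕ) (hn : n ≠ 6) : Subsingleton (H n (P t3)) := by
  cases n with
  | zero => exact H_zero_P t3 (0, (1, 0)) (by simp)
  | succ n => exact subsing_of_bij (bij_t3 n) (H_l2.1 n (by omega))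

lemma f6_inj (y : H 6 (P l3)) (h : hmap (pproj t3 io) 6 y = 0) : y = 0 := by
  obtain ⟨x, h1, h2⟩ := l3_fac y
  refine h2 (TT_inj x ?_)
  change D3.dl 5 (hmap (qmap qm_gl) 6 x) = 0
  rw [← h1, h, map_zero]

/-- Coordinate on the cokernel. -/
lemma H6_t4 : Nonempty (H 6 (P t4) ≃ₗ[ℤ] ZMod 2) := by
  obtain ⟨e⟩ := H_l2.2
  let E : H 6 (P t3) ≃ₗ[ℤ] ℤ := (LinearEquiv.ofBijective (D3.dl 5) (bij_t3 5)).trans e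
  have hE : ∀ x, E x = e (D3.dl 5 x) := fun _ => rfl
  let p := hmap (pinc t3 tau) 6
  have hp : Function.Surjective p := by
    intro x
    exact D4.ex_X 5 x ((H_l3.1 5 (by norm_num) (by norm_num)).elim _ _)
  let c : ℤ →ₗ[ℤ] ZMod 2 := (Int.castAddHom (ZMod 2)).toIntLinearMap
  let q : H 6 (P t3) →ₗ[ℤ] ZMod 2 := c.comp E.toLinearMap
  have hq : Function.Surjective q := by
    intro z
    refine ⟨E.symm (z.val : ℤ), ?_⟩
    change ((E (E.symm (z.val : ℤ)) : ℤ) : ZMod 2) = z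
    rw [LinearEquiv.apply_symm_apply]
    simp
  have hk : LinearMap.ker p = LinearMap.ker q := by
    ext v
    rw [LinearMap.mem_ker, LinearMap.mem_ker]
    have h1 : q v = 0 ↔ (2 : ℤ) ∣ E v := by
      change ((E v : ℤ) : ZMod 2) = 0 ↔ _
      exact ZMod.intCast_zmod_eq_zero_iff_dvd _ _
    rw [h1]
    constructor
    · intro hv
      obtain ⟨y, rfl⟩ := D4.ex_V 6 v hv
      obtain ⟨x, hx, -⟩ := l3_fac y
      obtain ⟨d, hd⟩ := TT_two x
      rw [hE, hx]
      change 2 ∣ e (TT x)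
      rw [hd, map_smul]
      exact ⟨e d, rfl⟩
    · rintro ⟨d, hd⟩
      obtain ⟨x, hx⟩ := TT_surj (e.symm d)
      obtain ⟨y, hy⟩ := l3_fac' x
      have : v = hmap (pproj t3 io) 6 y := by
        apply E.injective
        rw [hd, hE, hy]
        change _ = e (TT x)
        rw [hx, map_smul, LinearEquiv.apply_symm_apply]
        rfl
      rw [this]
      exact D4.inc_proj 6 y
  exact ⟨(p.quotKerEquivOfSurjective hp).symm.trans ((Submodule.quotEquivOfEq _ _ hk).trans
    (q.quotKerEquivOfSurjective hq))⟩

lemma H9_t4 : Nonempty (H 9 (P t4) ≃ₗ[ℤ] ℤ) := by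
  obtain ⟨e⟩ := H_l3.2
  refine ⟨(LinearEquiv.ofBijective (D4.dl 8) ⟨?_, ?_⟩).trans e⟩
  · refine (injective_iff_map_eq_zero _).2 fun x hx => ?_
    obtain ⟨v, rfl⟩ := D4.ex_X 8 x hx
    rw [(H_t3 9 (by norm_num)).elim v 0, map_zero]
  · intro y
    exact D4.ex_A 8 y ((H_t3 8 (by norm_num)).elim _ _)

lemma Hn_t4 (n : ℕ) (h6 : n ≠ 6) (h9 : n ≠ 9) : Subsingleton (H n (P t4)) := by
  cases n with
  | zero => exact H_zero_P t4 (0, (1, 0)) (by simp)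
  | succ n =>
    refine subsingleton_of_forall_eq 0 fun x => ?_
    have hd : D4.dl n x = 0 := by
      by_cases hn : n = 6
      · subst hn
        exact f6_inj _ (D4.proj_dl 6 x)
      · exact (H_l3.1 n hn (by omega)).elim _ _
    obtain ⟨v, rfl⟩ := D4.ex_X n x hd
    rw [(H_t3 (n + 1) h6).elim v 0, map_zero]

end GT

set_option linter.unusedSectionVars false
set_option linter.unusedVariables false
set_option linter.unnecessarySimpa false
namespace GT

/-! ### The Hopf map -/

/-- The Hopf map. -/
def hv (x y : ℂ) : V3 := (‖x‖ ^ 2 - ‖y‖ ^ 2, 2 * x * (starRingEnd ℂ) y)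

lemma nu_hv (x y : ℂ) : nu (hv x y) = ‖x‖ ^ 2 + ‖y‖ ^ 2 := by
  rw [nu, Real.sqrt_eq_iff_eq_sq (by positivity) (by positivity)]
  simp only [hv, norm_mul, Complex.norm_conj, Complex.norm_ofNat]
  ring

lemma hv_smul (s : ℝ) (x y : ℂ) : hv (s * x) (s * y) = s ^ 2 • hv x y := by
  refine Prod.ext ?_ ?_
  · simp [hv, mul_pow]
    ring
  · simp [hv]
    ring

lemma hv_phase {t : ℂ} (ht : ‖t‖ = 1) (x y : ℂ) : hv (t * x) (t * y) = hv x y := by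
  have h : t * (starRingEnd ℂ) t = 1 := by
    rw [Complex.mul_conj, Complex.normSq_eq_norm_sq, ht]; simp
  refine Prod.ext ?_ ?_
  · simp [hv, ht]
  · simp only [hv, map_mul]
    linear_combination 2 * x * (starRingEnd ℂ) y * h

lemma nsq (x : ℂ) : ((‖x‖ ^ 2 : ℝ) : ℂ) = x * (starRingEnd ℂ) x := by
  rw [Complex.mul_conj, Complex.normSq_eq_norm_sq]

/-- The rank one matrix. -/
def ppm (x y : ℂ) : Matrix (Fin 2) (Fin 2) ℂ :=
  !![x * (starRingEnd ℂ) x, x * (starRingEnd ℂ) y; y * (starRingEnd ℂ) x, y * (starRingEnd ℂ) y]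

lemma herm_hv (x y : ℂ) : herm (hv x y) = (2 : ℂ) • ppm x y - (ppm x y).trace • 1 := by
  have h1 := nsq x
  have h2 := nsq y
  push_cast at h1 h2
  have h3 : (starRingEnd ℂ) 2 = 2 := Complex.conj_ofNat 2
  ext i j
  fin_cases i <;> fin_cases j <;> simp [herm_apply, hv, ppm, Matrix.trace_fin_two, h3, h1, h2] <;> ring

lemma ppm_mul (g : Matrix (Fin 2) (Fin 2) ℂ) (x y : ℂ) :
    ppm (g 0 0 * x + g 0 1 * y) (g 1 0 * x + g 1 1 * y) = g * ppm x y * star g := by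
  ext i j
  fin_cases i <;> fin_cases j <;> simp [ppm, Matrix.mul_apply, Matrix.star_apply] <;> ring

lemma hv_tau (g : U2) (x y : ℂ) : hv (g.1 0 0 * x + g.1 0 1 * y) (g.1 1 0 * x + g.1 1 1 * y) =
    tau g (hv x y) := by
  apply herm_inj
  have hg : star (g : Matrix (Fin 2) (Fin 2) ℂ) * (g : Matrix (Fin 2) (Fin 2) ℂ) = 1 :=
      Matrix.UnitaryGroup.star_mul_self g
  have hg' : (g : Matrix (Fin 2) (Fin 2) ℂ) * star (g : Matrix (Fin 2) (Fin 2) ℂ) = 1 :=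
      mul_eq_one_comm.1 hg
  rw [herm_tau, herm_hv, herm_hv, ppm_mul, Matrix.trace_mul_comm, ← mul_assoc, hg, one_mul]
  simp only [mul_sub, sub_mul, Matrix.mul_smul, Matrix.smul_mul, mul_one, hg']

lemma hv_surj (v : V3) : ∃ x y, hv x y = v := by
  by_cases h : v = 0
  · exact ⟨0, 0, by rw [h]; simp [hv]⟩
  · obtain ⟨g, hg⟩ := D2.ex_u v h
    have h2 : v = tau g⁻¹ (nu v • ((1, 0) : V3)) := by rw [← hg, rep_inv_apply]
    have h3 : hv (Real.sqrt (nu v)) 0 = nu v • ((1, 0) : V3) := by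
      simp [hv, Real.sq_sqrt (nu_nonneg v)]
    refine ⟨_, _, (hv_tau g⁻¹ (Real.sqrt (nu v)) 0).trans ?_⟩
    rw [h3, ← h2]

lemma hv_eq {x y x' y' : ℂ} (h : hv x' y' = hv x y) : ∃ t : ℂ, ‖t‖ = 1 ∧ x' = t * x ∧ y' = t * y := by
  have h1 := congrArg nu h
  rw [nu_hv, nu_hv] at h1
  have h2 : ‖x'‖ ^ 2 - ‖y'‖ ^ 2 = ‖x‖ ^ 2 - ‖y‖ ^ 2 := congrArg Prod.fst h
  have h3 : 2 * x' * (starRingEnd ℂ) y' = 2 * x * (starRingEnd ℂ) y := congrArg Prod.snd h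
  have hx : ‖x'‖ = ‖x‖ := by
    rw [← sq_eq_sq₀ (norm_nonneg _) (norm_nonneg _)]; linarith
  have hy : ‖y'‖ = ‖y‖ := by
    rw [← sq_eq_sq₀ (norm_nonneg _) (norm_nonneg _)]; linarith
  by_cases h0 : x = 0
  · subst h0
    have h0' : x' = 0 := by simpa using hx
    subst h0'
    by_cases h4 : y = 0
    · subst h4
      exact ⟨1, by simp, by simp, by simpa using hy⟩
    · refine ⟨y' / y, by rw [norm_div, hy, div_self (norm_ne_zero_iff.2 h4)], by simp, ?_⟩
      field_simp
  · have h0' : x' ≠ 0 := by rw [← norm_ne_zero_iff, hx]; exact norm_ne_zero_iff.2 h0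
    refine ⟨x' / x, by rw [norm_div, hx, div_self (norm_ne_zero_iff.2 h0)], by field_simp, ?_⟩
    have h5 := congrArg (starRingEnd ℂ) h3
    have e1 := nsq x
    have e2 := nsq x'
    rw [hx] at e2
    have h6 : (starRingEnd ℂ) x ≠ 0 := by simpa using h0
    simp only [map_mul, Complex.conj_conj, Complex.conj_ofNat] at h5
    field_simp
    apply mul_left_cancel₀ h6
    linear_combination (e2 - e1) * y' + x' * h5 / 2

lemma hv_cont : Continuous (fun p : ℂ × ℂ => hv p.1 p.2) := by
  unfold hv
  have := Complex.continuous_conj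
  fun_prop

/-! ### Frames -/

/-- Pairs of row vectors. -/
abbrev Fr : Type := (Fin 5 → ℂ) × (Fin 5 → ℂ)

/-- Pluecker coordinates. -/
def pl (M : Fr) : Fin 5 → Fin 5 → ℂ := fun i j => M.1 i * M.2 j - M.1 j * M.2 i

lemma pl_eq (M : Fr) : pluecker (Matrix.of ![M.1, M.2]) = pl M := rfl

/-- Frames with orthogonal rows of the same length. -/
structure Good (M : Fr) (l : ℝ) : Prop where
  h1 : ∑ i, ‖M.1 i‖ ^ 2 = l
  h2 : ∑ i, ‖M.2 i‖ ^ 2 = l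
  h3 : ∑ i, M.1 i * (starRingEnd ℂ) (M.2 i) = 0

/-- Four vectors. -/
abbrev W4 : Type := ((V3 × V3) × V3) × V3

/-- The closed pentagon. -/
def cl (v : W4) : Fin 5 → V3 :=
  ![v.1.1.1, v.1.1.2, v.1.2, v.2, -(v.1.1.1 + v.1.1.2 + v.1.2 + v.2)]

lemma cl_inj {v w : W4} (h : ∀ i, cl v i = cl w i) : v = w :=
  Prod.ext (Prod.ext (Prod.ext (h 0) (h 1)) (h 2)) (h 3)

lemma cl_t4 (u : U2) (v : W4) (i : Fin 5) : cl (t4 u v) i = tau u (cl v i) := by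
  fin_cases i <;> simp [cl]

lemma cl_smul (c : ℝ) (v : W4) (i : Fin 5) : cl (c • v) i = c • cl v i := by
  fin_cases i <;> simp [cl, -smul_eq_mul, -Prod.smul_mk]

/-- Perimeter. -/
def NN (v : W4) : ℝ := ∑ i, nu (cl v i)

lemma NN_t4 (u : U2) (v : W4) : NN (t4 u v) = NN v := by
  simp only [NN, cl_t4, nu_tau]

lemma NN_smul {c : ℝ} (hc : 0 ≤ c) (v : W4) : NN (c • v) = c * NN v := by
  simp only [NN, cl_smul, nu_smul _ _ hc, Finset.mul_sum]

lemma NN_pos {v : W4} (hv : v ≠ 0) : 0 < NN v := by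
  refine (Finset.sum_nonneg fun i _ => nu_nonneg _).lt_of_ne' fun h => hv ?_
  rw [Finset.sum_eq_zero_iff_of_nonneg fun i _ => nu_nonneg _] at h
  refine cl_inj fun i => ?_
  by_contra h'
  have h0 : cl (0 : W4) i = 0 := by fin_cases i <;> simp [cl]
  rw [h0] at h'
  exact (nu_pos h').ne' (h i (Finset.mem_univ i))

lemma NN_cont : Continuous NN := by
  have := nu_cont
  unfold NN
  simp only [Fin.sum_univ_five]
  simp only [cl, Matrix.cons_val]
  fun_prop

/-- Normalization. -/
def nrm (v : W4) : W4 := (2 / NN v) • v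

/-- The vectors of a frame. -/
def hop (M : Fr) : W4 := (((hv (M.1 0) (M.2 0), hv (M.1 1) (M.2 1)), hv (M.1 2) (M.2 2)), hv (M.1 3) (M.2 3))

lemma hop_cont : Continuous hop := by
  have h : ∀ i, Continuous (fun M : Fr => hv (M.1 i) (M.2 i)) := fun i =>
    hv_cont.comp (f := fun M : Fr => (M.1 i, M.2 i)) (by fun_prop)
  have h0 := h 0
  have h1 := h 1
  have h2 := h 2
  have h3 := h 3
  unfold hop
  fun_prop

lemma cl_hop {M : Fr} {l : ℝ} (h : Good M l) (i : Fin 5) : cl (hop M) i = hv (M.1 i) (M.2 i) := by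
  have e1 := h.h1
  have e2 := h.h2
  have e3 := h.h3
  simp only [Fin.sum_univ_five] at e1 e2 e3
  fin_cases i
  · rfl
  · rfl
  · rfl
  · rfl
  · refine Prod.ext ?_ ?_
    · simp [cl, hop, hv]
      linarith
    · simp [cl, hop, hv]
      linear_combination -2 * e3

lemma NN_hop {M : Fr} {l : ℝ} (h : Good M l) : NN (hop M) = 2 * l := by
  simp only [NN, cl_hop h, nu_hv, Finset.sum_add_distrib, h.h1, h.h2]
  ring

lemma Good.of_cl {M : Fr} {v : W4} (h : ∀ i, hv (M.1 i) (M.2 i) = cl v i) (hN : NN v = 2) :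
    Good M 1 := by
  have e := hN
  simp only [NN, ← h, nu_hv, Finset.sum_add_distrib] at e
  have hs : ∑ i, hv (M.1 i) (M.2 i) = 0 := by
    simp only [h, Fin.sum_univ_five]
    simp [cl]
  have h1 : ∑ i, ‖M.1 i‖ ^ 2 - ∑ i, ‖M.2 i‖ ^ 2 = 0 := by
    have := congrArg Prod.fst hs
    rw [Prod.fst_sum] at this
    simpa [hv] using this
  have h2 : 2 * ∑ i, M.1 i * (starRingEnd ℂ) (M.2 i) = 0 := by
    have := congrArg Prod.snd hs
    rw [Prod.snd_sum] at this
    simpa [hv, Finset.mul_sum, mul_assoc] using this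
  exact ⟨by linarith, by linarith, by simpa using h2⟩

lemma hop_surj {v : W4} (hN : NN v = 2) : ∃ M, Good M 1 ∧ hop M = v := by
  choose x y hxy using fun i => hv_surj (cl v i)
  have hG : Good (x, y) 1 := Good.of_cl (v := v) hxy hN
  exact ⟨(x, y), hG, cl_inj fun i => by rw [cl_hop hG, hxy]⟩

end GT

set_option linter.unusedSectionVars false
set_option linter.unusedVariables false
set_option linter.unnecessarySimpa false
namespace GT

/-! ### Comparison of frames -/

lemma sesq (a b c d : ℂ) (x y : Fin 5 → ℂ) :
    ∑ i, (a * x i + b * y i) * (starRingEnd ℂ) (c * x i + d * y i) =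
    a * (starRingEnd ℂ) c * ∑ i, x i * (starRingEnd ℂ) (x i) +
    a * (starRingEnd ℂ) d * ∑ i, x i * (starRingEnd ℂ) (y i) +
    b * (starRingEnd ℂ) c * ∑ i, y i * (starRingEnd ℂ) (x i) +
    b * (starRingEnd ℂ) d * ∑ i, y i * (starRingEnd ℂ) (y i) := by
  simp only [Fin.sum_univ_five, map_add, map_mul]
  ring

lemma Good.c1 {M : Fr} {l : ℝ} (h : Good M l) : ∑ i, M.1 i * (starRingEnd ℂ) (M.1 i) = l := by
  rw [← h.h1]
  simp only [← nsq]
  push_cast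
  rfl

lemma Good.c2 {M : Fr} {l : ℝ} (h : Good M l) : ∑ i, M.2 i * (starRingEnd ℂ) (M.2 i) = l := by
  rw [← h.h2]
  simp only [← nsq]
  push_cast
  rfl

lemma Good.c3 {M : Fr} {l : ℝ} (h : Good M l) : ∑ i, M.2 i * (starRingEnd ℂ) (M.1 i) = 0 := by
  have := congrArg (starRingEnd ℂ) h.h3
  simpa [map_sum, mul_comm] using this

lemma Good.of_c {M : Fr} {l : ℝ} (h1 : ∑ i, M.1 i * (starRingEnd ℂ) (M.1 i) = l)
    (h2 : ∑ i, M.2 i * (starRingEnd ℂ) (M.2 i) = l)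
    (h3 : ∑ i, M.1 i * (starRingEnd ℂ) (M.2 i) = 0) : Good M l := by
  simp only [← nsq] at h1 h2
  exact ⟨by exact_mod_cast h1, by exact_mod_cast h2, h3⟩

lemma pl_ne {M : Fr} (h : pl M ≠ 0) : ∃ a b, pl M a b ≠ 0 := by
  by_contra! h'
  exact h (funext fun a => funext fun b => h' a b)

lemma Good.pos {M : Fr} {l : ℝ} (h : Good M l) (hp : pl M ≠ 0) : 0 < l := by
  have h0 : 0 ≤ l := h.h1 ▸ Finset.sum_nonneg fun i _ => by positivity
  refine h0.lt_of_ne' fun hl => hp ?_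
  have h1 := h.h1
  rw [hl, Finset.sum_eq_zero_iff_of_nonneg fun i _ => by positivity] at h1
  have h2 : ∀ i, M.1 i = 0 := fun i => by simpa using h1 i (Finset.mem_univ i)
  funext i j
  simp [pl, h2]

lemma nrm_smul {c : ℝ} (hc : 0 < c) (v : W4) : nrm (c • v) = nrm v := by
  rw [nrm, nrm, NN_smul hc.le, smul_smul]
  congr 1
  by_cases h : NN v = 0
  · simp [h]
  · field_simp

lemma nrm_t4 (u : U2) (v : W4) : nrm (t4 u v) = t4 u (nrm v) := by
  rw [nrm, nrm, NN_t4, map_smul]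

lemma nrm_ne {v : W4} (h : v ≠ 0) : nrm v ≠ 0 :=
  smul_ne_zero (div_pos two_pos (NN_pos h)).ne' h

lemma NN_nrm {v : W4} (h : v ≠ 0) : NN (nrm v) = 2 := by
  have := NN_pos h
  rw [nrm, NN_smul (by positivity)]
  field_simp

lemma nrm_of {v : W4} (h : NN v = 2) : nrm v = v := by
  rw [nrm, h]; simp

lemma nrm_contOn : ContinuousOn nrm (nz W4) := by
  unfold nrm
  have h := NN_cont
  refine ContinuousOn.smul (ContinuousOn.div (by fun_prop) h.continuousOn fun v hv => (NN_pos hv).ne')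
    (by fun_prop)

lemma key1 {M M' : Fr} {l l' : ℝ} (h : Good M l) (h' : Good M' l') (hp : pl M ≠ 0) {c : ℂ} (hc : c ≠ 0)
    (hpl : ∀ i j, pl M' i j = c * pl M i j) : orb t4 (nrm (hop M)) (nrm (hop M')) := by
  obtain ⟨a, b, hab⟩ := pl_ne hp
  have hp' : pl M' ≠ 0 := by
    intro h0
    have := hpl a b
    rw [h0] at this
    exact mul_ne_zero hc hab this.symm
  have lp := h.pos hp
  have lp' := h'.pos hp'
  set p := pl M a b with hpdef
  let g : Matrix (Fin 2) (Fin 2) ℂ := !![(M'.1 a * M.2 b - M'.1 b * M.2 a) / p,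
    (M'.1 b * M.1 a - M'.1 a * M.1 b) / p;
    (M'.2 a * M.2 b - M'.2 b * M.2 a) / p, (M'.2 b * M.1 a - M'.2 a * M.1 b) / p]
  have e1 : ∀ j, M'.1 j = g 0 0 * M.1 j + g 0 1 * M.2 j := by
    intro j
    have q1 := hpl a b
    have q2 := hpl j b
    have q3 := hpl a j
    simp only [pl] at q1 q2 q3
    simp only [g, Matrix.of_apply, Matrix.cons_val', Matrix.cons_val_zero, Matrix.cons_val_one,
      Matrix.cons_val_fin_one]
    field_simp
    apply mul_left_cancel₀ hc
    rw [hpdef]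
    simp only [pl]
    linear_combination (-M'.1 j) * q1 + M'.1 a * q2 + M'.1 b * q3
  have e2 : ∀ j, M'.2 j = g 1 0 * M.1 j + g 1 1 * M.2 j := by
    intro j
    have q1 := hpl a b
    have q2 := hpl j b
    have q3 := hpl a j
    simp only [pl] at q1 q2 q3
    simp only [g, Matrix.of_apply, Matrix.cons_val', Matrix.cons_val_zero, Matrix.cons_val_one,
      Matrix.cons_val_fin_one]
    field_simp
    apply mul_left_cancel₀ hc
    rw [hpdef]
    simp only [pl]
    linear_combination (-M'.2 j) * q1 + M'.2 a * q2 + M'.2 b * q3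
  clear_value g
  have s1 := h'.c1
  have s2 := h'.c2
  have s3 := h'.h3
  have s4 := h'.c3
  simp only [e1, e2, sesq, h.c1, h.c2, h.h3, h.c3] at s1 s2 s3 s4
  set s : ℝ := Real.sqrt (l' / l) with hs
  have sp : 0 < s := Real.sqrt_pos.2 (by positivity)
  have ssq : s ^ 2 = l' / l := Real.sq_sqrt (by positivity)
  have ssq' : (s : ℂ) ^ 2 * l = l' := by
    have : s ^ 2 * l = l' := by rw [ssq]; field_simp
    exact_mod_cast this
  have sc : (s : ℂ) ≠ 0 := by exact_mod_cast sp.ne'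
  have lc : (l : ℂ) ≠ 0 := by exact_mod_cast lp.ne'
  have hu : ((s : ℂ)⁻¹ • g) ∈ Matrix.unitaryGroup (Fin 2) ℂ := by
    rw [Matrix.mem_unitaryGroup_iff]
    ext i j
    have hi : ∀ z w : ℂ, (s : ℂ)⁻¹ * z * ((s : ℂ)⁻¹ * w) = z * w * l / l' := by
      intro z w
      rw [← ssq']
      field_simp
    have lc' : (l' : ℂ) ≠ 0 := by exact_mod_cast lp'.ne'
    fin_cases i <;> fin_cases j <;>
      simp [Matrix.mul_apply, Matrix.star_apply, hi] <;> field_simp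
    · linear_combination s1
    · linear_combination s3
    · linear_combination s4
    · linear_combination s2
  have key : hop M' = s ^ 2 • t4 ⟨_, hu⟩ (hop M) := by
    refine cl_inj fun i => ?_
    rw [cl_smul, cl_t4, cl_hop h', cl_hop h, ← hv_tau, ← hv_smul, e1, e2]
    congr 1 <;> simp <;> field_simp
  rw [key, nrm_smul (by positivity), nrm_t4]
  exact ⟨_, rfl⟩

lemma phase_sq {t : ℂ} (ht : ‖t‖ = 1) : t * (starRingEnd ℂ) t = 1 := by
  rw [Complex.mul_conj, Complex.normSq_eq_norm_sq, ht]; simp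

lemma key2 {M M' : Fr} {l l' : ℝ} (h : Good M l) (h' : Good M' l') (hp : pl M ≠ 0) {c : ℂ} (hc : c ≠ 0)
    {t : Fin 5 → ℂ} (ht : ∀ i, ‖t i‖ = 1)
    (hpl : ∀ i j, pl M' i j = c * t i * t j * pl M i j) : orb t4 (nrm (hop M)) (nrm (hop M')) := by
  let M₂ : Fr := (fun i => t i * M.1 i, fun i => t i * M.2 i)
  have h₂ : Good M₂ l := by
    refine ⟨?_, ?_, ?_⟩
    · simp [M₂, ht, h.h1]
    · simp [M₂, ht, h.h2]
    · rw [← h.h3]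
      refine Finset.sum_congr rfl fun i _ => ?_
      simp only [M₂, map_mul]
      linear_combination M.1 i * (starRingEnd ℂ) (M.2 i) * phase_sq (ht i)
  have e : hop M₂ = hop M := cl_inj fun i => by
    rw [cl_hop h₂, cl_hop h]
    exact hv_phase (ht i) _ _
  have hpl₂ : ∀ i j, pl M₂ i j = t i * t j * pl M i j := by
    intro i j
    simp only [pl, M₂]
    ring
  have hp₂ : pl M₂ ≠ 0 := by
    obtain ⟨a, b, hab⟩ := pl_ne hp
    intro h0
    have := hpl₂ a b
    rw [h0] at this
    have hn : ∀ i, t i ≠ 0 := fun i => by rw [← norm_ne_zero_iff, ht]; norm_num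
    exact mul_ne_zero (mul_ne_zero (hn a) (hn b)) hab this.symm
  rw [← e]
  exact key1 h₂ h' hp₂ hc fun i j => by rw [hpl, hpl₂]; ring

lemma fib {M M' : Fr} (h : Good M 1) (h' : Good M' 1) (u : U2) (he : hop M' = t4 u (hop M)) :
    ∃ c : ℂ, c ≠ 0 ∧ ∃ t ∈ torusT, ∀ i j, pl M' i j = c * t i * t j * pl M i j := by
  have hk : ∀ i, ∃ t : ℂ, ‖t‖ = 1 ∧ M'.1 i = t * (u.1 0 0 * M.1 i + u.1 0 1 * M.2 i) ∧
      M'.2 i = t * (u.1 1 0 * M.1 i + u.1 1 1 * M.2 i) := by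
    intro i
    apply hv_eq
    rw [← cl_hop h', he, cl_t4, cl_hop h, hv_tau]
  choose t ht h1 h2 using hk
  obtain ⟨s, hs⟩ := IsAlgClosed.exists_pow_nat_eq (∏ i, t i) (n := 5) (by norm_num)
  have hsn : ‖s‖ = 1 := by
    have : ‖s‖ ^ 5 = 1 := by rw [← norm_pow, hs, norm_prod]; simp [ht]
    exact (pow_eq_one_iff_of_nonneg (norm_nonneg _) (by norm_num)).1 this
  have hs0 : s ≠ 0 := by rw [← norm_ne_zero_iff, hsn]; norm_num
  have hdet : u.1.det ≠ 0 := by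
    have hg : star u.1 * u.1 = 1 := Matrix.UnitaryGroup.star_mul_self u
    intro h0
    have := congrArg Matrix.det hg
    rw [Matrix.det_mul, h0, mul_zero, Matrix.det_one] at this
    exact zero_ne_one this
  refine ⟨s ^ 2 * u.1.det, mul_ne_zero (pow_ne_zero _ hs0) hdet, fun i => t i / s, ⟨fun i => ?_, ?_⟩, ?_⟩
  · rw [norm_div, ht, hsn, div_one]
  · rw [Finset.prod_div_distrib, ← hs]
    simp [hs0]
  · intro i j
    simp only [pl, h1, h2, Matrix.det_fin_two]
    field_simp
    ring

/-! ### Frames from Pluecker vectors -/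

/-- Discriminant. -/
def disc (M : Fr) : ℝ := (∑ i, ‖M.1 i‖ ^ 2) * (∑ i, ‖M.2 i‖ ^ 2) - ‖∑ i, M.1 i * (starRingEnd ℂ) (M.2 i)‖ ^ 2

/-- Orthogonalization. -/
def gs (M : Fr) : Fr := (fun i => Real.sqrt (disc M) * M.1 i,
  fun i => (-(starRingEnd ℂ) (∑ i, M.1 i * (starRingEnd ℂ) (M.2 i))) * M.1 i +
    ((∑ i, ‖M.1 i‖ ^ 2 : ℝ) : ℂ) * M.2 i)

lemma disc_eq (M : Fr) : 2 * disc M = ∑ i, ∑ j, ‖pl M i j‖ ^ 2 := by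
  have : ((2 * disc M : ℝ) : ℂ) = ((∑ i, ∑ j, ‖pl M i j‖ ^ 2 : ℝ) : ℂ) := by
    rw [disc]
    rw [Complex.ofReal_mul, Complex.ofReal_sub, Complex.ofReal_mul, nsq]
    simp only [Fin.sum_univ_five, Complex.ofReal_add, nsq, pl, map_add, map_sub, map_mul, Complex.conj_conj]
    simp only [Complex.ofReal_ofNat]
    ring
  exact_mod_cast this

lemma disc_pos {M : Fr} (h : pl M ≠ 0) : 0 < disc M := by
  obtain ⟨a, b, hab⟩ := pl_ne h
  have h1 : ‖pl M a b‖ ^ 2 ≤ ∑ j, ‖pl M a j‖ ^ 2 :=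
    Finset.single_le_sum (f := fun j => ‖pl M a j‖ ^ 2) (fun i _ => by positivity) (Finset.mem_univ b)
  have h2 : ∑ j, ‖pl M a j‖ ^ 2 ≤ ∑ i, ∑ j, ‖pl M i j‖ ^ 2 :=
    Finset.single_le_sum (f := fun i => ∑ j, ‖pl M i j‖ ^ 2)
      (fun i _ => Finset.sum_nonneg fun j _ => by positivity) (Finset.mem_univ a)
  have h3 : 0 < ‖pl M a b‖ ^ 2 := by positivity
  rw [← disc_eq] at h2
  linarith

lemma gs_good {M : Fr} (h : pl M ≠ 0) : Good (gs M) ((∑ i, ‖M.1 i‖ ^ 2) * disc M) := by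
  have hd := disc_pos h
  have hd2 : ((Real.sqrt (disc M) : ℝ) : ℂ) ^ 2 = disc M := by
    exact_mod_cast Real.sq_sqrt hd.le
  have hde : (disc M : ℂ) = ((∑ i, ‖M.1 i‖ ^ 2 : ℝ) : ℂ) * ((∑ i, ‖M.2 i‖ ^ 2 : ℝ) : ℂ) -
      (∑ i, M.1 i * (starRingEnd ℂ) (M.2 i)) * (starRingEnd ℂ) (∑ i, M.1 i * (starRingEnd ℂ) (M.2 i)) := by
    rw [disc, Complex.ofReal_sub, Complex.ofReal_mul, nsq]
  have a1 : ∑ i, M.1 i * (starRingEnd ℂ) (M.1 i) = ((∑ i, ‖M.1 i‖ ^ 2 : ℝ) : ℂ) := by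
    simp only [← nsq]; push_cast; rfl
  have a2 : ∑ i, M.2 i * (starRingEnd ℂ) (M.2 i) = ((∑ i, ‖M.2 i‖ ^ 2 : ℝ) : ℂ) := by
    simp only [← nsq]; push_cast; rfl
  have a3 : ∑ i, M.2 i * (starRingEnd ℂ) (M.1 i) =
      (starRingEnd ℂ) (∑ i, M.1 i * (starRingEnd ℂ) (M.2 i)) := by
    rw [map_sum]
    exact Finset.sum_congr rfl fun i _ => by rw [map_mul, Complex.conj_conj, mul_comm]
  set r := Real.sqrt (disc M) with hr
  set α : ℝ := ∑ i, ‖M.1 i‖ ^ 2 with hα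
  set δ : ℝ := ∑ i, ‖M.2 i‖ ^ 2 with hδ
  have e1 : ∀ i, (gs M).1 i = (r : ℂ) * M.1 i + 0 * M.2 i := fun i => by
    simp only [gs, hr]; ring
  have e2 : ∀ i, (gs M).2 i = -((starRingEnd ℂ) (∑ i, M.1 i * (starRingEnd ℂ) (M.2 i))) * M.1 i +
    (α : ℂ) * M.2 i := fun i => rfl
  set β := ∑ i, M.1 i * (starRingEnd ℂ) (M.2 i) with hβ
  apply Good.of_c <;> simp only [e1, e2, sesq, a1, a2, a3, ← hβ] <;>
    simp only [map_neg, map_zero, Complex.conj_conj, Complex.conj_ofReal, Complex.ofReal_mul]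
  · linear_combination (α : ℂ) * hd2
  · linear_combination -(α : ℂ) * hde
  · ring

lemma gs_pl (M : Fr) (i j) : pl (gs M) i j = ((Real.sqrt (disc M) * ∑ i, ‖M.1 i‖ ^ 2 : ℝ) : ℂ) * pl M i j := by
  simp only [pl, gs, Complex.ofReal_mul]
  ring

lemma disc_cont : Continuous disc := by
  have := Complex.continuous_conj
  unfold disc
  fun_prop

lemma gs_cont : Continuous gs := by
  have := Complex.continuous_conj
  have := disc_cont
  unfold gs
  fun_prop

/-- The frame associated to a Pluecker vector. -/
def fr (a b : Fin 5) (p : Fin 5 → Fin 5 → ℂ) : Fr := gs (p a, p b)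

lemma fr_cont (a b : Fin 5) : Continuous (fr a b) := gs_cont.comp (by fun_prop)

lemma cone_pl {p : Fin 5 → Fin 5 → ℂ} (hp : p ∈ plueckerCone) : ∃ M : Fr, pl M = p := by
  obtain ⟨_, M, hM⟩ := hp
  exact ⟨(M 0, M 1), hM⟩

lemma fr_spec {p : Fin 5 → Fin 5 → ℂ} (hp : p ∈ plueckerCone) {a b : Fin 5} (hab : p a b ≠ 0) :
    ∃ l, Good (fr a b p) l ∧ pl (fr a b p) ≠ 0 ∧ ∃ c : ℂ, c ≠ 0 ∧ ∀ i j, pl (fr a b p) i j = c * p i j := by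
  obtain ⟨M, rfl⟩ := cone_pl hp
  have h1 : ∀ i j, pl (pl M a, pl M b) i j = pl M a b * pl M i j := by
    intro i j
    simp only [pl]
    ring
  have h2 : pl (pl M a, pl M b) ≠ 0 := by
    intro h0
    have := h1 a b
    rw [h0] at this
    exact mul_ne_zero hab hab this.symm
  have hG := gs_good h2
  have hs : (∑ i, ‖pl M a i‖ ^ 2) ≠ 0 := by
    refine (lt_of_lt_of_le (b := ‖pl M a b‖ ^ 2) (by positivity) ?_).ne'
    exact Finset.single_le_sum (f := fun j => ‖pl M a j‖ ^ 2) (fun i _ => by positivity) (Finset.mem_univ b)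
  have hc : ((Real.sqrt (disc (pl M a, pl M b)) * ∑ i, ‖pl M a i‖ ^ 2 : ℝ) : ℂ) * pl M a b ≠ 0 := by
    refine mul_ne_zero ?_ hab
    exact_mod_cast mul_ne_zero (Real.sqrt_pos.2 (disc_pos h2)).ne' hs
  have h3 : ∀ i j, pl (fr a b (pl M)) i j =
      ((Real.sqrt (disc (pl M a, pl M b)) * ∑ i, ‖pl M a i‖ ^ 2 : ℝ) : ℂ) * pl M a b * pl M i j := by
    intro i j
    rw [fr, gs_pl, h1, mul_assoc]
  refine ⟨_, hG, ?_, _, hc, h3⟩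
  intro h0
  have := h3 a b
  rw [h0] at this
  exact mul_ne_zero hc hab this.symm

end GT

set_option linter.unusedSectionVars false
set_option linter.unusedVariables false
set_option linter.unnecessarySimpa false
namespace GT

/-! ### The orbit space as an orbit space of nonzero vectors -/

lemma hop_ne {M : Fr} {l : ℝ} (h : Good M l) (hp : pl M ≠ 0) : hop M ≠ 0 := by
  intro h0
  have h1 := NN_hop h
  have h2 : NN (0 : W4) = 0 := by
    have := NN_smul (le_refl (0 : ℝ)) (0 : W4)
    simpa using this
  rw [h0, h2] at h1
  have := h.pos hp
  linarith

lemma cone_ne (p : plueckerCone) : ∃ ab : Fin 5 × Fin 5, (p : Fin 5 → Fin 5 → ℂ) ab.1 ab.2 ≠ 0 := by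
  by_contra! h'
  exact p.2.1 (funext fun a => funext fun b => h' (a, b))

/-- A frame for a point of the cone. -/
def afr (p : plueckerCone) : Fr := fr (cone_ne p).choose.1 (cone_ne p).choose.2 p

lemma afr_spec (p : plueckerCone) : ∃ l, Good (afr p) l ∧ pl (afr p) ≠ 0 ∧
    ∃ c : ℂ, c ≠ 0 ∧ ∀ i j, pl (afr p) i j = c * p.1 i j :=
  fr_spec p.2 (cone_ne p).choose_spec

/-- The map on the cone. -/
def aF (p : plueckerCone) : P t4 :=
  qmk (orb t4) ⟨nrm (hop (afr p)), nrm_ne (hop_ne (afr_spec p).choose_spec.1 (afr_spec p).choose_spec.2.1)⟩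

lemma aF_eq (p : plueckerCone) {M : Fr} {l : ℝ} (h : Good M l) (hp : pl M ≠ 0) {c : ℂ} (hc : c ≠ 0)
    {t : Fin 5 → ℂ} (ht : ∀ i, ‖t i‖ = 1) (hpl : ∀ i j, pl M i j = c * t i * t j * p.1 i j)
    (h0 : nrm (hop M) ∈ nz W4) : aF p = qmk (orb t4) ⟨nrm (hop M), h0⟩ := by
  obtain ⟨l', g, gp, c0, hc0, e⟩ := afr_spec p
  refine qmk_eq.2 (key2 g h gp (c := c / c0) (div_ne_zero hc hc0) ht fun i j => ?_)
  rw [hpl, e]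
  field_simp

lemma aF_cont : Continuous aF := by
  rw [continuous_iff_continuousAt]
  intro p₀
  obtain ⟨⟨a, b⟩, hab⟩ := cone_ne p₀
  set O : Set plueckerCone := {p | p.1 a b ≠ 0} with hO
  have hOo : IsOpen O := by
    have : Continuous fun p : plueckerCone => p.1 a b :=
      (continuous_apply b).comp ((continuous_apply a).comp continuous_subtype_val)
    exact isOpen_compl_singleton.preimage this
  refine ContinuousOn.continuousAt ?_ (hOo.mem_nhds hab)
  rw [continuousOn_iff_continuous_domRestrict]
  have hn : ∀ p : O, hop (fr a b p.1.1) ∈ nz W4 := fun p => by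
    obtain ⟨l, g, gp, _⟩ := fr_spec p.1.2 p.2
    exact hop_ne g gp
  have : O.domRestrict aF = fun p : O => qmk (orb t4) ⟨nrm (hop (fr a b p.1.1)), nrm_ne (hn p)⟩ := by
    funext p
    obtain ⟨l, g, gp, c, hc, e⟩ := fr_spec p.1.2 p.2
    exact aF_eq p.1 g gp hc (t := 1) (by simp) (by simpa using e) _
  rw [this]
  refine (continuous_qmk _ _).comp (Continuous.subtype_mk ?_ _)
  refine nrm_contOn.comp_continuous (f := fun p : O => hop (fr a b p.1.1)) ?_ hn
  exact hop_cont.comp ((fr_cont a b).comp (by fun_prop))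

/-- From the orbit space to the model. -/
def mA : C(GrModT, P t4) where
  toFun := Quot.lift aF (by
    rintro p q ⟨c, hc, t, ht, e⟩
    obtain ⟨l', g, gp, c0, hc0, e0⟩ := afr_spec q
    rw [aF_eq p g gp (c := c0 * c) (mul_ne_zero hc0 hc) ht.1 (fun i j => by rw [e0, e]; ring)
      (nrm_ne (hop_ne g gp))]
    rfl)
  continuous_toFun := continuous_quot_lift _ aF_cont

/-- The Stiefel manifold. -/
def Kf : Set Fr := {M | Good M 1}

lemma Kf_compact : IsCompact Kf := by
  have hj := Complex.continuous_conj
  apply Metric.isCompact_of_isClosed_isBounded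
  · have : Kf = {M : Fr | ∑ i, ‖M.1 i‖ ^ 2 = 1} ∩ ({M : Fr | ∑ i, ‖M.2 i‖ ^ 2 = 1} ∩
      {M : Fr | ∑ i, M.1 i * (starRingEnd ℂ) (M.2 i) = 0}) := by
      ext M
      exact ⟨fun h => ⟨h.h1, h.h2, h.h3⟩, fun h => ⟨h.1, h.2.1, h.2.2⟩⟩
    rw [this]
    refine (isClosed_eq (by fun_prop) (by fun_prop)).inter
      ((isClosed_eq (by fun_prop) (by fun_prop)).inter (isClosed_eq (by fun_prop) (by fun_prop)))
  · rw [isBounded_iff_forall_norm_le]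
    refine ⟨1, fun M hM => ?_⟩
    have hb : ∀ x : Fin 5 → ℂ, ∑ i, ‖x i‖ ^ 2 = 1 → ‖x‖ ≤ 1 := by
      intro x hx
      rw [pi_norm_le_iff_of_nonneg zero_le_one]
      intro i
      have h1 : ‖x i‖ ^ 2 ≤ ∑ i, ‖x i‖ ^ 2 :=
        Finset.single_le_sum (f := fun j => ‖x j‖ ^ 2) (fun i _ => by positivity) (Finset.mem_univ i)
      rw [hx] at h1
      exact (sq_le_one_iff₀ (norm_nonneg _)).1 h1
    exact max_le (hb _ hM.h1) (hb _ hM.h2)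

lemma Good.pl_ne' {M : Fr} (h : Good M 1) : pl M ≠ 0 := by
  intro h0
  have := disc_eq M
  rw [h0, disc, h.h1, h.h2, h.h3] at this
  simp at this

/-- Points of the cone from frames. -/
def kc (M : Kf) : plueckerCone := ⟨pl M.1, Good.pl_ne' M.2, _, pl_eq M.1⟩

/-- The sphere. -/
def S2 : Set W4 := {v | NN v = 2}

/-- The map from the Stiefel manifold. -/
def kS (M : Kf) : S2 := ⟨hop M.1, by rw [S2, Set.mem_ofPred_eq, NN_hop M.2, mul_one]⟩

lemma kS_surj : Function.Surjective kS := fun v => by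
  obtain ⟨M, h, e⟩ := hop_surj v.2
  exact ⟨⟨M, h⟩, Subtype.ext e⟩

lemma kS_quot : Topology.IsQuotientMap kS := by
  have : CompactSpace Kf := isCompact_iff_compactSpace.1 Kf_compact
  have hc : Continuous kS := Continuous.subtype_mk (hop_cont.comp continuous_subtype_val) _
  exact hc.isClosedMap.isQuotientMap hc kS_surj

/-- Class of a frame. -/
def kG (M : Kf) : GrModT := Quot.mk _ (kc M)

lemma kG_cont : Continuous kG := by
  have h : Continuous kc := by
    refine Continuous.subtype_mk ?_ _
    unfold pl
    fun_prop
  exact continuous_quot_mk.comp h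

lemma kG_eq {M M' : Kf} (u : U2) (h : hop M'.1 = t4 u (hop M.1)) : kG M = kG M' :=
  Quot.sound (fib M.2 M'.2 u h)

/-- The map on the sphere. -/
def bS (v : S2) : GrModT := kG (kS_surj v).choose

lemma bS_eq {v : S2} (M : Kf) (h : hop M.1 = v) : bS v = kG M := by
  refine kG_eq 1 ?_
  have := congrArg Subtype.val (kS_surj v).choose_spec
  rw [map_one, h, ← this]
  rfl

lemma bS_cont : Continuous bS := by
  rw [kS_quot.continuous_iff]
  exact kG_cont.congr fun M => (bS_eq M rfl).symm

lemma bS_rel {v w : S2} (u : U2) (h : (w : W4) = t4 u v) : bS v = bS w := by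
  obtain ⟨M, e⟩ := kS_surj v
  obtain ⟨M', e'⟩ := kS_surj w
  have e := congrArg Subtype.val e
  have e' := congrArg Subtype.val e'
  rw [bS_eq M e, bS_eq M' e']
  refine kG_eq u ?_
  rw [← e, ← e'] at h
  exact h

/-- From the model to the orbit space. -/
def mB : C(P t4, GrModT) where
  toFun := Quotient.lift (fun x : nz W4 => bS ⟨nrm x, NN_nrm x.2⟩) (by
    rintro ⟨x, hx⟩ ⟨y, hy⟩ ⟨u, h⟩
    refine bS_rel u ?_
    change t4 u x = y at h
    change nrm y = t4 u (nrm x)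
    rw [← nrm_t4, h])
  continuous_toFun := by
    refine continuous_quot_lift _ (bS_cont.comp (Continuous.subtype_mk ?_ _))
    exact nrm_contOn.comp_continuous continuous_subtype_val fun x => x.2

lemma mB_mk (x : nz W4) : mB (qmk _ x) = bS ⟨nrm x, NN_nrm x.2⟩ := rfl

lemma mA_mk (p : plueckerCone) : mA (Quot.mk _ p) = aF p := rfl

lemma exists_unit {M : Fr} {l : ℝ} (h : Good M l) (hp : pl M ≠ 0) :
    ∃ M₂ : Kf, hop M₂.1 = nrm (hop M) ∧ ∃ c : ℂ, c ≠ 0 ∧ ∀ i j, pl M₂.1 i j = c * pl M i j := by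
  have lp := h.pos hp
  set s : ℝ := (Real.sqrt l)⁻¹ with hs
  have sp : 0 < s := inv_pos.2 (Real.sqrt_pos.2 lp)
  have ssq : s ^ 2 * l = 1 := by
    rw [hs, inv_pow, Real.sq_sqrt lp.le]
    field_simp
  have ssq' : (s : ℂ) ^ 2 * l = 1 := by exact_mod_cast ssq
  have sc : (s : ℂ) ≠ 0 := by exact_mod_cast sp.ne'
  let M₂ : Fr := (fun i => (s : ℂ) * M.1 i, fun i => (s : ℂ) * M.2 i)
  have h₂ : Good M₂ 1 := by
    have c1 := h.c1
    have c2 := h.c2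
    have c3 := h.h3
    simp only [Fin.sum_univ_five] at c1 c2 c3
    apply Good.of_c <;>
      simp only [M₂, map_mul, Complex.conj_ofReal, Fin.sum_univ_five]
    · push_cast; linear_combination (s : ℂ) ^ 2 * c1 + ssq'
    · push_cast; linear_combination (s : ℂ) ^ 2 * c2 + ssq'
    · linear_combination (s : ℂ) ^ 2 * c3
  refine ⟨⟨M₂, h₂⟩, ?_, (s : ℂ) ^ 2, pow_ne_zero _ sc, fun i j => ?_⟩
  · refine cl_inj fun i => ?_
    rw [cl_hop h₂, nrm, cl_smul, cl_hop h, NN_hop h]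
    have : 2 / (2 * l) = s ^ 2 := by
      field_simp
      linarith
    rw [this, ← hv_smul]
  · simp only [M₂, pl]
    ring

lemma mB_mA : mB.comp mA = ContinuousMap.id _ := by
  ext x
  obtain ⟨p, rfl⟩ := Quot.exists_rep x
  obtain ⟨l, g, gp, c0, hc0, e0⟩ := afr_spec p
  obtain ⟨M₂, e₂, c, hc, e⟩ := exists_unit g gp
  have hn := hop_ne g gp
  change mB (aF p) = Quot.mk _ p
  rw [aF, mB_mk]
  rw [bS_eq M₂ (by rw [e₂]; exact (nrm_of (NN_nrm hn)).symm)]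
  refine (Quot.sound ?_).symm
  refine ⟨c * c0, mul_ne_zero hc hc0, 1, ⟨by simp, by simp⟩, fun i j => ?_⟩
  change pl M₂.1 i j = _
  rw [e, e0]
  simp
  ring

lemma qm_nrm : QM (orb t4) (nz W4) (orb t4) (nz W4) nrm :=
  QM.mk' (fun x hx => nrm_ne hx) (by rintro x _ ⟨g, rfl⟩; exact ⟨g, (nrm_t4 _ _).symm⟩) nrm_contOn

lemma mA_mB : (mA.comp mB).Homotopic (ContinuousMap.id _) := by
  have e : mA.comp mB = qmap qm_nrm := by
    refine qext fun x => ?_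
    rw [ContinuousMap.comp_apply, mB_mk, qmap_mk]
    obtain ⟨M, h, e⟩ := hop_surj (NN_nrm x.2)
    rw [bS_eq ⟨M, h⟩ e]
    change aF (kc ⟨M, h⟩) = _
    have hz : nrm (hop M) ∈ nz W4 := nrm_ne (hop_ne h h.pl_ne')
    rw [aF_eq (kc ⟨M, h⟩) h h.pl_ne' one_ne_zero (t := 1) (by simp) (by intro i j; simp [kc]) hz]
    congr 2
    rw [e, nrm_of (NN_nrm x.2)]
  rw [e]
  have hpos : ∀ t ∈ Set.Icc (0 : ℝ) 1, ∀ v : W4, v ≠ 0 → 0 < t + (1 - t) * (2 / NN v) := by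
    intro t ht v hv
    have h2 : 0 < 2 / NN v := div_pos two_pos (NN_pos hv)
    rcases eq_or_lt_of_le ht.1 with h | h
    · rw [← h]; simpa using h2
    · have := mul_nonneg (sub_nonneg.2 ht.2) h2.le
      linarith
  have := qmap_homotopic (sat_nz t4) (fun t v => (t + (1 - t) * (2 / NN v)) • v) qm_nrm
    (QM.id' (subset_refl _))
    (fun x hx => by simpa [nrm] using (orb _).refl _) (fun x hx => by simpa using (orb _).refl _)
    (fun t ht x hx => smul_ne_zero (hpos t ht x hx).ne' hx)
    (by rintro t ht x hx _ hy ⟨g, rfl⟩; exact ⟨g, by rw [NN_t4, map_smul]⟩) (by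
      have hN := NN_cont
      have hd : ContinuousOn (fun p : ℝ × W4 => 2 / NN p.2) (Set.Icc (0 : ℝ) 1 ×ˢ nz W4) :=
        ContinuousOn.div (by fun_prop) (by fun_prop) fun p hp => (NN_pos hp.2).ne'
      fun_prop)
  convert this using 1
  exact qext fun x => rfl

lemma bij_mA (n : ℕ) : Function.Bijective (hmap mA n) :=
  hmap_bij mA mB (by rw [mB_mA]) mA_mB n

/-- Comparison of homology. -/
def eqA (n : ℕ) : H n GrModT ≃ₗ[ℤ] H n (P t4) := LinearEquiv.ofBijective (hmap mA n) (bij_mA n)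

end GT

set_option linter.unusedSectionVars false
set_option linter.unusedVariables false
set_option linter.unnecessarySimpa false
namespace GT

/-! ### Comparison with the singular homology of the statement -/

lemma sc_of {R : Type} [Ring R] (S : ShortComplex (ModuleCat R))
    {M : Type} [AddCommGroup M] [Module R M] (φ : LinearMap.ker S.g.hom →ₗ[R] M)
    (hs : Function.Surjective φ)
    (hker : ∀ x, φ x = 0 ↔ ∃ y, S.f.hom y = x.1) : Nonempty (S.homology ≃ₗ[R] M) := by
  have e2 : S.homology ≃ₗ[R] (LinearMap.ker S.g.hom ⧸ LinearMap.range S.moduleCatToCycles) :=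
    S.moduleCatHomologyIso.toLinearEquiv
  have hr : LinearMap.range S.moduleCatToCycles = LinearMap.ker φ := by
    ext x
    rw [LinearMap.mem_range, LinearMap.mem_ker, hker x]
    constructor
    · rintro ⟨y, hy⟩
      exact ⟨y, congrArg Subtype.val hy⟩
    · rintro ⟨y, hy⟩
      exact ⟨y, Subtype.ext hy⟩
  exact ⟨e2.trans ((Submodule.quotEquivOfEq _ _ hr).trans (LinearMap.quotKerEquivOfSurjective φ hs))⟩

lemma homol_of {R : Type} [Ring R] (K : ChainComplex (ModuleCat R) ℕ) (i k : ℕ)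
    (hk : (ComplexShape.down ℕ).next i = k)
    {M : Type} [AddCommGroup M] [Module R M] (φ : LinearMap.ker (K.d i k).hom →ₗ[R] M)
    (hs : Function.Surjective φ)
    (hker : ∀ x, φ x = 0 ↔ ∃ y, (K.d (i + 1) i).hom y = x.1) : Nonempty (K.homology i ≃+ M) := by
  have e1 := (K.homologyIsoSc' (i + 1) i k (ChainComplex.prev ℕ i) hk).toLinearEquiv
  obtain ⟨e2⟩ := sc_of (K.sc' (i + 1) i k) φ hs hker
  exact ⟨(e1.trans e2).toAddEquiv⟩

/-- Additive maps are linear over the integers. -/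
def addLin {A B : Type} {_ : AddCommGroup A} {_ : AddCommGroup B} {_ : Module ℤ A} {_ : Module ℤ B}
    (f : A →+ B) : A →ₗ[ℤ] B where
  toFun := f
  map_add' := f.map_add
  map_smul' c x := by
    simpa using map_intCast_smul f ℤ ℤ c x

/-- Additive equivalences are linear over the integers. -/
def addLinE {A B : Type} {_ : AddCommGroup A} {_ : AddCommGroup B} {_ : Module ℤ A} {_ : Module ℤ B}
    (f : A ≃+ B) : A ≃ₗ[ℤ] B where
  toFun := f
  invFun := f.symm
  left_inv := f.left_inv
  right_inv := f.right_inv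
  map_add' := f.map_add
  map_smul' := (addLin f.toAddMonoidHom).map_smul

variable {X : Type} [TopologicalSpace X]

/-- Chain groups agree. -/
def EI (X : Type) [TopologicalSpace X] (n : ℕ) : Ch (n + 1) X ≃+ (singularChainComplex X).X n :=
  (Finsupp.domCongr ((TopCat.of X).toSSetObjEquiv (Opposite.op (SimplexCategory.mk n))).symm : _ ≃+
    ((TopCat.toSSet.obj (TopCat.of X)).obj (Opposite.op (SimplexCategory.mk n)) →₀ ℤ))

lemma EI_single (n : ℕ) (σ : C(Dl (n + 1), X)) (a : ℤ) : EI X n (Finsupp.single σ a) =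
    (Finsupp.single (((TopCat.of X).toSSetObjEquiv (Opposite.op (SimplexCategory.mk n))).symm σ) a :
      ((TopCat.toSSet.obj (TopCat.of X)).obj (Opposite.op (SimplexCategory.mk n))) →₀ ℤ) :=
  Finsupp.equivMapDomain_single _ _ _

lemma hom_sum_apply {A B : ModuleCat ℤ} {m : ℕ} (c : Fin m → ℤ) (f : Fin m → (A ⟶ B)) (x : A) :
    (∑ i, c i • f i).hom x = ∑ i, c i • (f i).hom x := by
  rw [ModuleCat.hom_sum, LinearMap.sum_apply]
  exact Finset.sum_congr rfl fun i _ => by rw [ModuleCat.hom_zsmul]; rfl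

lemma sc_d (n : ℕ) (x : (TopCat.toSSet.obj (TopCat.of X)).obj (Opposite.op (SimplexCategory.mk (n + 1))) →₀ ℤ) :
    (((singularChainComplex X).d (n + 1) n).hom x :
      (TopCat.toSSet.obj (TopCat.of X)).obj (Opposite.op (SimplexCategory.mk n)) →₀ ℤ) =
    ∑ i : Fin (n + 2), (-1 : ℤ) ^ (i : ℕ) •
      Finsupp.mapDomain ((TopCat.toSSet.obj (TopCat.of X)).map (SimplexCategory.δ i).op) x := by
  have hd := AlternatingFaceMapComplex.obj_d_eq
    (((SimplicialObject.whiskering (Type) (ModuleCat ℤ)).obj (ModuleCat.free ℤ)).obj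
      (TopCat.toSSet.obj (TopCat.of X))) n
  have h2 := congrArg (fun f => ModuleCat.Hom.hom f x) hd
  exact h2.trans (hom_sum_apply _ _ _)

lemma EI_d (n : ℕ) (c : Ch (n + 2) X) :
    ((singularChainComplex X).d (n + 1) n).hom (EI X (n + 1) c) = EI X n (bd (n + 1) c) := by
  induction c using Finsupp.induction_linear with
  | zero => simp
  | add a b ha hb => simp only [map_add, ha, hb]
  | single σ a =>
    rw [bd_single, Finset.smul_sum, map_sum, EI_single]
    refine (sc_d n _).trans (Finset.sum_congr rfl fun i _ => ?_)
    rw [Finsupp.smul_single, Finsupp.smul_single, EI_single, Finsupp.mapDomain_single,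
      Finsupp.smul_single,
      TopCat.toSSetObjEquiv_symm_naturality (X := TopCat.of X) (SimplexCategory.δ i) σ]
    simp only [smul_eq_mul, mul_one]
    rw [mul_comm]
    rfl

lemma EI_symm_d (n : ℕ) (c : (singularChainComplex X).X (n + 1)) :
    (EI X n).symm (((singularChainComplex X).d (n + 1) n).hom c) = bd (n + 1) ((EI X (n + 1)).symm c) := by
  rw [AddEquiv.symm_apply_eq, ← EI_d, AddEquiv.apply_symm_apply]

lemma homol_succ (X : Type) [TopologicalSpace X] (n : ℕ) :
    Nonempty (singularHomology X (n + 1) ≃+ H (n + 2) X) := by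
  let ψ : LinearMap.ker ((singularChainComplex X).d (n + 1) n).hom →+ Zc X (n + 2) :=
    { toFun := fun x => ⟨(EI X (n + 1)).symm x.1, by
        rw [mem_Zc_succ, ← EI_symm_d, x.2, map_zero]⟩
      map_zero' := Subtype.ext (map_zero (EI X (n + 1)).symm)
      map_add' := fun x y => Subtype.ext (map_add (EI X (n + 1)).symm x.1 y.1) }
  refine homol_of (singularChainComplex X) (n + 1) n (ChainComplex.next_nat_succ n)
    (addLin ((cls (n + 2)).toAddMonoidHom.comp ψ)) ?_ ?_
  · intro y
    obtain ⟨c, rfl⟩ := cls_surj _ y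
    refine ⟨⟨EI X (n + 1) c.1, ?_⟩, ?_⟩
    · rw [LinearMap.mem_ker, EI_d, mem_Zc_succ.1 c.2, map_zero]
    · change cls _ (ψ _) = _
      congr 1
      exact Subtype.ext ((EI X (n + 1)).symm_apply_apply c.1)
  · intro x
    change cls _ (ψ x) = 0 ↔ _
    rw [cls_eq_zero]
    change (∃ b, bd (n + 2) b = (EI X (n + 1)).symm x.1) ↔ _
    constructor
    · rintro ⟨b, hb⟩
      exact ⟨EI X (n + 2) b, by rw [EI_d, hb, AddEquiv.apply_symm_apply]⟩
    · rintro ⟨y, hy⟩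
      exact ⟨(EI X (n + 2)).symm y, by rw [← EI_symm_d, hy]⟩

instance : IsEmpty (Dl 0) := ⟨fun x => by simpa using x.2.2⟩

/-- Empty simplices. -/
def ch0 (X : Type) [TopologicalSpace X] : Ch 0 X ≃ₗ[ℤ] ℤ :=
  haveI : Unique C(Dl 0, X) := ⟨⟨⟨isEmptyElim, by fun_prop⟩⟩, fun f => ContinuousMap.ext isEmptyElim⟩
  Finsupp.uniqueLinearEquiv ℤ ℤ default

lemma homol_zero (X : Type) [TopologicalSpace X] (x : X) (h : Subsingleton (H 1 X)) :
    Nonempty (singularHomology X 0 ≃+ ℤ) := by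
  refine homol_of (singularChainComplex X) 0 0 ChainComplex.next_nat_zero
    (addLin ((ch0 X).toLinearMap.toAddMonoidHom.comp ((bd 0).toAddMonoidHom.comp
      ((EI X 0).symm.toAddMonoidHom.comp (Submodule.subtype _).toAddMonoidHom)))) ?_ ?_
  · intro y
    let σ : C(Dl 1, X) := ContinuousMap.const _ x
    have hb : bd 0 (Finsupp.single σ 1) = Finsupp.single (σ.comp (face 0)) 1 := by
      rw [bd_single]; simp
    obtain ⟨z, hz⟩ : ∃ z : Ch 0 X, ch0 X z = y := ⟨(ch0 X).symm y, by simp⟩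
    obtain ⟨w, hw⟩ : ∃ w : Ch 1 X, bd 0 w = z := by
      clear hz
      induction z using Finsupp.induction_linear with
      | zero => exact ⟨0, by simp⟩
      | add a b ha hb =>
        obtain ⟨u, rfl⟩ := ha
        obtain ⟨v, rfl⟩ := hb
        exact ⟨u + v, by simp⟩
      | single τ a =>
        refine ⟨Finsupp.single σ a, ?_⟩
        have : τ = σ.comp (face 0) := ContinuousMap.ext isEmptyElim
        rw [bd_single, this]; simp
    refine ⟨⟨EI X 0 w, ?_⟩, ?_⟩
    · rw [LinearMap.mem_ker, (singularChainComplex X).shape 0 0 (by simp)]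
      rfl
    · change ch0 X (bd 0 ((EI X 0).symm (EI X 0 w))) = y
      rw [AddEquiv.symm_apply_apply, hw, hz]
  · intro c
    change ch0 X (bd 0 ((EI X 0).symm c.1)) = 0 ↔ _
    rw [LinearEquiv.map_eq_zero_iff]
    constructor
    · intro hc
      obtain ⟨b, hb⟩ := (cls_eq_zero (⟨(EI X 0).symm c.1, mem_Zc_succ.2 hc⟩ : Zc X 1)).1 (Subsingleton.elim _ _)
      exact ⟨EI X 1 b, by rw [EI_d, hb, AddEquiv.apply_symm_apply]⟩
    · rintro ⟨y, hy⟩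
      rw [← hy, EI_symm_d, bd_bd]

/-- A point of the orbit space. -/
def ptG : GrModT := mB (qmk _ ⟨(((((1 : ℝ), (0 : ℂ)), (0, 0)), (0, 0)), (0, 0)), fun h => by
  have h1 := congrArg (fun v : W4 => v.1.1.1.1) h
  simp at h1⟩)

end GT

/-- The orbit space `Gr(2,ℂ⁵)/T` has nontrivial integral homology groups
`H₀ ≅ ℤ`, `H₈ ≅ ℤ` and `H₅ ≅ ℤ/2ℤ`; all other homology groups vanish. -/
theorem homology_of_grassmannian_mod_torus :
    Nonempty ((singularHomology GrModT 0) ≃ₗ[ℤ] ℤ) ∧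
    Nonempty ((singularHomology GrModT 8) ≃ₗ[ℤ] ℤ) ∧
    Nonempty ((singularHomology GrModT 5) ≃ₗ[ℤ] ZMod 2) ∧
    (∀ i : ℕ, i ≠ 0 → i ≠ 5 → i ≠ 8 → Subsingleton (singularHomology GrModT i)) := by
  refine ⟨?_, ?_, ?_, ?_⟩
  · have := GT.Hn_t4 1 (by norm_num) (by norm_num)
    exact (GT.homol_zero _ GT.ptG (GT.eqA 1).injective.subsingleton).map GT.addLinE
  · obtain ⟨e⟩ := GT.homol_succ GrModT 7
    obtain ⟨f⟩ := GT.H9_t4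
    exact ⟨GT.addLinE ((e.trans (GT.eqA 9).toAddEquiv).trans f.toAddEquiv)⟩
  · obtain ⟨e⟩ := GT.homol_succ GrModT 4
    obtain ⟨f⟩ := GT.H6_t4
    exact ⟨GT.addLinE ((e.trans (GT.eqA 6).toAddEquiv).trans f.toAddEquiv)⟩
  · intro i h0 h5 h8
    obtain ⟨n, rfl⟩ := Nat.exists_eq_succ_of_ne_zero h0
    obtain ⟨e⟩ := GT.homol_succ GrModT n
    have := GT.Hn_t4 (n + 2) (by omega) (by omega)
    exact (e.trans (GT.eqA (n + 2)).toAddEquiv).injective.subsingleton
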